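/- arXiv:2307.07284 — 4 statements merged into one kernel-verified Lean document; each statement's English description precedes it below -/
import Mathlib

section
/- For every real ε > 0 and every deterministic delayed-decision algorithm for online Feedback Vertex Set, there exists an instance (n, G) with μ(G) ≥ 1 such that the algorithm's output satisfies |S_n(G)| > (4 − ε)·μ(G). In other words, no deterministic delayed-decision algorithm for online Feedback Vertex Set achieves a strict competitive ratio of 4 − ε. -/
open SimpleGraph

/-- `S` is a feedback vertex set of `G`: removing `S` leaves an acyclic induced subgraph. -/
def IsFVS {n : ℕ} (G : SimpleGraph (Fin n)) (S : Finset (Fin n)) : Prop :=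
  (G.induce {v : Fin n | v ∉ S}).IsAcyclic

/-- `fvsNum G` is the minimum size of a feedback vertex set of `G`. -/
noncomputable def fvsNum {n : ℕ} (G : SimpleGraph (Fin n)) : ℕ :=
  sInf {k : ℕ | ∃ S : Finset (Fin n), IsFVS G S ∧ S.card = k}

/-- A deterministic delayed-decision algorithm for online Feedback Vertex Set.
Vertices of an instance `(n, G)` arrive in the order `0, 1, …, n-1`; after the `i`-th
arrival the algorithm has irrevocably selected the set `S n G i ⊆ {0, …, i-1}`. -/
structure DelayedFVSAlgorithm where
  /-- the set selected after seeing the first `i` vertices -/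
  S : ∀ n : ℕ, SimpleGraph (Fin n) → ℕ → Finset (Fin n)
  /-- only already presented vertices may be selected -/
  mem_lt : ∀ (n : ℕ) (G : SimpleGraph (Fin n)) (i : ℕ) (v : Fin n),
    v ∈ S n G i → (v : ℕ) < i
  /-- determinism/online condition: on instances agreeing on their `i`-th prefix, the
  selected sets agree -/
  online : ∀ (n m : ℕ) (G : SimpleGraph (Fin n)) (G' : SimpleGraph (Fin m)) (i : ℕ)
      (hn : i ≤ n) (hm : i ≤ m),
      (∀ x y : Fin i, G.Adj (Fin.castLE hn x) (Fin.castLE hn y) ↔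
        G'.Adj (Fin.castLE hm x) (Fin.castLE hm y)) →
      (S n G i).image Fin.val = (S m G' i).image Fin.val
  /-- decisions are irrevocable -/
  irrevocable : ∀ (n : ℕ) (G : SimpleGraph (Fin n)) (i : ℕ), i < n →
    S n G i ⊆ S n G (i + 1)
  /-- a valid partial solution is maintained: the subgraph induced on the presented,
  non-selected vertices is acyclic -/
  valid : ∀ (n : ℕ) (G : SimpleGraph (Fin n)) (i : ℕ), i ≤ n →
    (G.induce {v : Fin n | (v : ℕ) < i ∧ v ∉ S n G i}).IsAcyclic

namespace SimpleGraph

variable {V : Type*} {G G' : SimpleGraph V} {A B : Set V}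

theorem IsAcyclic.induce_of_adj_imp (h : (G'.induce B).IsAcyclic) (hAB : A ⊆ B)
    (hadj : ∀ u ∈ A, ∀ v ∈ A, G.Adj u v → G'.Adj u v) : (G.induce A).IsAcyclic :=
  h.comap (⟨Set.inclusion hAB, fun {u v} huv ↦ hadj u u.2 v v.2 huv⟩ : G.induce A →g G'.induce B)
    (Set.inclusion_injective hAB)

theorem Walk.support_subset_of_adj_closed {P : V → Prop} (hP : ∀ u v, G.Adj u v → P u → P v)
    {u v : V} (w : G.Walk u v) (hu : P u) : ∀ x ∈ w.support, P x := by
  induction w with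
  | nil => simpa using hu
  | cons h w ih =>
    intro x hx
    rw [Walk.support_cons, List.mem_cons] at hx
    rcases hx with rfl | hx
    · exact hu
    · exact ih (hP _ _ h hu) x hx

theorem Walk.IsCycle.not_isAcyclic_induce {v : V} {c : G.Walk v v} (hc : c.IsCycle)
    (hA : ∀ x ∈ c.support, x ∈ A) : ¬ (G.induce A).IsAcyclic := by
  intro h
  refine h (c.induce A hA) ?_
  rw [← Walk.isCycle_map_iff_of_injective
    (f := (Embedding.induce A : G.induce A ↪g G).toHom) Subtype.val_injective]
  rwa [Walk.map_induce]

theorem IsAcyclic.induce_union_of_not_adj (hA : (G.induce A).IsAcyclic)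
    (hB : (G.induce B).IsAcyclic) (hAB : ∀ a ∈ A, ∀ b ∈ B, ¬ G.Adj a b) :
    (G.induce (A ∪ B)).IsAcyclic := by
  intro v c hc
  have hc' := hc.map (f := (Embedding.induce (A ∪ B) : G.induce (A ∪ B) ↪g G).toHom)
    Subtype.val_injective
  rcases v.2 with hv | hv
  · refine hc'.not_isAcyclic_induce (A := A) ?_ hA
    have := c.support_subset_of_adj_closed (P := fun x : ↥(A ∪ B) ↦ (x : V) ∈ A)
      (fun x y hxy hx ↦ y.2.resolve_right fun hy ↦ hAB _ hx _ hy hxy) hv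
    intro x hx
    rw [Walk.support_map, List.mem_map] at hx
    obtain ⟨y, hy, rfl⟩ := hx
    exact this y hy
  · refine hc'.not_isAcyclic_induce (A := B) ?_ hB
    have := c.support_subset_of_adj_closed (P := fun x : ↥(A ∪ B) ↦ (x : V) ∈ B)
      (fun x y hxy hx ↦ y.2.resolve_left fun hy ↦ hAB _ hy _ hx hxy.symm) hv
    intro x hx
    rw [Walk.support_map, List.mem_map] at hx
    obtain ⟨y, hy, rfl⟩ := hx
    exact this y hy

/-- Two forests joined by at most one edge form a forest. -/
theorem IsAcyclic.induce_union (hA : (G.induce A).IsAcyclic) (hB : (G.induce B).IsAcyclic)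
    (hdisj : Disjoint A B)
    (hAB : ∀ a ∈ A, ∀ b ∈ B, ∀ a' ∈ A, ∀ b' ∈ B, G.Adj a b → G.Adj a' b' → a = a' ∧ b = b') :
    (G.induce (A ∪ B)).IsAcyclic := by
  by_cases hex : ∃ a ∈ A, ∃ b ∈ B, G.Adj a b
  swap
  · push Not at hex
    exact hA.induce_union_of_not_adj hB hex
  obtain ⟨a, ha, b, hb, hab⟩ := hex
  have hbA : b ∉ A := fun h ↦ hdisj.le_bot ⟨h, hb⟩
  have hcross : ∀ u ∈ A, ∀ v ∈ B, ¬ (G.deleteEdges {s(a, b)}).Adj u v := by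
    intro u hu v hv huv
    rw [deleteEdges_adj] at huv
    obtain ⟨rfl, rfl⟩ := hAB a ha b hb u hu v hv hab huv.1
    exact huv.2 rfl
  have hle : ∀ C : Set V, ∀ u ∈ C, ∀ v ∈ C, (G.deleteEdges {s(a, b)}).Adj u v → G.Adj u v :=
    fun _ u _ v _ h ↦ (deleteEdges_adj.1 h).1
  have hH : ((G.deleteEdges {s(a, b)}).induce (A ∪ B)).IsAcyclic :=
    (hA.induce_of_adj_imp le_rfl (hle A)).induce_union_of_not_adj
      (hB.induce_of_adj_imp le_rfl (hle B)) hcross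
  have hnr : ¬ ((G.deleteEdges {s(a, b)}).induce (A ∪ B)).Reachable
      ⟨a, Or.inl ha⟩ ⟨b, Or.inr hb⟩ := by
    rintro ⟨w⟩
    exact hbA (w.support_subset_of_adj_closed (P := fun x : ↥(A ∪ B) ↦ (x : V) ∈ A)
      (fun x y hxy hx ↦ y.2.resolve_right fun hy ↦ hcross _ hx _ hy hxy) ha _
      w.end_mem_support)
  refine (hH.sup_edge_of_not_reachable hnr).anti ?_
  intro u v huv
  by_cases he : s((u : V), (v : V)) = s(a, b)
  · right
    rw [edge_adj]
    refine ⟨?_, huv.ne⟩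
    rw [Sym2.eq_iff] at he
    simpa [Subtype.ext_iff, eq_comm] using he
  · left
    exact deleteEdges_adj.2 ⟨huv, he⟩

/-- Adding a vertex with at most one neighbour to a forest gives a forest. -/
theorem IsAcyclic.induce_insert (hA : (G.induce A).IsAcyclic) (v : V)
    (hv : ∀ a ∈ A, ∀ a' ∈ A, G.Adj v a → G.Adj v a' → a = a') :
    (G.induce (insert v A)).IsAcyclic := by
  by_cases hvA : v ∈ A
  · rwa [Set.insert_eq_of_mem hvA]
  have hs : (G.induce {v}).IsAcyclic := IsAcyclic.of_subsingleton
  rw [Set.insert_eq, Set.union_comm]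
  refine hA.induce_union hs (by simpa using hvA) ?_
  rintro a ha _ rfl c hc _ rfl hac hcb
  exact ⟨hv a ha c hc hac.symm hcb.symm, rfl⟩

/-- A set of vertices in which every vertex has two neighbours induces a cycle. -/
theorem not_isAcyclic_induce_of_two_neighbors {X : Finset V} (hX : X.Nonempty)
    (h : ∀ v ∈ X, ∃ a ∈ X, ∃ b ∈ X, a ≠ b ∧ G.Adj v a ∧ G.Adj v b) :
    ¬ (G.induce (X : Set V)).IsAcyclic := by
  intro hac
  have : Nonempty (X : Set V) := hX.to_subtype
  obtain ⟨u, v, p, hp, hmax⟩ :=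
    Walk.exists_isPath_forall_isPath_length_le_length (G.induce (X : Set V))
  have key : ∀ w, (G.induce (X : Set V)).Adj v w → w = p.penultimate := by
    intro w hw
    refine hac.eq_penultimate_of_adj_end hp hw ?_
    by_contra hws
    have := hmax _ _ _ (hp.concat hws hw)
    simp at this
  obtain ⟨a, ha, b, hb, hne, hva, hvb⟩ := h v v.2
  have h1 := key ⟨a, ha⟩ hva
  have h2 := key ⟨b, hb⟩ hvb
  exact hne (congrArg Subtype.val (h1.trans h2.symm))

end SimpleGraph

/-- Removing `F` from the subgraph of `G` induced on `{0, …, n - 1}` leaves a forest. -/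
def ForestOff (G : SimpleGraph ℕ) (n : ℕ) (F : Finset ℕ) : Prop :=
  (G.induce {v | v < n ∧ v ∉ F}).IsAcyclic

/-- The first `n` vertices of `G` and `G'` induce the same graph. -/
def PrefixAgree (G G' : SimpleGraph ℕ) (n : ℕ) : Prop :=
  ∀ u < n, ∀ v < n, G.Adj u v ↔ G'.Adj u v

theorem PrefixAgree.trans {G G' G'' : SimpleGraph ℕ} {n m : ℕ} (h : PrefixAgree G G' n)
    (h' : PrefixAgree G' G'' m) (hnm : n ≤ m) : PrefixAgree G G'' n :=
  fun u hu v hv ↦ (h u hu v hv).trans (h' u (hu.trans_le hnm) v (hv.trans_le hnm))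

theorem ForestOff.of_prefixAgree {G G' : SimpleGraph ℕ} {n m : ℕ} {F F' : Finset ℕ}
    (h : ForestOff G' m F) (hF : F ⊆ F') (hnm : n ≤ m) (hG : PrefixAgree G G' n) :
    ForestOff G n F' :=
  h.induce_of_adj_imp (fun _ hv ↦ ⟨hv.1.trans_le hnm, fun hm ↦ hv.2 (hF hm)⟩)
    fun u hu v hv huv ↦ (hG u hu.1 v hv.1).1 huv

theorem ForestOff.mono {G : SimpleGraph ℕ} {n : ℕ} {F F' : Finset ℕ} (h : ForestOff G n F)
    (hF : F ⊆ F') : ForestOff G n F' :=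
  h.of_prefixAgree hF le_rfl fun _ _ _ _ ↦ Iff.rfl

/-- The graph on `ℕ` that agrees with `G` on `{0, …, n - 1}` and whose other edges are those of the
symmetric closure of `R`. -/
def extendGraph (G : SimpleGraph ℕ) (n : ℕ) (R : ℕ → ℕ → Prop) : SimpleGraph ℕ where
  Adj u v := u ≠ v ∧
    (u < n ∧ v < n ∧ G.Adj u v ∨ (n ≤ u ∨ n ≤ v) ∧ (R u v ∨ R v u))
  symm := ⟨fun u v h ↦ by
    have := G.adj_comm u v
    tauto⟩
  loopless := ⟨fun u h ↦ h.1 rfl⟩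

theorem extendGraph_adj {G : SimpleGraph ℕ} {n : ℕ} {R : ℕ → ℕ → Prop} {u v : ℕ} :
    (extendGraph G n R).Adj u v ↔ u ≠ v ∧
      (u < n ∧ v < n ∧ G.Adj u v ∨ (n ≤ u ∨ n ≤ v) ∧ (R u v ∨ R v u)) := Iff.rfl

theorem prefixAgree_extendGraph (G : SimpleGraph ℕ) (n : ℕ) (R : ℕ → ℕ → Prop) :
    PrefixAgree G (extendGraph G n R) n := by
  intro u hu v hv
  rw [extendGraph_adj]
  have := @SimpleGraph.Adj.ne _ G u v
  grind

theorem ForestOff.isAcyclic_extendGraph {G : SimpleGraph ℕ} {n : ℕ} {F : Finset ℕ}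
    (h : ForestOff G n F) (R : ℕ → ℕ → Prop) :
    ((extendGraph G n R).induce {v | v < n ∧ v ∉ F}).IsAcyclic :=
  h.induce_of_adj_imp le_rfl fun u hu v hv ↦ (prefixAgree_extendGraph G n R u hu.1 v hv.1).2

/-! ### Attaching a path of two new vertices to the ends of an edge, or to a single vertex -/

/-- The edges of the path `x, n, n + 1, y`. -/
def earRel (n x y : ℕ) (u v : ℕ) : Prop :=
  u = x ∧ v = n ∨ u = n ∧ v = n + 1 ∨ u = n + 1 ∧ v = y

theorem ForestOff.ear {G : SimpleGraph ℕ} {n x y : ℕ} {F : Finset ℕ} (h : ForestOff G n F)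
    (hx : x < n) (hy : y < n) (hxy : x ∈ F ∨ y ∈ F) :
    ForestOff (extendGraph G n (earRel n x y)) (n + 2) F := by
  have h0 := h.isAcyclic_extendGraph (earRel n x y)
  rcases hxy with hF | hF
  · refine SimpleGraph.IsAcyclic.induce_of_adj_imp
      ((h0.induce_insert (n + 1) ?_).induce_insert n ?_) ?_ fun _ _ _ _ ↦ id
    all_goals
      simp only [extendGraph_adj, earRel, Set.mem_insert_iff, Set.mem_ofPred_eq, Set.subset_def]
      grind
  · refine SimpleGraph.IsAcyclic.induce_of_adj_imp
      ((h0.induce_insert n ?_).induce_insert (n + 1) ?_) ?_ fun _ _ _ _ ↦ id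
    all_goals
      simp only [extendGraph_adj, earRel, Set.mem_insert_iff, Set.mem_ofPred_eq, Set.subset_def]
      grind

/-! ### Adding a disjoint cycle -/

/-- The edges of the cycle on `n, …, n + m`. -/
def cycleRel (n m : ℕ) (u v : ℕ) : Prop :=
  n ≤ u ∧ u ≤ n + m ∧ n ≤ v ∧ v ≤ n + m ∧ (v = u + 1 ∨ u = n ∧ v = n + m)

theorem isAcyclic_extendGraph_cycleRel_Ico (G : SimpleGraph ℕ) {n m p : ℕ} (k : ℕ) (hp : n ≤ p)
    (hk : n < p ∨ p + k ≤ n + m) :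
    ((extendGraph G n (cycleRel n m)).induce (Set.Ico p (p + k))).IsAcyclic := by
  induction k with
  | zero =>
    have : IsEmpty (Set.Ico p (p + 0)) := by simp
    exact SimpleGraph.IsAcyclic.of_subsingleton
  | succ k ih =>
    refine SimpleGraph.IsAcyclic.induce_of_adj_imp
      ((ih (by grind)).induce_insert (p + k) ?_) ?_ fun _ _ _ _ ↦ id
    all_goals
      simp only [extendGraph_adj, cycleRel, Set.mem_insert_iff, Set.mem_Ico, Set.subset_def]
      grind

theorem ForestOff.cycle {G : SimpleGraph ℕ} {n m b : ℕ} {F : Finset ℕ} (h : ForestOff G n F)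
    (hb : n ≤ b) (hbm : b ≤ n + m) :
    ForestOff (extendGraph G n (cycleRel n m)) (n + m + 1) (insert b F) := by
  have h0 := h.isAcyclic_extendGraph (cycleRel n m)
  have h1 := isAcyclic_extendGraph_cycleRel_Ico G (n := n) (m := m) (p := n) (b - n) le_rfl
    (by grind)
  have h2 := isAcyclic_extendGraph_cycleRel_Ico G (n := n) (m := m) (p := b + 1) (n + m - b)
    (by grind) (by grind)
  refine SimpleGraph.IsAcyclic.induce_of_adj_imp
    ((h0.induce_union_of_not_adj h1 ?_).induce_union h2 ?_ ?_) ?_ fun _ _ _ _ ↦ id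
  · simp only [extendGraph_adj, cycleRel, Set.mem_Ico, Set.mem_ofPred_eq]
    grind
  · rw [Set.disjoint_left]
    simp only [Set.mem_union, Set.mem_Ico, Set.mem_ofPred_eq]
    grind
  · simp only [extendGraph_adj, cycleRel, Set.mem_union, Set.mem_Ico, Set.mem_ofPred_eq]
    grind
  · simp only [Finset.mem_insert, Set.mem_union, Set.mem_Ico, Set.mem_ofPred_eq, Set.subset_def]
    grind

/-! ### Connecting two parts by two paths -/

/-- The edges of the paths `x, n, x'` and `y, n + 1, y'`. -/
def linkRel (n x x' y y' : ℕ) (u v : ℕ) : Prop :=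
  u = n ∧ (v = x ∨ v = x') ∨ u = n + 1 ∧ (v = y ∨ v = y')

theorem ForestOff.link {G : SimpleGraph ℕ} {k n x x' y y' : ℕ} {F : Finset ℕ}
    (h : ForestOff G n F) (hk : ∀ u < k, ∀ v, k ≤ v → v < n → ¬ G.Adj u v)
    (hx : x < k) (hy : y < k) (hx' : k ≤ x') (hy' : k ≤ y') (hxn : x' < n) (hyn : y' < n)
    (hF : (x ∈ F ∨ x' ∈ F) ∨ y ∈ F ∨ y' ∈ F) :
    ForestOff (extendGraph G n (linkRel n x x' y y')) (n + 2) F := by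
  have h0 := h.isAcyclic_extendGraph (linkRel n x x' y y')
  have hA : ((extendGraph G n (linkRel n x x' y y')).induce {v | v < k ∧ v ∉ F}).IsAcyclic :=
    h0.induce_of_adj_imp (fun v hv ↦ ⟨by grind, hv.2⟩) fun _ _ _ _ ↦ id
  have hB : ((extendGraph G n (linkRel n x x' y y')).induce
      {v | k ≤ v ∧ v < n ∧ v ∉ F}).IsAcyclic :=
    h0.induce_of_adj_imp (fun v hv ↦ hv.2) fun _ _ _ _ ↦ id
  rcases hF with hF | hF
  · refine SimpleGraph.IsAcyclic.induce_of_adj_imp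
      (((hA.induce_insert (n + 1) ?_).induce_union hB ?_ ?_).induce_insert n ?_)
      ?_ fun _ _ _ _ ↦ id
    all_goals
      simp only [extendGraph_adj, linkRel, Set.mem_insert_iff, Set.mem_union, Set.mem_ofPred_eq,
        Set.subset_def, Set.disjoint_left]
      grind
  · refine SimpleGraph.IsAcyclic.induce_of_adj_imp
      (((hA.induce_insert n ?_).induce_union hB ?_ ?_).induce_insert (n + 1) ?_)
      ?_ fun _ _ _ _ ↦ id
    all_goals
      simp only [extendGraph_adj, linkRel, Set.mem_insert_iff, Set.mem_union, Set.mem_ofPred_eq,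
        Set.subset_def, Set.disjoint_left]
      grind

/-! ### Online selection rules -/

theorem not_forestOff_of_two_neighbors {G : SimpleGraph ℕ} {n : ℕ} {F X : Finset ℕ}
    (hX : X.Nonempty) (hXn : ∀ v ∈ X, v < n) (hXF : ∀ v ∈ X, v ∉ F)
    (h : ∀ v ∈ X, ∃ a ∈ X, ∃ b ∈ X, a ≠ b ∧ G.Adj v a ∧ G.Adj v b) : ¬ ForestOff G n F :=
  fun hG ↦ SimpleGraph.not_isAcyclic_induce_of_two_neighbors hX h <|
    hG.induce_of_adj_imp (fun v hv ↦ ⟨hXn v hv, hXF v hv⟩) fun _ _ _ _ ↦ id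

/-- A delayed-decision algorithm, with instances given by the first `n` vertices of a graph
on `ℕ`. -/
structure SelectionRule where
  /-- the set selected on the first `n` vertices of `G` -/
  D : SimpleGraph ℕ → ℕ → Finset ℕ
  lt_of_mem : ∀ {G n v}, v ∈ D G n → v < n
  mono : ∀ {G G' n m}, n ≤ m → PrefixAgree G G' n → D G n ⊆ D G' m
  valid : ∀ G n, ForestOff G n (D G n)

namespace SelectionRule

variable {r : SelectionRule} {G : SimpleGraph ℕ} {n K B : ℕ}

theorem exists_mem (r : SelectionRule) {X : Finset ℕ} (hX : X.Nonempty) (hXn : ∀ v ∈ X, v < n)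
    (h : ∀ v ∈ X, ∃ a ∈ X, ∃ b ∈ X, a ≠ b ∧ G.Adj v a ∧ G.Adj v b) : ∃ v ∈ X, v ∈ r.D G n := by
  by_contra! hD
  exact not_forestOff_of_two_neighbors hX hXn hD h (r.valid G n)

/-- At most `B` vertices are selected on non-acyclic instances with a feedback vertex set of size
at most `K`. -/
def BoundedBy (r : SelectionRule) (K B : ℕ) : Prop :=
  ∀ (G : SimpleGraph ℕ) (n : ℕ) (F : Finset ℕ), F.card ≤ K → ForestOff G n F →
    ¬ ForestOff G n ∅ → (r.D G n).card ≤ B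

theorem exists_mem_ear (r : SelectionRule) {x y : ℕ} (hx : x < n) (hy : y < n)
    (hxy : x = y ∨ G.Adj x y) :
    ∃ v, (v = x ∨ v = y ∨ v = n ∨ v = n + 1) ∧
      v ∈ r.D (extendGraph G n (earRel n x y)) (n + 2) := by
  have hne := fun h : G.Adj x y ↦ h.ne
  have hsymm := G.adj_comm x y
  obtain ⟨v, hv, hvD⟩ := r.exists_mem (G := extendGraph G n (earRel n x y)) (n := n + 2)
    (X := {x, y, n, n + 1}) (by simp) (by grind) (by
      intro v hv
      simp only [Finset.mem_insert, Finset.mem_singleton] at hv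
      rcases hv with rfl | rfl | rfl | rfl
      · by_cases h : v = y
        · refine ⟨n, by simp, n + 1, by simp, by simp, ?_⟩
          simp only [extendGraph_adj, earRel]
          grind
        · refine ⟨y, by simp, n, by simp, by grind, ?_⟩
          simp only [extendGraph_adj, earRel]
          grind
      · by_cases h : x = v
        · refine ⟨n, by simp, n + 1, by simp, by simp, ?_⟩
          simp only [extendGraph_adj, earRel]
          grind
        · refine ⟨x, by simp, n + 1, by simp, by grind, ?_⟩
          simp only [extendGraph_adj, earRel]
          grind
      · refine ⟨x, by simp, v + 1, by simp, by grind, ?_⟩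
        simp only [extendGraph_adj, earRel]
        grind
      · refine ⟨y, by simp, n, by simp, by grind, ?_⟩
        simp only [extendGraph_adj, earRel]
        grind)
  exact ⟨v, by simpa using hv, hvD⟩

/-- The adversary can force one end of an edge (or a given vertex) to be selected, using an
extension that preserves all feedback vertex sets meeting this edge. -/
theorem BoundedBy.exists_select_edge (hr : r.BoundedBy K B) {x y : ℕ} (hx : x < n) (hy : y < n)
    (hxy : x = y ∨ G.Adj x y) {F₀ : Finset ℕ} (hcard : F₀.card ≤ K) (hF₀ : x ∈ F₀ ∨ y ∈ F₀)
    (hG : ForestOff G n F₀) (hne : ¬ ForestOff G n ∅) :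
    ∃ (G' : SimpleGraph ℕ) (n' : ℕ), n ≤ n' ∧ PrefixAgree G G' n ∧
      (x ∈ r.D G' n' ∨ y ∈ r.D G' n') ∧
      ∀ F, (x ∈ F ∨ y ∈ F) → ForestOff G n F → ForestOff G' n' F := by
  obtain ⟨j, hj⟩ : ∃ j, B < (r.D G n).card + j := ⟨B + 1, by omega⟩
  induction j generalizing G n with
  | zero => exact absurd (hr G n F₀ hcard hG hne) (by omega)
  | succ j ih =>
    have hag := prefixAgree_extendGraph G n (earRel n x y)
    obtain ⟨v, hv, hvD⟩ := r.exists_mem_ear hx hy hxy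
    have hear : ∀ F, (x ∈ F ∨ y ∈ F) → ForestOff G n F →
        ForestOff (extendGraph G n (earRel n x y)) (n + 2) F := fun F hF h ↦ h.ear hx hy hF
    by_cases hdone : x ∈ r.D (extendGraph G n (earRel n x y)) (n + 2) ∨
        y ∈ r.D (extendGraph G n (earRel n x y)) (n + 2)
    · exact ⟨_, n + 2, by omega, hag, hdone, hear⟩
    have hnv : n ≤ v := by grind
    have hlt : (r.D G n).card < (r.D (extendGraph G n (earRel n x y)) (n + 2)).card :=
      Finset.card_lt_card <| Finset.ssubset_iff_subset_ne.2
        ⟨r.mono (by omega) hag, fun h ↦ absurd (r.lt_of_mem (h ▸ hvD)) (by omega)⟩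
    obtain ⟨G', n', hn', hag', hD, hF⟩ := ih (by omega) (by omega)
      (hxy.imp_right (hag x hx y hy).1) (hear F₀ hF₀ hG)
      (fun h ↦ hne (h.of_prefixAgree le_rfl (by omega) hag)) (by omega)
    exact ⟨G', n', by omega, hag.trans hag' (by omega), hD, fun F hm hfor ↦ hF F hm (hear F hm hfor)⟩

/-- The adversary can force both ends of an edge to be selected, using an extension that
preserves all feedback vertex sets containing a certain end of this edge. -/
theorem BoundedBy.exists_select_ends (hr : r.BoundedBy K B) {x y : ℕ} (hx : x < n) (hy : y < n)
    (hxy : G.Adj x y)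
    (hF : ∀ f, f = x ∨ f = y → ∃ F₀ : Finset ℕ, F₀.card ≤ K ∧ f ∈ F₀ ∧ ForestOff G n F₀)
    (hne : ¬ ForestOff G n ∅) :
    ∃ (f : ℕ) (G' : SimpleGraph ℕ) (n' : ℕ), (f = x ∨ f = y) ∧ n ≤ n' ∧ PrefixAgree G G' n ∧
      x ∈ r.D G' n' ∧ y ∈ r.D G' n' ∧
      ∀ F, f ∈ F → ForestOff G n F → ForestOff G' n' F := by
  obtain ⟨F₁, hF₁, hxF₁, hG₁⟩ := hF x (Or.inl rfl)
  obtain ⟨G₁, n₁, hn₁, hag₁, hD₁, hfor₁⟩ :=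
    hr.exists_select_edge hx hy (Or.inr hxy) hF₁ (Or.inl hxF₁) hG₁ hne
  obtain ⟨f, g, hfg, hgD⟩ : ∃ f g, (f = x ∧ g = y ∨ f = y ∧ g = x) ∧ g ∈ r.D G₁ n₁ := by grind
  have hfn : f < n := by grind
  obtain ⟨F₂, hF₂, hfF₂, hG₂⟩ := hF f (by grind)
  obtain ⟨G₂, n₂, hn₂, hag₂, hD₂, hfor₂⟩ := hr.exists_select_edge (hfn.trans_le hn₁)
    (hfn.trans_le hn₁) (Or.inl rfl) hF₂ (Or.inl hfF₂) (hfor₁ F₂ (by grind) hG₂)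
    (fun h ↦ hne (h.of_prefixAgree le_rfl hn₁ hag₁))
  have hgD₂ := r.mono hn₂ hag₂ hgD
  exact ⟨f, G₂, n₂, by grind, hn₁.trans hn₂, hag₁.trans hag₂ hn₁, by grind, by grind,
    fun F hF h ↦ hfor₂ F (Or.inl hF) (hfor₁ F (by grind) h)⟩

/-- After `k` rounds, `F` together with an arbitrary vertex of the cycle through
`s, …, s + 2 * L` is a feedback vertex set. -/
structure FreeCycle (r : SelectionRule) (L k : ℕ) (G : SimpleGraph ℕ) (n s : ℕ)
    (F : Finset ℕ) : Prop where
  lt : s + 2 * L < n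
  adj : ∀ v, s ≤ v → v < s + 2 * L → G.Adj v (v + 1)
  card_le : F.card ≤ k
  forestOff : ∀ b, s ≤ b → b ≤ s + 2 * L → ForestOff G n (insert b F)
  le_card : 4 * k + 1 ≤ (r.D G n).card
  not_forestOff : ¬ ForestOff G n ∅

theorem cycle_two_neighbors (G : SimpleGraph ℕ) (n : ℕ) {L : ℕ} (hL : 0 < L) :
    ∀ v ∈ Finset.Icc n (n + 2 * L), ∃ a ∈ Finset.Icc n (n + 2 * L),
      ∃ b ∈ Finset.Icc n (n + 2 * L), a ≠ b ∧
        (extendGraph G n (cycleRel n (2 * L))).Adj v a ∧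
        (extendGraph G n (cycleRel n (2 * L))).Adj v b := by
  intro v hv
  rw [Finset.mem_Icc] at hv
  refine ⟨if v = n then n + 2 * L else v - 1, ?_, if v = n + 2 * L then n else v + 1, ?_, ?_, ?_⟩
  · grind
  · grind
  · grind
  · simp only [extendGraph_adj, cycleRel]
    grind

theorem exists_mem_cycle (r : SelectionRule) (G : SimpleGraph ℕ) (n : ℕ) {L : ℕ} (hL : 0 < L) :
    ∃ v, n ≤ v ∧ v ∈ r.D (extendGraph G n (cycleRel n (2 * L))) (n + 2 * L + 1) := by
  obtain ⟨v, hv, hvD⟩ := r.exists_mem (n := n + 2 * L + 1) (X := Finset.Icc n (n + 2 * L))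
    (by simp) (by grind) (cycle_two_neighbors G n hL)
  exact ⟨v, (Finset.mem_Icc.1 hv).1, hvD⟩

theorem exists_freeCycle_zero (r : SelectionRule) {L : ℕ} (hL : 0 < L) :
    ∃ G n s F, r.FreeCycle L 0 G n s F := by
  refine ⟨extendGraph ⊥ 0 (cycleRel 0 (2 * L)), 0 + 2 * L + 1, 0, ∅, ?_, ?_, ?_, ?_, ?_, ?_⟩
  · omega
  · intro v hv hvL
    simp only [extendGraph_adj, cycleRel]
    grind
  · simp
  · intro b hb hbL
    refine ForestOff.cycle (F := ∅) ?_ hb hbL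
    exact SimpleGraph.IsAcyclic.induce SimpleGraph.isAcyclic_bot _
  · obtain ⟨v, -, hv⟩ := r.exists_mem_cycle ⊥ 0 hL
    exact Finset.card_pos.2 ⟨v, hv⟩
  · exact not_forestOff_of_two_neighbors (X := Finset.Icc 0 (0 + 2 * L)) (by simp) (by grind)
      (by simp) (cycle_two_neighbors ⊥ 0 hL)

theorem exists_consecutive_notMem {D : Finset ℕ} {L : ℕ} (hD : D.card < L) (s : ℕ) :
    ∃ x, s ≤ x ∧ x + 1 < s + 2 * L ∧ x ∉ D ∧ x + 1 ∉ D := by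
  obtain ⟨i, hi, hiD⟩ := Finset.exists_mem_notMem_of_card_lt_card
    (s := D.image fun v ↦ (v - s) / 2) (t := Finset.range L)
    (by simpa using Finset.card_image_le.trans_lt hD)
  rw [Finset.mem_range] at hi
  simp only [Finset.mem_image, not_exists, not_and] at hiD
  exact ⟨s + 2 * i, by omega, by omega, fun h ↦ hiD _ h (by omega), fun h ↦ hiD _ h (by omega)⟩

theorem exists_mem_link (r : SelectionRule) {x x' : ℕ} (hx : x + 1 < x') (hn : x' + 1 < n)
    (hadj : G.Adj x (x + 1)) (hadj' : G.Adj x' (x' + 1)) :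
    ∃ v, (v = x ∨ v = x + 1 ∨ v = x' ∨ v = x' + 1 ∨ v = n ∨ v = n + 1) ∧
      v ∈ r.D (extendGraph G n (linkRel n x x' (x + 1) (x' + 1))) (n + 2) := by
  have hsymm := hadj.symm
  have hsymm' := hadj'.symm
  obtain ⟨v, hv, hvD⟩ := r.exists_mem (n := n + 2)
    (G := extendGraph G n (linkRel n x x' (x + 1) (x' + 1)))
    (X := {x, x + 1, x', x' + 1, n, n + 1}) (by simp) (by grind) (by
      intro v hv
      simp only [extendGraph_adj, linkRel]
      simp only [Finset.mem_insert, Finset.mem_singleton] at hv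
      rcases hv with rfl | rfl | rfl | rfl | rfl | rfl
      · exact ⟨v + 1, by simp, n, by simp, by grind⟩
      · exact ⟨x, by simp, n + 1, by simp, by grind⟩
      · exact ⟨v + 1, by simp, n, by simp, by grind⟩
      · exact ⟨x', by simp, n + 1, by simp, by grind⟩
      · exact ⟨x, by simp, x', by simp, by grind⟩
      · exact ⟨x + 1, by simp, x' + 1, by simp, by grind⟩)
  exact ⟨v, by simpa using hv, hvD⟩

theorem card_add_three_le {S T : Finset ℕ} (hST : S ⊆ T) {a b c : ℕ} (ha : a ∈ T) (hb : b ∈ T)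
    (hc : c ∈ T) (haS : a ∉ S) (hbS : b ∉ S) (hcS : c ∉ S) (hab : a ≠ b) (hac : a ≠ c)
    (hbc : b ≠ c) : S.card + 3 ≤ T.card := by
  have h : insert a (insert b (insert c S)) ⊆ T := by grind
  have := Finset.card_le_card h
  rwa [Finset.card_insert_of_notMem (by grind), Finset.card_insert_of_notMem (by grind),
    Finset.card_insert_of_notMem hcS] at this

/-- One round of the adversary: a new disjoint cycle is presented and linked to the free cycle by
two paths through consecutive vertices. If the new cycle loses one of its two linked vertices, it
becomes the free cycle and the linked vertices of the old one are both forced to be selected;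
otherwise the roles are exchanged. -/
theorem FreeCycle.exists_succ (hr : r.BoundedBy K B) {L k s : ℕ} {F : Finset ℕ} (hL : B < L)
    (hk : k + 2 ≤ K) (h : r.FreeCycle L k G n s F) :
    ∃ G' n' s' F', r.FreeCycle L (k + 1) G' n' s' F' := by
  obtain ⟨u, hu, huD⟩ := r.exists_mem_cycle G n (L := L) (by omega)
  have hag₁ := prefixAgree_extendGraph G n (cycleRel n (2 * L))
  have hfor₁ : ∀ b b', s ≤ b → b ≤ s + 2 * L → n ≤ b' → b' ≤ n + 2 * L →
      ForestOff (extendGraph G n (cycleRel n (2 * L))) (n + 2 * L + 1)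
        (insert b' (insert b F)) := fun b b' h1 h2 h3 h4 ↦ (h.forestOff b h1 h2).cycle h3 h4
  have hadj₁ : ∀ v, n ≤ v → v < n + 2 * L →
      (extendGraph G n (cycleRel n (2 * L))).Adj v (v + 1) := by
    intro v hv hvL
    simp only [extendGraph_adj, cycleRel]
    grind
  have hsep : ∀ u < n, ∀ v, n ≤ v → v < n + 2 * L + 1 →
      ¬ (extendGraph G n (cycleRel n (2 * L))).Adj u v := by
    simp only [extendGraph_adj, cycleRel]
    grind
  generalize extendGraph G n (cycleRel n (2 * L)) = G₁ at *
  obtain ⟨n₁, hn₁⟩ : ∃ n₁, n₁ = n + 2 * L + 1 := ⟨_, rfl⟩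
  rw [← hn₁] at huD hfor₁ hsep
  have hne₁ : ¬ ForestOff G₁ n₁ ∅ :=
    fun h' ↦ h.not_forestOff (h'.of_prefixAgree le_rfl (by omega) hag₁)
  have hlt := h.lt
  have hcard₁ : 4 * k + 2 ≤ (r.D G₁ n₁).card := by
    have : (r.D G n).card < (r.D G₁ n₁).card :=
      Finset.card_lt_card <| Finset.ssubset_iff_subset_ne.2
        ⟨r.mono (by omega) hag₁, fun h ↦ absurd (r.lt_of_mem (h ▸ huD)) (by omega)⟩
    have := h.le_card
    omega
  have hcardF : ∀ b b', (insert b' (insert b F)).card ≤ K := by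
    intro b b'
    have h1 := Finset.card_insert_le b' (insert b F)
    have h2 := Finset.card_insert_le b F
    have h3 := h.card_le
    omega
  have hDL : (r.D G₁ n₁).card < L :=
    (hr G₁ n₁ _ (hcardF s n) (hfor₁ s n le_rfl (by omega) le_rfl (by omega)) hne₁).trans_lt hL
  obtain ⟨x, hx1, hx2, hx3, hx4⟩ := exists_consecutive_notMem hDL s
  obtain ⟨x', hx1', hx2', hx3', hx4'⟩ := exists_consecutive_notMem hDL n
  have hadjx := (hag₁ x (by omega) (x + 1) (by omega)).1 (h.adj x hx1 (by omega))
  have hadjx' := hadj₁ x' hx1' (by omega)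
  obtain ⟨v, hv, hvD⟩ := r.exists_mem_link (n := n₁) (by omega) (by omega) hadjx hadjx'
  have hag₂ := prefixAgree_extendGraph G₁ n₁ (linkRel n₁ x x' (x + 1) (x' + 1))
  have hfor₂ : ∀ b b', s ≤ b → b ≤ s + 2 * L → n ≤ b' → b' ≤ n + 2 * L →
      (b = x ∨ b = x + 1 ∨ b' = x' ∨ b' = x' + 1) →
      ForestOff (extendGraph G₁ n₁ (linkRel n₁ x x' (x + 1) (x' + 1))) (n₁ + 2)
        (insert b' (insert b F)) := fun b b' h1 h2 h3 h4 h5 ↦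
    (hfor₁ b b' h1 h2 h3 h4).link hsep (by omega) (by omega) (by omega) (by omega)
      (by omega) (by omega) (by grind)
  generalize extendGraph G₁ n₁ (linkRel n₁ x x' (x + 1) (x' + 1)) = G₂ at *
  have hne₂ : ¬ ForestOff G₂ (n₁ + 2) ∅ :=
    fun h' ↦ hne₁ (h'.of_prefixAgree le_rfl (by omega) hag₂)
  have hvn : ∀ a, a ∈ r.D G₁ n₁ → a < n₁ := fun a ↦ r.lt_of_mem
  by_cases hvx : v = x' ∨ v = x' + 1
  · obtain ⟨f, G₃, n₃, hf, hn₃, hag₃, hxD, hyD, hfor₃⟩ := hr.exists_select_ends (n := n₁ + 2)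
      (x := x) (y := x + 1) (by omega) (by omega)
      ((hag₂ x (by omega) (x + 1) (by omega)).1 hadjx)
      (fun f hf ↦ ⟨_, hcardF f n, by simp,
        hfor₂ f n (by omega) (by omega) le_rfl (by omega) (by omega)⟩) hne₂
    have hsub := r.mono (by omega) (hag₂.trans hag₃ (by omega)) (m := n₃)
    refine ⟨G₃, n₃, n, insert f F, by omega, ?_, ?_, ?_, ?_, ?_⟩
    · intro w hw hwL
      exact (hag₂.trans hag₃ (by omega) w (by omega) (w + 1) (by omega)).1 (hadj₁ w hw hwL)
    · exact (Finset.card_insert_le _ _).trans (by have := h.card_le; omega)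
    · intro b hb hbL
      exact hfor₃ _ (by simp) (hfor₂ f b (by omega) (by omega) hb hbL (by omega))
    · have := card_add_three_le hsub hxD hyD (r.mono hn₃ hag₃ hvD) hx3 hx4 (by grind)
        (by omega) (by omega) (by omega)
      omega
    · exact fun h' ↦ hne₂ (h'.of_prefixAgree le_rfl hn₃ hag₃)
  · obtain ⟨f, G₃, n₃, hf, hn₃, hag₃, hxD, hyD, hfor₃⟩ := hr.exists_select_ends (n := n₁ + 2)
      (x := x') (y := x' + 1) (by omega) (by omega)
      ((hag₂ x' (by omega) (x' + 1) (by omega)).1 hadjx')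
      (fun f hf ↦ ⟨_, hcardF s f, by simp,
        hfor₂ s f le_rfl (by omega) (by omega) (by omega) (by omega)⟩) hne₂
    have hsub := r.mono (by omega) (hag₂.trans hag₃ (by omega)) (m := n₃)
    refine ⟨G₃, n₃, s, insert f F, by omega, ?_, ?_, ?_, ?_, ?_⟩
    · intro w hw hwL
      exact (hag₂.trans hag₃ (by omega) w (by omega) (w + 1) (by omega)).1
        ((hag₁ w (by omega) (w + 1) (by omega)).1 (h.adj w hw hwL))
    · exact (Finset.card_insert_le _ _).trans (by have := h.card_le; omega)
    · intro b hb hbL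
      rw [Finset.insert_comm]
      exact hfor₃ _ (by simp) (hfor₂ b f hb hbL (by omega) (by omega) (by omega))
    · have := card_add_three_le hsub hxD hyD (r.mono hn₃ hag₃ hvD) hx3' hx4' (by grind)
        (by omega) (by omega) (by omega)
      omega
    · exact fun h' ↦ hne₂ (h'.of_prefixAgree le_rfl hn₃ hag₃)

theorem BoundedBy.exists_freeCycle (hr : r.BoundedBy K B) {L : ℕ} (hL : B < L) (k : ℕ)
    (hk : k + 1 ≤ K) : ∃ G n s F, r.FreeCycle L k G n s F := by
  induction k with
  | zero => exact r.exists_freeCycle_zero (by omega)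
  | succ k ih =>
    obtain ⟨G, n, s, F, h⟩ := ih (by omega)
    exact h.exists_succ hr hL hk

/-- A rule that always selects few vertices is contradicted by an instance with a feedback vertex
set of size `k + 1` on which it selects at least `4 * k + 1` vertices. -/
theorem BoundedBy.exists_instance {k : ℕ} (hr : r.BoundedBy (k + 1) B) :
    ∃ G n F, F.card ≤ k + 1 ∧ ForestOff G n F ∧ ¬ ForestOff G n ∅ ∧
      4 * k + 1 ≤ (r.D G n).card := by
  obtain ⟨G, n, s, F, h⟩ := hr.exists_freeCycle (Nat.lt_succ_self B) k le_rfl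
  exact ⟨G, n, insert s F, (Finset.card_insert_le _ _).trans (by have := h.card_le; omega),
    h.forestOff s le_rfl (by omega), h.not_forestOff, h.le_card⟩

end SelectionRule

/-! ### Instances on `Fin n` -/

theorem isFVS_comap_val_iff {G : SimpleGraph ℕ} {n : ℕ} {S : Finset (Fin n)} :
    IsFVS (G.comap Fin.val) S ↔ ForestOff G n (S.image Fin.val) := by
  constructor
  · intro h
    refine h.comap (⟨fun v ↦ ⟨⟨v, v.2.1⟩, fun hv ↦ v.2.2 (Finset.mem_image.2 ⟨_, hv, rfl⟩)⟩,
      fun huv ↦ huv⟩ : G.induce _ →g (G.comap Fin.val).induce _) ?_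
    exact fun u v huv ↦ Subtype.ext (congrArg (fun w ↦ (w.1 : Fin n).val) huv)
  · intro h
    have hmem : ∀ v : {v : Fin n | v ∉ S}, (v.1 : ℕ) ∈ {v | v < n ∧ v ∉ S.image Fin.val} := by
      refine fun v ↦ ⟨v.1.2, fun hv ↦ ?_⟩
      obtain ⟨w, hw, hwv⟩ := Finset.mem_image.1 hv
      exact v.2 (Fin.ext hwv ▸ hw)
    refine h.comap (⟨fun v ↦ ⟨v.1, hmem v⟩, fun huv ↦ huv⟩ :
      (G.comap Fin.val).induce _ →g G.induce _) ?_
    exact fun u v huv ↦ Subtype.ext (Fin.ext (congrArg Subtype.val huv))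

theorem fvsNum_comap_val_le {G : SimpleGraph ℕ} {n : ℕ} {F : Finset ℕ} (h : ForestOff G n F) :
    fvsNum (G.comap (Fin.val : Fin n → ℕ)) ≤ F.card := by
  classical
  let S : Finset (Fin n) := Finset.univ.filter fun v ↦ (v : ℕ) ∈ F
  have hS : IsFVS (G.comap Fin.val) S := by
    rw [isFVS_comap_val_iff]
    refine SimpleGraph.IsAcyclic.induce_of_adj_imp h (fun v hv ↦ ⟨hv.1, fun hF ↦ hv.2 ?_⟩)
      fun _ _ _ _ ↦ id
    exact Finset.mem_image.2 ⟨⟨v, hv.1⟩, by simpa [S] using hF, rfl⟩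
  have h1 : fvsNum (G.comap (Fin.val : Fin n → ℕ)) ≤ S.card := Nat.sInf_le ⟨S, hS, rfl⟩
  refine h1.trans (Finset.card_le_card_of_injOn Fin.val (fun v hv ↦ ?_) Fin.val_injective.injOn)
  simpa [S] using hv

theorem one_le_fvsNum_comap_val {G : SimpleGraph ℕ} {n : ℕ} (h : ¬ ForestOff G n ∅) :
    1 ≤ fvsNum (G.comap (Fin.val : Fin n → ℕ)) := by
  have huniv : IsFVS (G.comap (Fin.val : Fin n → ℕ)) Finset.univ := by
    have : IsEmpty {v : Fin n | v ∉ Finset.univ} := by simp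
    exact SimpleGraph.IsAcyclic.of_subsingleton
  obtain ⟨S, hS, hcard⟩ := Nat.sInf_mem
    (⟨_, Finset.univ, huniv, rfl⟩ :
      {k : ℕ | ∃ S, IsFVS (G.comap (Fin.val : Fin n → ℕ)) S ∧ S.card = k}.Nonempty)
  rw [fvsNum, ← hcard, Nat.one_le_iff_ne_zero, Finset.card_ne_zero, Finset.nonempty_iff_ne_empty]
  rintro rfl
  exact h (by simpa using isFVS_comap_val_iff.1 hS)

namespace DelayedFVSAlgorithm

theorem S_subset (A : DelayedFVSAlgorithm) {n i j : ℕ} (G : SimpleGraph (Fin n)) (hij : i ≤ j)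
    (hj : j ≤ n) : A.S n G i ⊆ A.S n G j := by
  induction j, hij using Nat.le_induction with
  | base => exact subset_rfl
  | succ j _ ih => exact (ih (by omega)).trans (A.irrevocable n G j hj)

/-- The selection rule on graphs on `ℕ` given by a delayed-decision algorithm. -/
def toSelectionRule (A : DelayedFVSAlgorithm) : SelectionRule where
  D G n := (A.S n (G.comap Fin.val) n).image Fin.val
  lt_of_mem := by
    intro G n v hv
    obtain ⟨w, -, rfl⟩ := Finset.mem_image.1 hv
    exact w.2
  mono := by
    intro G G' n m hnm hag
    rw [A.online n m (G.comap Fin.val) (G'.comap Fin.val) n le_rfl hnm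
      fun x y ↦ hag x x.2 y y.2]
    exact Finset.image_subset_image (A.S_subset _ hnm le_rfl)
  valid := by
    intro G n
    rw [← isFVS_comap_val_iff]
    exact SimpleGraph.IsAcyclic.induce_of_adj_imp (A.valid n _ n le_rfl) (fun v hv ↦ ⟨v.2, hv⟩)
      fun _ _ _ _ ↦ id

theorem card_toSelectionRule_D (A : DelayedFVSAlgorithm) (G : SimpleGraph ℕ) (n : ℕ) :
    (A.toSelectionRule.D G n).card = (A.S n (G.comap Fin.val) n).card :=
  Finset.card_image_of_injective _ Fin.val_injective

end DelayedFVSAlgorithm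

/-- No deterministic delayed-decision algorithm for online Feedback Vertex Set achieves
a strict competitive ratio of `4 - ε`. -/
theorem fvs_delayed_lower_bound_four (ε : ℝ) (hε : 0 < ε) (A : DelayedFVSAlgorithm) :
    ∃ (n : ℕ) (G : SimpleGraph (Fin n)),
      1 ≤ fvsNum G ∧ ((A.S n G n).card : ℝ) > (4 - ε) * (fvsNum G : ℝ) := by
  by_contra! hA
  have hle : ∀ (G : SimpleGraph ℕ) (n : ℕ) (F : Finset ℕ), ForestOff G n F →
      ¬ ForestOff G n ∅ → (A.toSelectionRule.D G n).card ≤ 4 * (F.card : ℝ) ∧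
      (A.toSelectionRule.D G n).card ≤ (4 - ε) * fvsNum (G.comap (Fin.val : Fin n → ℕ)) ∧
      (fvsNum (G.comap (Fin.val : Fin n → ℕ)) : ℝ) ≤ F.card := by
    intro G n F hF hne
    have h1 := one_le_fvsNum_comap_val hne
    have h2 := hA n (G.comap Fin.val) h1
    rw [← A.card_toSelectionRule_D] at h2
    have h3 : (fvsNum (G.comap (Fin.val : Fin n → ℕ)) : ℝ) ≤ F.card :=
      mod_cast fvsNum_comap_val_le hF
    have h4 := mul_nonneg hε.le (Nat.cast_nonneg (α := ℝ)
      (fvsNum (G.comap (Fin.val : Fin n → ℕ))))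
    exact ⟨by linarith, h2, h3⟩
  obtain ⟨k, hk⟩ := exists_nat_gt (3 / ε)
  have hr : A.toSelectionRule.BoundedBy (k + 1) (4 * (k + 1)) := by
    intro G n F hcard hF hne
    have h1 := (hle G n F hF hne).1
    have h2 : (F.card : ℝ) ≤ k + 1 := mod_cast hcard
    have : ((A.toSelectionRule.D G n).card : ℝ) ≤ 4 * (k + 1) := by linarith
    exact_mod_cast this
  obtain ⟨G, n, F, hcard, hF, hne, hD⟩ := hr.exists_instance
  obtain ⟨-, h1, h2⟩ := hle G n F hF hne
  have h3 : (F.card : ℝ) ≤ k + 1 := mod_cast hcard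
  have h4 : (4 * k + 1 : ℝ) ≤ (A.toSelectionRule.D G n).card := mod_cast hD
  have h5 : 3 < k * ε := (div_lt_iff₀ hε).1 hk
  rcases le_total ε 4 with h6 | h6
  · have := mul_le_mul_of_nonneg_left (h2.trans h3) (sub_nonneg.2 h6)
    nlinarith
  · have := mul_nonneg (sub_nonneg.2 h6) (Nat.cast_nonneg (α := ℝ)
      (fvsNum (G.comap (Fin.val : Fin n → ℕ))))
    have := Nat.cast_nonneg (α := ℝ) k
    nlinarith
end

section
/- There exists a deterministic delayed-decision algorithm for online Feedback Vertex Set such that on every instance (n, G): if G is acyclic then S_n(G) = ∅, and if G contains a cycle then |S_n(G)| ≤ 5·μ(G) − 2 (an inequality of integers); in particular, on every instance with n ≥ 1 vertices and μ(G) ≥ 1 the algorithm's output satisfies |S_n(G)| ≤ (5 − 2/n)·μ(G), i.e., it achieves a strict competitive ratio of 5 − 2/n. -/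
open SimpleGraph

namespace OnlineFVS

variable {V : Type*} {G : SimpleGraph V}

/-- The spanning subgraph of `G` in which all edges meeting `F` are deleted. -/
def del (G : SimpleGraph V) (F : Finset V) : SimpleGraph V where
  Adj x y := G.Adj x y ∧ x ∉ F ∧ y ∉ F
  symm := ⟨fun _ _ h => ⟨h.1.symm, h.2.2, h.2.1⟩⟩
  loopless := ⟨fun _ h => h.1.ne rfl⟩

lemma del_le (F : Finset V) : del G F ≤ G := fun _ _ h => h.1

lemma del_mono_left {G' : SimpleGraph V} (h : G ≤ G') (F : Finset V) : del G F ≤ del G' F :=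
  fun _ _ hxy => ⟨h hxy.1, hxy.2⟩

/-- A finite forest on a nonempty vertex set has fewer edges than vertices. -/
lemma card_edges_lt (E : Finset (Sym2 V)) (X : Finset V) (hX : X.Nonempty)
    (hE : ∀ e ∈ E, ∀ x ∈ e, x ∈ X) (hd : ∀ e ∈ E, ¬ e.IsDiag)
    (hac : (fromEdgeSet (E : Set (Sym2 V))).IsAcyclic) : E.card + 1 ≤ X.card := by
  classical
  have : Nonempty X := hX.to_subtype
  let K : SimpleGraph X := (fromEdgeSet (E : Set (Sym2 V))).comap Subtype.val
  have hK : K.IsAcyclic := hac.of_comap (Function.Embedding.subtype _)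
  obtain ⟨T, hKT, -, hT⟩ :=
    (connected_top (V := X)).exists_isTree_le_of_le_of_isAcyclic le_top hK
  have h1 := hT.card_edgeFinset
  have h2 : E.card ≤ T.edgeFinset.card := by
    have : E ⊆ T.edgeFinset.image (Sym2.map Subtype.val) := by
      intro e he
      induction e with
      | _ x y =>
        have hx := hE _ he x (by simp)
        have hy := hE _ he y (by simp)
        refine Finset.mem_image.2 ⟨s(⟨x, hx⟩, ⟨y, hy⟩), ?_, by simp⟩
        rw [mem_edgeFinset, mem_edgeSet]
        apply hKT
        have := hd _ he
        simp only [Sym2.mk_isDiag_iff] at this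
        simp [K, he, this]
    exact (Finset.card_le_card this).trans Finset.card_image_le
  rw [Fintype.card_coe] at h1
  omega

/-- Attaching a path to a forest, at its last vertex only, yields a forest. -/
lemma isAcyclic_sup_path {x y : V} (p : G.Walk x y) (hp : p.IsPath) (M : SimpleGraph V)
    (hM : M.IsAcyclic) (hav : ∀ z ∈ p.support, z ≠ y → ∀ t, ¬ M.Adj z t) :
    (M ⊔ fromEdgeSet {e | e ∈ p.edges}).IsAcyclic := by
  induction p with
  | nil => simpa using hM
  | @cons u v w h q ih =>
    rw [Walk.cons_isPath_iff] at hp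
    have huw : u ≠ w := fun h => hp.2 (h ▸ q.end_mem_support)
    have hq := ih hp.1 (fun z hz => hav z (by simp [hz]))
    have := hq.sup_edge_of_not_reachable (u := u) (v := v) (by
      intro hr
      obtain ⟨r⟩ := hr
      cases r with
      | nil => exact hp.2 q.start_mem_support
      | cons h' _ =>
        rcases h' with h' | h'
        · exact hav u (by simp) huw _ h'
        · exact hp.2 (q.fst_mem_support_of_mem_edges h'.1))
    refine this.anti ?_
    rintro a b (hab | hab)
    · exact Or.inl (Or.inl hab)
    · simp only [fromEdgeSet_adj, Set.mem_ofPred_eq, Walk.edges_cons, List.mem_cons] at hab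
      rcases hab with ⟨hab | hab, hne⟩
      · right
        rw [edge_adj]
        exact ⟨by simpa using hab, hne⟩
      · exact Or.inl (Or.inr ⟨hab, hne⟩)

lemma cycle_supp {u : V} (c : G.Walk u u) (hc : c.IsCycle) {x : V} (hx : x ∈ c.support) :
    ∃ y, G.Adj x y := by
  obtain ⟨e, he, hxe⟩ := (Walk.mem_support_iff_exists_mem_edges_of_not_nil hc.not_nil).1 hx
  obtain ⟨y, rfl⟩ := Sym2.mem_iff_exists.1 hxe
  exact ⟨y, c.edges_subset_edgeSet he⟩

lemma isAcyclic_map {V' : Type*} {G : SimpleGraph V} (f : V ↪ V') (hG : G.IsAcyclic) :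
    (G.map f).IsAcyclic := by
  intro x c hc
  obtain ⟨y, hxy⟩ := cycle_supp c hc c.start_mem_support
  obtain ⟨u₀, -, -, -, -⟩ := (SimpleGraph.map_adj ..).1 hxy
  have : Nonempty V := ⟨u₀⟩
  obtain ⟨e, he⟩ : ∃ e, e ∈ c.edges :=
    List.exists_mem_of_ne_nil _ fun h => hc.ne_nil (Walk.eq_nil_iff_nil.2 (Walk.edges_eq_nil.1 h))
  induction e with
  | _ x y =>
    obtain ⟨hxy, hr⟩ := adj_and_reachable_delete_edges_iff_exists_cycle.2 ⟨_, c, hc, he⟩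
    obtain ⟨u, v, huv, rfl, rfl⟩ := (SimpleGraph.map_adj ..).1 hxy
    have hinv := Function.leftInverse_invFun f.injective
    let φ : (G.map f \ fromEdgeSet {s(f u, f v)}) →g (G \ fromEdgeSet {s(u, v)}) :=
      { toFun := Function.invFun f
        map_rel' := by
          rintro a b ⟨hab, hne⟩
          obtain ⟨a, b, hadj, rfl, rfl⟩ := (SimpleGraph.map_adj ..).1 hab
          rw [hinv, hinv]
          refine ⟨hadj, fun h => hne ⟨?_, f.injective.ne hadj.ne⟩⟩
          have := congrArg (Sym2.map f) (h.1 : s(a, b) = s(u, v))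
          simpa using this }
    have hr' := hr.map φ
    rw [show φ (f u) = u from hinv u, show φ (f v) = v from hinv v] at hr'
    obtain ⟨w, d, hd, -⟩ := adj_and_reachable_delete_edges_iff_exists_cycle.1 ⟨huv, hr'⟩
    exact hG d hd

variable [DecidableEq V]

lemma path_deg {x y : V} (p : G.Walk x y) (hp : p.IsPath) (z : V) :
    (p.edges.toFinset.filter (z ∈ ·)).card ≤ 2 ∧
    ((z = x ∨ z = y) → (p.edges.toFinset.filter (z ∈ ·)).card ≤ 1) ∧
    (z ∉ p.support → (p.edges.toFinset.filter (z ∈ ·)).card = 0) := by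
  induction p with
  | nil => simp
  | @cons u v w h q ih =>
    rw [Walk.cons_isPath_iff] at hp
    obtain ⟨h2, h1, h0⟩ := ih hp.1
    have huw : u ≠ w := fun h => hp.2 (h ▸ q.end_mem_support)
    have huv : u ≠ v := h.ne
    simp only [Walk.edges_cons, List.toFinset_cons, Finset.filter_insert, Walk.support_cons,
      List.mem_cons, not_or]
    by_cases hzu : z = u
    · subst hzu
      have := h0 hp.2
      have hc := Finset.card_insert_le s(z, v) (q.edges.toFinset.filter (z ∈ ·))
      simp only [Sym2.mem_iff, true_or, if_true]
      refine ⟨by omega, fun _ => by omega, fun h => absurd trivial h.1⟩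
    · by_cases hzv : z = v
      · subst hzv
        have := h1 (Or.inl rfl)
        have hc := Finset.card_insert_le s(u, z) (q.edges.toFinset.filter (z ∈ ·))
        simp only [Sym2.mem_iff, or_true, if_true]
        refine ⟨by omega, ?_, fun h => absurd q.start_mem_support h.2⟩
        rintro (h | h)
        · exact absurd h hzu
        · subst h
          rw [Walk.edges_eq_nil.2 (Walk.isPath_iff_nil.1 hp.1)]
          simp
      · simp only [Sym2.mem_iff, hzu, hzv, or_self, if_false]
        exact ⟨h2, fun h => h1 (by tauto), fun h => h0 h.2⟩

lemma path_card_support {x y : V} (p : G.Walk x y) (hp : p.IsPath) :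
    p.support.toFinset.card = p.length + 1 := by
  rw [List.toFinset_card_of_nodup hp.support_nodup, Walk.length_support]

lemma path_card_edges {x y : V} (p : G.Walk x y) (hp : p.IsPath) :
    p.edges.toFinset.card = p.length := by
  rw [List.toFinset_card_of_nodup hp.isTrail.edges_nodup, Walk.length_edges]

lemma cycle_card {u : V} (c : G.Walk u u) (hc : c.IsCycle) :
    c.support.toFinset.card = c.edges.toFinset.card := by
  cases c with
  | nil => exact absurd rfl hc.ne_nil
  | @cons _ v _ h p =>
    rw [Walk.cons_isCycle_iff] at hc
    have h1 : (Walk.cons h p).support.toFinset = p.support.toFinset := by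
      simp [Walk.support_cons]
    rw [h1, path_card_support p hc.1, Walk.edges_cons, List.toFinset_cons,
      Finset.card_insert_of_notMem (by simpa using hc.2), path_card_edges p hc.1]

lemma cycle_deg {u : V} (c : G.Walk u u) (hc : c.IsCycle) (z : V) :
    (c.edges.toFinset.filter (z ∈ ·)).card ≤ 2 := by
  cases c with
  | nil => exact absurd rfl hc.ne_nil
  | @cons _ v _ h p =>
    rw [Walk.cons_isCycle_iff] at hc
    have hd := path_deg p hc.1 z
    have hcd := Finset.card_insert_le s(u, v) (p.edges.toFinset.filter (z ∈ ·))
    simp only [Walk.edges_cons, List.toFinset_cons, Finset.filter_insert]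
    split_ifs with hz
    · have := hd.2.1 (by simpa [or_comm] using hz)
      omega
    · exact hd.1

/-- A lower-bound certificate accompanying the selected set `S`: a subgraph with vertex set `W`
and edge set `E` whose degrees are at most three on `B` and at most two elsewhere, a number `k` of
disjoint cycles inside `W`, and, for every `w ∈ P`, a petal `A w` (a connected set containing a
cycle) meeting `W` only in `w`. -/
structure Cert (G : SimpleGraph V) (S W B P : Finset V) (E : Finset (Sym2 V))
    (A : V → Finset V) (k : ℕ) : Prop where
  B_sub : B ⊆ S
  P_sub : P ⊆ S
  S_sub : S ⊆ W
  disj : ∀ w ∈ P, w ∉ B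
  edges : ∀ e ∈ E, e ∈ G.edgeSet
  ends : ∀ e ∈ E, ∀ x ∈ e, x ∈ W
  supp : ∀ x ∈ W, ∃ y, G.Adj x y
  deg : ∀ x ∈ W, (E.filter (x ∈ ·)).card ≤ if x ∈ B then 3 else 2
  count : 2 * W.card + B.card ≤ 2 * E.card
  acyc : (del (fromEdgeSet (E : Set (Sym2 V))) S).IsAcyclic
  cyc : ∀ F : Finset V, (del G F).IsAcyclic → k ≤ (F ∩ W).card
  petal_inter : ∀ w ∈ P, ∀ x ∈ A w, x ∈ W → x = w
  petal_walk : ∀ w ∈ P, ∀ x ∈ A w, ∃ q : G.Walk w x, ∀ y ∈ q.support, y ∈ A w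
  petal_hit : ∀ w ∈ P, ∀ F : Finset V, (del G F).IsAcyclic → ∃ x ∈ A w, x ∈ F
  petal_disj : ∀ w ∈ P, ∀ w' ∈ P, ∀ x, x ∈ A w → x ∈ A w' → w = w'

namespace Cert

variable {S W B P : Finset V} {E : Finset (Sym2 V)} {A : V → Finset V} {k : ℕ}

lemma empty (G : SimpleGraph V) : Cert G ∅ ∅ ∅ ∅ ∅ (fun _ => ∅) 0 where
  B_sub := by simp
  P_sub := by simp
  S_sub := by simp
  disj := by simp
  edges := by simp
  ends := by simp
  supp := by simp
  deg := by simp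
  count := by simp
  acyc := by
    refine IsAcyclic.anti (G' := ⊥) ?_ isAcyclic_bot
    rintro x y ⟨h, -⟩
    simp at h
  cyc := by simp
  petal_inter := by simp
  petal_walk := by simp
  petal_hit := by simp
  petal_disj := by simp

lemma mono {G' : SimpleGraph V} (h : Cert G S W B P E A k) (hG : G ≤ G') :
    Cert G' S W B P E A k where
  B_sub := h.B_sub
  P_sub := h.P_sub
  S_sub := h.S_sub
  disj := h.disj
  edges e he := edgeSet_mono hG (h.edges e he)
  ends := h.ends
  supp x hx := (h.supp x hx).imp fun _ hy => hG hy
  deg := h.deg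
  count := h.count
  acyc := h.acyc
  cyc F hF := h.cyc F (hF.anti (del_mono_left hG F))
  petal_inter := h.petal_inter
  petal_walk w hw x hx := by
    obtain ⟨q, hq⟩ := h.petal_walk w hw x hx
    exact ⟨q.mapLe hG, by simpa using hq⟩
  petal_hit w hw F hF := h.petal_hit w hw F (hF.anti (del_mono_left hG F))
  petal_disj := h.petal_disj

lemma erase_petal (h : Cert G S W B P E A k) (w : V) : Cert G S W B (P.erase w) E A k where
  B_sub := h.B_sub
  P_sub := (Finset.erase_subset _ _).trans h.P_sub
  S_sub := h.S_sub
  disj x hx := h.disj x (Finset.mem_of_mem_erase hx)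
  edges := h.edges
  ends := h.ends
  supp := h.supp
  deg := h.deg
  count := h.count
  acyc := h.acyc
  cyc := h.cyc
  petal_inter x hx := h.petal_inter x (Finset.mem_of_mem_erase hx)
  petal_walk x hx := h.petal_walk x (Finset.mem_of_mem_erase hx)
  petal_hit x hx := h.petal_hit x (Finset.mem_of_mem_erase hx)
  petal_disj x hx y hy := h.petal_disj x (Finset.mem_of_mem_erase hx) y
    (Finset.mem_of_mem_erase hy)

lemma branch_bound (h : Cert G S W B P E A k) (hW : W.Nonempty) {F : Finset V}
    (hF : (del G F).IsAcyclic) : B.card + 2 ≤ 2 * (F ∩ W).card + 2 * (F ∩ B).card := by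
  classical
  have hBW : B ⊆ W := h.B_sub.trans h.S_sub
  by_cases hWF : W ⊆ F
  · rw [Finset.inter_eq_right.2 hWF, Finset.inter_eq_right.2 (hBW.trans hWF)]
    have := hW.card_pos
    omega
  have hne : (W \ F).Nonempty := Finset.sdiff_nonempty.2 hWF
  set E₀ := E.filter fun e => ∀ x ∈ e, x ∉ F with hE₀
  set E₁ := E.filter fun e => ¬ ∀ x ∈ e, x ∉ F with hE₁
  have hsplit : E₀.card + E₁.card = E.card := Finset.card_filter_add_card_filter_not _
  have h0 : E₀.card + 1 ≤ (W \ F).card := by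
    refine card_edges_lt E₀ _ hne ?_ ?_ ?_
    · intro e he x hx
      rw [hE₀, Finset.mem_filter] at he
      exact Finset.mem_sdiff.2 ⟨h.ends e he.1 x hx, he.2 x hx⟩
    · intro e he
      exact G.not_isDiag_of_mem_edgeSet (h.edges e (Finset.mem_filter.1 he).1)
    · refine hF.anti ?_
      intro x y hxy
      rw [fromEdgeSet_adj, Finset.mem_coe, hE₀, Finset.mem_filter] at hxy
      exact ⟨h.edges _ hxy.1.1, hxy.1.2 x (by simp), hxy.1.2 y (by simp)⟩
  have h1 : E₁.card ≤ 2 * (F ∩ W).card + (F ∩ B).card := by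
    have hsub : E₁ ⊆ (F ∩ W).biUnion fun x => E.filter (x ∈ ·) := by
      intro e he
      rw [hE₁, Finset.mem_filter] at he
      obtain ⟨he, hx⟩ := he
      push Not at hx
      obtain ⟨x, hx, hxF⟩ := hx
      exact Finset.mem_biUnion.2 ⟨x, Finset.mem_inter.2 ⟨hxF, h.ends e he x hx⟩,
        Finset.mem_filter.2 ⟨he, hx⟩⟩
    calc E₁.card ≤ ∑ x ∈ F ∩ W, (E.filter (x ∈ ·)).card :=
          (Finset.card_le_card hsub).trans Finset.card_biUnion_le
      _ ≤ ∑ x ∈ F ∩ W, (2 + if x ∈ B then 1 else 0) := by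
          refine Finset.sum_le_sum fun x hx => (h.deg x (Finset.mem_inter.1 hx).2).trans ?_
          split_ifs <;> simp
      _ = 2 * (F ∩ W).card + (F ∩ B).card := by
          rw [Finset.sum_add_distrib, Finset.sum_const, smul_eq_mul, mul_comm,
            ← Finset.card_filter, Finset.filter_mem_eq_inter, Finset.inter_assoc,
            Finset.inter_eq_right.2 hBW]
  have h2 : (W \ F).card + (F ∩ W).card = W.card := by
    rw [Finset.inter_comm]
    exact Finset.card_sdiff_add_card_inter W F
  have := h.count
  omega

lemma petal_bound (h : Cert G S W B P E A k) {F : Finset V} (hF : (del G F).IsAcyclic) :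
    P.card ≤ (F \ W).card + (F ∩ P).card := by
  choose! g hgA hgF using fun w hw => h.petal_hit w hw F hF
  refine le_trans ?_ (Finset.card_union_le _ _)
  refine Finset.card_le_card_of_injOn g ?_ ?_
  · intro w hw
    have hw : w ∈ P := hw
    by_cases hgW : g w ∈ W
    · have := h.petal_inter w hw _ (hgA w hw) hgW
      have hwF := hgF w hw
      rw [this] at hwF
      simp [this, hw, hwF]
    · simp [hgF w hw, hgW]
  · intro w hw w' hw' heq
    exact h.petal_disj w hw w' hw' (g w) (hgA w hw) (heq ▸ hgA w' hw')

lemma bound (h : Cert G S W B P E A k) (hW : W.Nonempty) {F : Finset V}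
    (hF : (del G F).IsAcyclic) : B.card + P.card + k + 2 ≤ 5 * F.card := by
  have h1 := h.branch_bound hW hF
  have h2 := h.petal_bound hF
  have h3 := h.cyc F hF
  have h4 : (F \ W).card + (F ∩ W).card = F.card := Finset.card_sdiff_add_card_inter F W
  have h5 : (F ∩ P).card + (F ∩ B).card ≤ (F ∩ W).card := by
    rw [← Finset.card_union_of_disjoint]
    · refine Finset.card_le_card ?_
      rw [← Finset.inter_union_distrib_left]
      exact Finset.inter_subset_inter_left
        (Finset.union_subset (h.P_sub.trans h.S_sub) (h.B_sub.trans h.S_sub))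
    · refine Finset.disjoint_left.2 fun x hx hx' => ?_
      exact h.disj x (Finset.mem_inter.1 hx).2 (Finset.mem_inter.1 hx').2
  omega

/-- Adding an ear between two vertices of degree at most two. -/
lemma ear (h : Cert G S W B P E A k) {a b : V} (hab : a ≠ b) (ha : a ∈ W) (haB : a ∉ B)
    (hb : b ∈ W) (hbB : b ∉ B) (p : G.Walk a b) (hp : p.IsPath)
    (hpW : ∀ x ∈ p.support, x ∈ W → x = a ∨ x = b) (hpE : ∀ e ∈ p.edges, e ∉ E)
    (hpP : ∀ x ∈ p.support, ∀ w ∈ P, x ∈ A w → w = a ∨ w = b) :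
    Cert G (insert a (insert b S)) (W ∪ p.support.toFinset) (insert a (insert b B))
      (P \ {a, b}) (E ∪ p.edges.toFinset) A k where
  B_sub := Finset.insert_subset_insert _ (Finset.insert_subset_insert _ h.B_sub)
  P_sub := by
    intro x hx
    simp only [Finset.mem_sdiff] at hx
    simp [h.P_sub hx.1]
  S_sub := by
    intro x hx
    simp only [Finset.mem_insert] at hx
    rcases hx with rfl | rfl | hx
    · simp [ha]
    · simp [hb]
    · simp [h.S_sub hx]
  disj w hw := by
    simp only [Finset.mem_sdiff, Finset.mem_insert, Finset.mem_singleton] at hw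
    simp only [Finset.mem_insert]
    have := h.disj w hw.1
    tauto
  edges e he := by
    rcases Finset.mem_union.1 he with he | he
    · exact h.edges e he
    · exact p.edges_subset_edgeSet (by simpa using he)
  ends e he x hx := by
    rcases Finset.mem_union.1 he with he | he
    · exact Finset.mem_union_left _ (h.ends e he x hx)
    · exact Finset.mem_union_right _ (List.mem_toFinset.2
        (p.mem_support_of_mem_edges (by simpa using he) hx))
  supp x hx := by
    rcases Finset.mem_union.1 hx with hx | hx
    · exact h.supp x hx
    · have hnt : ¬ p.Nil := fun hn => hab hn.eq
      obtain ⟨e, he, hxe⟩ := (Walk.mem_support_iff_exists_mem_edges_of_not_nil hnt).1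
        (List.mem_toFinset.1 hx)
      obtain ⟨y, rfl⟩ := Sym2.mem_iff_exists.1 hxe
      exact ⟨y, p.edges_subset_edgeSet he⟩
  deg x hx := by
    obtain ⟨h2, h1, h0⟩ := path_deg p hp x
    have hle := Finset.card_union_le (E.filter (x ∈ ·)) (p.edges.toFinset.filter (x ∈ ·))
    rw [← Finset.filter_union] at hle
    by_cases hxab : x = a ∨ x = b
    · have hxW : x ∈ W := by rcases hxab with rfl | rfl <;> assumption
      have hxB : x ∉ B := by rcases hxab with rfl | rfl <;> assumption
      have := h.deg x hxW
      rw [if_neg hxB] at this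
      have := h1 hxab
      rw [if_pos (by simp; tauto)]
      omega
    · have hiff : x ∈ insert a (insert b B) ↔ x ∈ B := by simp; tauto
      simp only [hiff]
      by_cases hxW : x ∈ W
      · have := h0 fun hxp => hxab (hpW x hxp hxW)
        have := h.deg x hxW
        omega
      · have hE0 : (E.filter (x ∈ ·)).card = 0 := by
          rw [Finset.card_eq_zero, Finset.filter_eq_empty_iff]
          exact fun e he hxe => hxW (h.ends e he x hxe)
        have : (2 : ℕ) ≤ if x ∈ B then 3 else 2 := by split_ifs <;> simp
        omega
  count := by
    have hE : (E ∪ p.edges.toFinset).card = E.card + p.edges.toFinset.card := by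
      refine Finset.card_union_of_disjoint (Finset.disjoint_right.2 fun e he => ?_)
      exact hpE e (by simpa using he)
    have hW : (W ∪ p.support.toFinset).card + 2 ≤ W.card + p.support.toFinset.card := by
      rw [← Finset.card_union_add_card_inter]
      have : ({a, b} : Finset V) ⊆ W ∩ p.support.toFinset := by
        intro x hx
        simp only [Finset.mem_insert, Finset.mem_singleton] at hx
        rcases hx with rfl | rfl
        · simp [ha]
        · simp [hb]
      have := Finset.card_le_card this
      rw [Finset.card_pair hab] at this
      omega
    have hB : (insert a (insert b B)).card = B.card + 2 := by
      rw [Finset.card_insert_of_notMem (by simp [hab, haB]), Finset.card_insert_of_notMem hbB]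
    have := h.count
    rw [path_card_support p hp] at hW
    rw [path_card_edges p hp] at hE
    omega
  acyc := by
    refine (isAcyclic_sup_path p hp _ (h.acyc.anti (G := del (fromEdgeSet (E : Set (Sym2 V)))
      (insert a (insert b S))) ?_) ?_).anti ?_
    · exact fun x y hxy => ⟨hxy.1, fun hx => hxy.2.1 (by simp [hx]),
        fun hy => hxy.2.2 (by simp [hy])⟩
    · rintro z hz - t ⟨hzt, hz', -⟩
      have := hpW z hz (h.ends _ hzt.1 z (by simp))
      simp only [Finset.mem_insert] at hz'
      tauto
    · rintro x y ⟨hxy, hx, hy⟩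
      rw [fromEdgeSet_adj, Finset.mem_coe, Finset.mem_union, List.mem_toFinset] at hxy
      rcases hxy with ⟨hxy | hxy, hne⟩
      · exact Or.inl ⟨⟨hxy, hne⟩, hx, hy⟩
      · exact Or.inr ⟨hxy, hne⟩
  cyc F hF := (h.cyc F hF).trans
    (Finset.card_le_card (Finset.inter_subset_inter_left Finset.subset_union_left))
  petal_inter w hw x hxA hx := by
    simp only [Finset.mem_sdiff, Finset.mem_insert, Finset.mem_singleton] at hw
    rcases Finset.mem_union.1 hx with hx | hx
    · exact h.petal_inter w hw.1 x hxA hx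
    · exact absurd (hpP x (List.mem_toFinset.1 hx) w hw.1 hxA) hw.2
  petal_walk w hw := h.petal_walk w (Finset.sdiff_subset hw)
  petal_hit w hw := h.petal_hit w (Finset.sdiff_subset hw)
  petal_disj w hw w' hw' := h.petal_disj w (Finset.sdiff_subset hw) w' (Finset.sdiff_subset hw')

end Cert

lemma cycle_hit {u : V} (c : G.Walk u u) (hc : c.IsCycle) {F : Finset V}
    (hF : (del G F).IsAcyclic) : ∃ x ∈ c.support, x ∈ F := by
  by_contra! hcon
  have hE : ∀ e ∈ c.edges, e ∈ (del G F).edgeSet := by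
    intro e he
    induction e with
    | _ x y =>
      exact ⟨c.edges_subset_edgeSet he, hcon x (c.fst_mem_support_of_mem_edges he),
        hcon y (c.snd_mem_support_of_mem_edges he)⟩
  exact hF _ (hc.transfer hE)

namespace Cert

variable {S W B P : Finset V} {E : Finset (Sym2 V)} {A : V → Finset V} {k : ℕ}

/-- Adding a cycle disjoint from the subgraph and from all petals. -/
lemma add_cycle (h : Cert G S W B P E A k) {u : V} (c : G.Walk u u) (hc : c.IsCycle)
    (hcW : ∀ x ∈ c.support, x ∉ W) (hcP : ∀ x ∈ c.support, ∀ w ∈ P, x ∉ A w) :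
    Cert G (insert u S) (W ∪ c.support.toFinset) B P (E ∪ c.edges.toFinset) A (k + 1) where
  B_sub := h.B_sub.trans (Finset.subset_insert _ _)
  P_sub := h.P_sub.trans (Finset.subset_insert _ _)
  S_sub := Finset.insert_subset (by simp) (h.S_sub.trans Finset.subset_union_left)
  disj := h.disj
  edges e he := by
    rcases Finset.mem_union.1 he with he | he
    · exact h.edges e he
    · exact c.edges_subset_edgeSet (by simpa using he)
  ends e he x hx := by
    rcases Finset.mem_union.1 he with he | he
    · exact Finset.mem_union_left _ (h.ends e he x hx)
    · exact Finset.mem_union_right _ (List.mem_toFinset.2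
        (c.mem_support_of_mem_edges (by simpa using he) hx))
  supp x hx := by
    rcases Finset.mem_union.1 hx with hx | hx
    · exact h.supp x hx
    · exact cycle_supp c hc (List.mem_toFinset.1 hx)
  deg x hx := by
    have hle := Finset.card_union_le (E.filter (x ∈ ·)) (c.edges.toFinset.filter (x ∈ ·))
    rw [← Finset.filter_union] at hle
    by_cases hxW : x ∈ W
    · have h0 : (c.edges.toFinset.filter (x ∈ ·)).card = 0 := by
        rw [Finset.card_eq_zero, Finset.filter_eq_empty_iff]
        exact fun e he hxe =>
          hcW x (c.mem_support_of_mem_edges (List.mem_toFinset.1 he) hxe) hxW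
      have := h.deg x hxW
      omega
    · have hE0 : (E.filter (x ∈ ·)).card = 0 := by
        rw [Finset.card_eq_zero, Finset.filter_eq_empty_iff]
        exact fun e he hxe => hxW (h.ends e he x hxe)
      have := cycle_deg c hc x
      have : (2 : ℕ) ≤ if x ∈ B then 3 else 2 := by split_ifs <;> simp
      omega
  count := by
    have hE : (E ∪ c.edges.toFinset).card = E.card + c.edges.toFinset.card := by
      refine Finset.card_union_of_disjoint (Finset.disjoint_left.2 fun e he he' => ?_)
      induction e with
      | _ x y =>
        exact hcW x (c.fst_mem_support_of_mem_edges (List.mem_toFinset.1 he'))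
          (h.ends _ he x (by simp))
    have hW := Finset.card_union_le W c.support.toFinset
    rw [cycle_card c hc] at hW
    have := h.count
    omega
  acyc := by
    cases c with
    | nil => exact absurd rfl hc.ne_nil
    | @cons _ v _ huv p =>
      rw [Walk.cons_isCycle_iff] at hc
      refine (isAcyclic_sup_path p hc.1 _ h.acyc ?_).anti ?_
      · rintro z hz - t ⟨hzt, -, -⟩
        exact hcW z (by simp [hz]) (h.ends _ hzt.1 z (by simp))
      · rintro x y ⟨hxy, hx, hy⟩
        simp only [Finset.mem_insert, not_or] at hx hy
        rw [fromEdgeSet_adj, Finset.mem_coe, Finset.mem_union, List.mem_toFinset,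
          Walk.edges_cons, List.mem_cons] at hxy
        rcases hxy with ⟨hxy | hxy | hxy, hne⟩
        · exact Or.inl ⟨⟨hxy, hne⟩, hx.2, hy.2⟩
        · rw [Sym2.eq_iff] at hxy
          tauto
        · exact Or.inr ⟨hxy, hne⟩
  cyc F hF := by
    obtain ⟨x, hxc, hxF⟩ := cycle_hit c hc hF
    have hk := h.cyc F hF
    rw [Finset.inter_union_distrib_left, Finset.card_union_of_disjoint]
    · have : 0 < (F ∩ c.support.toFinset).card :=
        Finset.card_pos.2 ⟨x, by simp [hxF, hxc]⟩
      omega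
    · refine Finset.disjoint_left.2 fun y hy hy' => ?_
      simp only [Finset.mem_inter, List.mem_toFinset] at hy hy'
      exact hcW y hy'.2 hy.2
  petal_inter w hw x hxA hx := by
    rcases Finset.mem_union.1 hx with hx | hx
    · exact h.petal_inter w hw x hxA hx
    · exact absurd hxA (hcP x (List.mem_toFinset.1 hx) w hw)
  petal_walk := h.petal_walk
  petal_hit := h.petal_hit
  petal_disj := h.petal_disj

/-- Adding a cycle as a petal at a vertex of degree at most two. -/
lemma add_petal (h : Cert G S W B P E A k) {u : V} (huW : u ∈ W) (huS : u ∉ S)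
    (c : G.Walk u u) (hc : c.IsCycle) (hcW : ∀ x ∈ c.support, x ∈ W → x = u)
    (hcP : ∀ x ∈ c.support, ∀ w ∈ P, x ∉ A w) :
    Cert G (insert u S) W B (insert u P) E (Function.update A u c.support.toFinset) k := by
  have hne : ∀ w ∈ P, w ≠ u := fun w hw hwu => huS (hwu ▸ h.P_sub hw)
  exact {
    B_sub := h.B_sub.trans (Finset.subset_insert _ _)
    P_sub := Finset.insert_subset_insert _ h.P_sub
    S_sub := Finset.insert_subset huW h.S_sub
    disj := by
      intro w hw
      rcases Finset.mem_insert.1 hw with rfl | hw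
      · exact fun hB => huS (h.B_sub hB)
      · exact h.disj w hw
    edges := h.edges
    ends := h.ends
    supp := h.supp
    deg := h.deg
    count := h.count
    acyc := by
      refine h.acyc.anti ?_
      rintro x y ⟨hxy, hx, hy⟩
      simp only [Finset.mem_insert, not_or] at hx hy
      exact ⟨hxy, hx.2, hy.2⟩
    cyc := h.cyc
    petal_inter := by
      intro w hw x hxA hx
      rcases Finset.mem_insert.1 hw with rfl | hw
      · rw [Function.update_self] at hxA
        exact hcW x (List.mem_toFinset.1 hxA) hx
      · rw [Function.update_of_ne (hne w hw)] at hxA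
        exact h.petal_inter w hw x hxA hx
    petal_walk := by
      intro w hw x hxA
      rcases Finset.mem_insert.1 hw with rfl | hw
      · rw [Function.update_self] at hxA ⊢
        have hx := List.mem_toFinset.1 hxA
        exact ⟨c.takeUntil x hx, fun y hy =>
          List.mem_toFinset.2 (c.support_takeUntil_subset_support hx hy)⟩
      · rw [Function.update_of_ne (hne w hw)] at hxA ⊢
        exact h.petal_walk w hw x hxA
    petal_hit := by
      intro w hw F hF
      rcases Finset.mem_insert.1 hw with rfl | hw
      · rw [Function.update_self]
        obtain ⟨x, hx, hxF⟩ := cycle_hit c hc hF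
        exact ⟨x, List.mem_toFinset.2 hx, hxF⟩
      · rw [Function.update_of_ne (hne w hw)]
        exact h.petal_hit w hw F hF
    petal_disj := by
      intro w hw w' hw' x hx hx'
      rcases Finset.mem_insert.1 hw with h1 | h1 <;>
        rcases Finset.mem_insert.1 hw' with h2 | h2
      · rw [h1, h2]
      · rw [h1, Function.update_self] at hx
        rw [Function.update_of_ne (hne w' h2)] at hx'
        exact absurd hx' (hcP x (List.mem_toFinset.1 hx) w' h2)
      · rw [h2, Function.update_self] at hx'
        rw [Function.update_of_ne (hne w h1)] at hx
        exact absurd hx (hcP x (List.mem_toFinset.1 hx') w h1)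
      · rw [Function.update_of_ne (hne w h1)] at hx
        rw [Function.update_of_ne (hne w' h2)] at hx'
        exact h.petal_disj w h1 w' h2 x hx hx' }

end Cert

/-- The set `S` carries a certificate of weight at least `m` which accounts for all of `S`. -/
def Good (G : SimpleGraph V) (S : Finset V) (m : ℕ) : Prop :=
  ∃ (W B P : Finset V) (E : Finset (Sym2 V)) (A : V → Finset V) (k : ℕ),
    Cert G S W B P E A k ∧ S.card ≤ B.card + P.card + k ∧ m ≤ E.card + S.card

/-- The vertex `x` is joined to `w` by a walk avoiding `W` and all petals, except at `w`. -/
def Near (G : SimpleGraph V) (W P : Finset V) (A : V → Finset V) (w x : V) : Prop :=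
  ∃ q : G.Walk w x, (∀ y ∈ q.support, y ∈ W → y = w) ∧
    ∀ y ∈ q.support, ∀ w' ∈ P, y ∈ A w' → w' = w

namespace Cert

variable {S W B P : Finset V} {E : Finset (Sym2 V)} {A : V → Finset V} {k : ℕ}

lemma near_refl (h : Cert G S W B P E A k) {w : V} (hw : w ∈ W) : Near G W P A w w :=
  ⟨Walk.nil, by simp, by
    intro y hy w' hw' hyA
    obtain rfl : y = w := by simpa using hy
    exact (h.petal_inter w' hw' y hyA hw).symm⟩

lemma near_petal (h : Cert G S W B P E A k) {w x : V} (hw : w ∈ P) (hx : x ∈ A w) :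
    Near G W P A w x := by
  obtain ⟨q, hq⟩ := h.petal_walk w hw x hx
  exact ⟨q, fun y hy hyW => h.petal_inter w hw y (hq y hy) hyW,
    fun y hy w' hw' hyA => h.petal_disj w' hw' w hw y hyA (hq y hy)⟩

lemma edge_notMem (h : Cert G S W B P E A k) {x y w : V} (q : G.Walk x y)
    (hq : ∀ z ∈ q.support, z ∈ W → z = w) : ∀ e ∈ q.edges, e ∉ E := by
  intro e he heE
  induction e with
  | _ s t =>
    have hs := hq s (q.fst_mem_support_of_mem_edges he) (h.ends _ heE s (by simp))
    have ht := hq t (q.snd_mem_support_of_mem_edges he) (h.ends _ heE t (by simp))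
    exact (q.edges_subset_edgeSet he : G.Adj s t).ne (hs.trans ht.symm)

lemma exists_good_of_ear (h : Cert G S W B P E A k) (hS : S.card ≤ B.card + P.card + k)
    {a b : V} (hab : a ≠ b) (ha : a ∈ W) (haB : a ∉ B) (hb : b ∈ W) (hbB : b ∉ B)
    (q : G.Walk a b) (hqW : ∀ x ∈ q.support, x ∈ W → x = a ∨ x = b)
    (hqE : ∀ e ∈ q.edges, e ∉ E)
    (hqP : ∀ x ∈ q.support, ∀ w ∈ P, x ∈ A w → w = a ∨ w = b) :
    ∃ S', S ⊆ S' ∧ Good G S' (E.card + S.card + 1) := by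
  have hp := q.bypass_isPath
  have hsup := q.support_bypass_subset_support
  have hcert := h.ear hab ha haB hb hbB q.bypass hp (fun x hx => hqW x (hsup hx))
    (fun e he => hqE e (q.edges_bypass_subset_edges he)) (fun x hx => hqP x (hsup hx))
  have hsub : S ⊆ insert a (insert b S) :=
    (Finset.subset_insert b S).trans (Finset.subset_insert _ _)
  refine ⟨_, hsub, _, _, _, _, _, _, hcert, ?_, ?_⟩
  · have hB : (insert a (insert b B)).card = B.card + 2 := by
      rw [Finset.card_insert_of_notMem (by simp [hab, haB]), Finset.card_insert_of_notMem hbB]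
    have h1 : insert a (insert b S) = (S \ {a, b}) ∪ {a, b} := by
      ext x; simp; tauto
    have h2 := Finset.card_sdiff_add_card_inter S {a, b}
    have h3 := Finset.card_sdiff_add_card_inter P {a, b}
    have h4 : (P ∩ {a, b}).card ≤ (S ∩ {a, b}).card :=
      Finset.card_le_card (Finset.inter_subset_inter_right h.P_sub)
    have h5 := Finset.card_union_le (S \ {a, b}) {a, b}
    rw [← h1, Finset.card_pair hab] at h5
    omega
  · have hE : (E ∪ q.bypass.edges.toFinset).card = E.card + q.bypass.edges.toFinset.card := by
      refine Finset.card_union_of_disjoint (Finset.disjoint_right.2 fun e he => ?_)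
      exact hqE e (q.edges_bypass_subset_edges (by simpa using he))
    have hl : q.bypass.length ≠ 0 := fun h0 => hab (Walk.eq_of_length_eq_zero h0)
    rw [path_card_edges _ hp] at hE
    have := Finset.card_le_card hsub
    omega

lemma near_unique (h : Cert G S W B P E A k) (hS : S.card ≤ B.card + P.card + k)
    (hno : ¬ ∃ S', S ⊆ S' ∧ Good G S' (E.card + S.card + 1)) {v w x y : V}
    (hv : v ∈ W) (hvB : v ∉ B) (hw : w ∈ W) (hwB : w ∉ B)
    (hx : Near G W P A v x) (hy : Near G W P A w y) (hxy : G.Adj x y) (hE : s(x, y) ∉ E) :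
    v = w := by
  by_contra hvw
  obtain ⟨q, hqW, hqP⟩ := hx
  obtain ⟨r, hrW, hrP⟩ := hy
  refine hno (h.exists_good_of_ear hS hvw hv hvB hw hwB (q.append (Walk.cons hxy r.reverse))
    ?_ ?_ ?_)
  · intro z hz hzW
    rw [Walk.mem_support_append_iff, Walk.support_cons, List.mem_cons, Walk.support_reverse,
      List.mem_reverse] at hz
    rcases hz with hz | rfl | hz
    · exact Or.inl (hqW z hz hzW)
    · exact Or.inl (hqW z q.end_mem_support hzW)
    · exact Or.inr (hrW z hz hzW)
  · intro e he
    rw [Walk.edges_append, Walk.edges_cons, List.mem_append, List.mem_cons, Walk.edges_reverse,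
      List.mem_reverse] at he
    rcases he with he | rfl | he
    · exact h.edge_notMem q hqW e he
    · exact hE
    · exact h.edge_notMem r hrW e he
  · intro z hz u hu hzA
    rw [Walk.mem_support_append_iff, Walk.support_cons, List.mem_cons, Walk.support_reverse,
      List.mem_reverse] at hz
    rcases hz with hz | rfl | hz
    · exact Or.inl (hqP z hz u hu hzA)
    · exact Or.inl (hqP z q.end_mem_support u hu hzA)
    · exact Or.inr (hrP z hz u hu hzA)

lemma near_adj (h : Cert G S W B P E A k) (hS : S.card ≤ B.card + P.card + k)
    (hno : ¬ ∃ S', S ⊆ S' ∧ Good G S' (E.card + S.card + 1)) {w x y : V}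
    (hw : w ∈ W) (hwB : w ∉ B) (hx : Near G W P A w x) (hxy : G.Adj x y) (hE : s(x, y) ∉ E)
    (hy : y ∉ B) : Near G W P A w y := by
  by_cases hyW : y ∈ W
  · have hyy := h.near_refl hyW
    rwa [h.near_unique hS hno hw hwB hyW hy hx hyy hxy hE]
  by_cases hyP : ∃ v ∈ P, y ∈ A v
  · obtain ⟨v, hv, hyv⟩ := hyP
    have hvy := h.near_petal hv hyv
    rwa [h.near_unique hS hno hw hwB (h.S_sub (h.P_sub hv)) (h.disj v hv) hx hvy hxy hE]
  · push Not at hyP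
    obtain ⟨q, hqW, hqP⟩ := hx
    refine ⟨q.concat hxy, ?_, ?_⟩ <;> intro z hz <;>
      rw [Walk.support_concat, List.mem_append, List.mem_singleton] at hz
    · rcases hz with hz | rfl
      · exact hqW z hz
      · exact fun hzW => absurd hzW hyW
    · rcases hz with hz | rfl
      · exact hqP z hz
      · exact fun v hv hzv => absurd hzv (hyP v hv)

lemma near_walk (h : Cert G S W B P E A k) (hS : S.card ≤ B.card + P.card + k)
    (hno : ¬ ∃ S', S ⊆ S' ∧ Good G S' (E.card + S.card + 1)) {w x y : V}
    (hw : w ∈ W) (hwB : w ∉ B) (hx : Near G W P A w x) (c : G.Walk x y)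
    (hcS : ∀ z ∈ c.support, z ∉ S) (hcE : ∀ e ∈ c.edges, e ∉ E) :
    ∀ z ∈ c.support, Near G W P A w z := by
  induction c with
  | nil => simpa using hx
  | cons hadj r ih =>
    simp only [Walk.support_cons, List.mem_cons, Walk.edges_cons, forall_eq_or_imp] at hcS hcE ⊢
    exact ⟨hx, ih (h.near_adj hS hno hw hwB hx hadj hcE.1
      fun hB => hcS.2 _ r.start_mem_support (h.B_sub hB)) hcS.2 hcE.2⟩

/-- If the certificate cannot grow, then no cycle avoiding `S` uses one of its edges. -/
lemma edge_notMem_of_cycle (h : Cert G S W B P E A k) (hS : S.card ≤ B.card + P.card + k)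
    (hno : ¬ ∃ S', S ⊆ S' ∧ Good G S' (E.card + S.card + 1)) {a b u : V}
    (c : (del G S).Walk u u) (hc : c.IsCycle) (hab : s(a, b) ∈ c.edges) : s(a, b) ∉ E := by
  intro habE
  obtain ⟨hadj, hr⟩ := adj_and_reachable_delete_edges_iff_exists_cycle.2 ⟨u, c, hc, hab⟩
  have haW := h.ends _ habE a (by simp)
  have hbW := h.ends _ habE b (by simp)
  obtain ⟨p⟩ := hr
  let L := del (fromEdgeSet (E : Set (Sym2 V))) S
  have key : ∀ {x y : V} (p : (del G S \ fromEdgeSet {s(a, b)}).Walk x y),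
      (∃ w ∈ W, w ∉ S ∧ Near G W P A w x ∧ (L \ fromEdgeSet {s(a, b)}).Reachable a w) →
      ∃ w ∈ W, w ∉ S ∧ Near G W P A w y ∧ (L \ fromEdgeSet {s(a, b)}).Reachable a w := by
    intro x y p
    induction p with
    | nil => exact id
    | @cons x z y hxz r ih =>
      rintro ⟨w, hw, hwS, hx, haw⟩
      apply ih
      obtain ⟨⟨hxz, hxS, hzS⟩, hne⟩ := hxz
      by_cases hE : s(x, z) ∈ E
      · have hxW := h.ends _ hE x (by simp)
        have hzW := h.ends _ hE z (by simp)
        obtain ⟨q, hq, -⟩ := hx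
        obtain rfl := hq x q.end_mem_support hxW
        refine ⟨z, hzW, hzS, h.near_refl hzW, haw.trans (Adj.reachable ?_)⟩
        exact ⟨⟨⟨hE, hxz.ne⟩, hxS, hzS⟩, hne⟩
      · exact ⟨w, hw, hwS, h.near_adj hS hno hw (fun hB => hwS (h.B_sub hB)) hx hxz hE
          (fun hB => hzS (h.B_sub hB)), haw⟩
  obtain ⟨w, hw, hwS, ⟨q, hq, -⟩, haw⟩ :=
    key p ⟨a, haW, hadj.2.1, h.near_refl haW, Reachable.rfl⟩
  obtain rfl := hq b q.end_mem_support hbW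
  have hL : L.Adj a b := ⟨⟨habE, hadj.1.ne⟩, hadj.2⟩
  obtain ⟨u', c', hc', hm⟩ := adj_and_reachable_delete_edges_iff_exists_cycle.1 ⟨hL, haw⟩
  exact h.acyc c' hc'

end Cert

namespace Cert

variable {S W B P : Finset V} {E : Finset (Sym2 V)} {A : V → Finset V} {k : ℕ}

lemma exists_good_of_cycle (h : Cert G S W B P E A k) (hS : S.card ≤ B.card + P.card + k)
    {u : V} (c : G.Walk u u) (hc : c.IsCycle) (hcW : ∀ x ∈ c.support, x ∉ W)
    (hcP : ∀ x ∈ c.support, ∀ w ∈ P, x ∉ A w) :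
    ∃ S', S ⊆ S' ∧ Good G S' (E.card + S.card + 1) := by
  refine ⟨_, Finset.subset_insert u S, _, _, _, _, _, _, h.add_cycle c hc hcW hcP, ?_, ?_⟩ <;>
    rw [Finset.card_insert_of_notMem fun hu => hcW u c.start_mem_support (h.S_sub hu)]
  · omega
  · have := Finset.card_le_card (Finset.subset_union_left (s₁ := E) (s₂ := c.edges.toFinset))
    omega

lemma exists_good_of_petal (h : Cert G S W B P E A k) (hS : S.card ≤ B.card + P.card + k)
    {u : V} (huW : u ∈ W) (huS : u ∉ S) (c : G.Walk u u) (hc : c.IsCycle)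
    (hcW : ∀ x ∈ c.support, x ∈ W → x = u) (hcP : ∀ x ∈ c.support, ∀ w ∈ P, x ∉ A w) :
    ∃ S', S ⊆ S' ∧ Good G S' (E.card + S.card + 1) := by
  refine ⟨_, Finset.subset_insert u S, _, _, _, _, _, _, h.add_petal huW huS c hc hcW hcP,
    ?_, ?_⟩ <;> rw [Finset.card_insert_of_notMem huS]
  · rw [Finset.card_insert_of_notMem fun hu => huS (h.P_sub hu)]
    omega
  · omega

/-- A cycle outside the subgraph which meets the petal at `w`, and no other petal, is joined to
`w` by an ear that replaces the petal. -/
lemma exists_good_of_lollipop (h : Cert G S W B P E A k)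
    (hS : S.card ≤ B.card + P.card + k) {w v x : V} (hw : w ∈ P)
    (c : G.Walk v v) (hc : c.IsCycle) (hcW : ∀ x ∈ c.support, x ∉ W)
    (hcP : ∀ x ∈ c.support, ∀ w' ∈ P, x ∈ A w' → w' = w) (hx : x ∈ c.support)
    (hxA : x ∈ A w) : ∃ S', S ⊆ S' ∧ Good G S' (E.card + S.card + 1) := by
  have hwW := h.S_sub (h.P_sub hw)
  obtain ⟨q, hqW, hqP⟩ := h.near_petal hw hxA
  obtain ⟨u, huc, huq, hu⟩ := q.exists_mem_support_forall_mem_support_imp_eq c.support.toFinset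
    ⟨x, by simp [hx]⟩
  rw [List.mem_toFinset] at huc
  have hsub : ∀ y ∈ (q.takeUntil u huq).support, y ∈ q.support :=
    fun y hy => q.support_takeUntil_subset_support huq hy
  have hrot : ∀ y, y ∈ (c.rotate _ huc).support ↔ y ∈ c.support :=
    fun y => c.mem_support_rotate_iff _ huc
  have huW := hcW u huc
  have hwu : w ≠ u := fun hwu => huW (hwu ▸ hwW)
  have h1 := (h.erase_petal w).add_cycle (c.rotate _ huc) (hc.rotate huc)
    (fun y hy => hcW y ((hrot y).1 hy)) (fun y hy w' hw' hyA =>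
      Finset.ne_of_mem_erase hw' (hcP y ((hrot y).1 hy) w' (Finset.mem_of_mem_erase hw') hyA))
  have hp := (q.takeUntil u huq).bypass_isPath
  have hpsub := (q.takeUntil u huq).support_bypass_subset_support
  have hpW : ∀ y ∈ (q.takeUntil u huq).bypass.support, y ∈ W → y = w :=
    fun y hy hyW => hqW y (hsub y (hpsub hy)) hyW
  have hpc : ∀ y ∈ (q.takeUntil u huq).bypass.support, y ∈ c.support → y = u :=
    fun y hy hyc => hu y (by simpa using hyc) (hpsub hy)
  have h2 := h1.ear hwu (Finset.mem_union_left _ hwW) (h.disj w hw)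
    (Finset.mem_union_right _ (by simp)) (fun hB => huW (h.S_sub (h.B_sub hB)))
    (q.takeUntil u huq).bypass hp ?_ ?_ ?_
  · have hsub : S ⊆ insert w (insert u (insert u S)) := by
      intro y hy
      simp [hy]
    have hcard : (insert w (insert u (insert u S))).card = S.card + 1 := by
      rw [Finset.insert_idem, Finset.insert_eq_of_mem (by simp [h.P_sub hw]),
        Finset.card_insert_of_notMem fun hu => huW (h.S_sub hu)]
    refine ⟨_, hsub, _, _, _, _, _, _, h2, ?_, ?_⟩ <;> rw [hcard]
    · have hB : (insert w (insert u B)).card = B.card + 2 := by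
        rw [Finset.card_insert_of_notMem (by simp [hwu, h.disj w hw]),
          Finset.card_insert_of_notMem fun hB => huW (h.S_sub (h.B_sub hB))]
      have hP : P.erase w \ {w, u} = P.erase w := by
        ext y
        simp only [Finset.mem_sdiff, Finset.mem_erase, Finset.mem_insert, Finset.mem_singleton]
        refine ⟨fun hy => hy.1, fun hy => ⟨hy, ?_⟩⟩
        rintro (rfl | rfl)
        · exact hy.1 rfl
        · exact huW (h.S_sub (h.P_sub hy.2))
      have := Finset.card_erase_add_one hw
      rw [hB, hP]
      omega
    · have := Finset.card_le_card (Finset.subset_union_left.trans Finset.subset_union_left :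
        E ⊆ (E ∪ (c.rotate _ huc).edges.toFinset) ∪ (q.takeUntil u huq).bypass.edges.toFinset)
      omega
  · intro y hy hyW
    rcases Finset.mem_union.1 hyW with hyW | hyc
    · exact Or.inl (hpW y hy hyW)
    · exact Or.inr (hpc y hy ((hrot y).1 (List.mem_toFinset.1 hyc)))
  · intro e he heE
    rcases Finset.mem_union.1 heE with heE | hec
    · exact h.edge_notMem _ hpW e he heE
    · rw [List.mem_toFinset] at hec
      induction e with
      | _ s t =>
        have hs := hpc s (Walk.fst_mem_support_of_mem_edges _ he)
          ((hrot s).1 (Walk.fst_mem_support_of_mem_edges _ hec))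
        have ht := hpc t (Walk.snd_mem_support_of_mem_edges _ he)
          ((hrot t).1 (Walk.snd_mem_support_of_mem_edges _ hec))
        exact (Walk.edges_subset_edgeSet _ he : G.Adj s t).ne (hs.trans ht.symm)
  · intro y hy w' hw' hyA
    exact Or.inl (hqP y (hsub y (hpsub hy)) w' (Finset.mem_of_mem_erase hw') hyA)

/-- As long as a cycle avoids the selected set, the certificate can grow. -/
lemma exists_good (h : Cert G S W B P E A k) (hS : S.card ≤ B.card + P.card + k)
    (hac : ¬ (del G S).IsAcyclic) : ∃ S', S ⊆ S' ∧ Good G S' (E.card + S.card + 1) := by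
  by_contra hno
  simp only [IsAcyclic, not_forall, not_not] at hac
  obtain ⟨u, c₀, hc₀⟩ := hac
  obtain ⟨c, hc, hcS, hcE⟩ : ∃ c : G.Walk u u, c.IsCycle ∧ (∀ x ∈ c.support, x ∉ S) ∧
      ∀ e ∈ c.edges, e ∉ E := by
    refine ⟨c₀.mapLe (del_le S), hc₀.mapLe _, fun x hx => ?_, fun e he => ?_⟩
    · exact (cycle_supp c₀ hc₀ (by simpa using hx)).choose_spec.2.1
    · induction e with
      | _ a b => exact h.edge_notMem_of_cycle hS hno c₀ hc₀ (by simpa using he)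
  by_cases hex : ∃ x ∈ c.support, ∃ w ∈ W, w ∉ B ∧ Near G W P A w x
  · obtain ⟨x, hx, w, hw, hwB, hnear⟩ := hex
    have hrot : ∀ z, z ∈ (c.rotate _ hx).support ↔ z ∈ c.support :=
      fun z => c.mem_support_rotate_iff _ hx
    have hall : ∀ z ∈ c.support, Near G W P A w z := by
      intro z hz
      refine h.near_walk hS hno hw hwB hnear (c.rotate _ hx) (fun y hy => hcS y ((hrot y).1 hy))
        (fun e he => hcE e ((c.rotate_edges _ hx).mem_iff.1 he)) z ((hrot z).2 hz)
    have hcW : ∀ z ∈ c.support, z ∈ W → z = w := fun z hz hzW => by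
      obtain ⟨q, hq, -⟩ := hall z hz
      exact hq z q.end_mem_support hzW
    have hcP : ∀ z ∈ c.support, ∀ w' ∈ P, z ∈ A w' → w' = w := fun z hz => by
      obtain ⟨q, -, hq⟩ := hall z hz
      exact hq z q.end_mem_support
    by_cases hwc : w ∈ c.support
    · have hrot : ∀ z, z ∈ (c.rotate _ hwc).support ↔ z ∈ c.support :=
        fun z => c.mem_support_rotate_iff _ hwc
      refine hno (h.exists_good_of_petal hS hw (hcS w hwc) (c.rotate _ hwc) (hc.rotate hwc)
        (fun z hz => hcW z ((hrot z).1 hz)) fun z hz w' hw' hzA => ?_)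
      exact hcS w hwc (h.P_sub (hcP z ((hrot z).1 hz) w' hw' hzA ▸ hw'))
    · have hcW' : ∀ z ∈ c.support, z ∉ W := fun z hz hzW => hwc (hcW z hz hzW ▸ hz)
      by_cases hl : w ∈ P ∧ ∃ z ∈ c.support, z ∈ A w
      · obtain ⟨hwP, z, hz, hzA⟩ := hl
        exact hno (h.exists_good_of_lollipop hS hwP c hc hcW' hcP hz hzA)
      · refine hno (h.exists_good_of_cycle hS c hc hcW' fun z hz w' hw' hzA => ?_)
        obtain rfl := hcP z hz w' hw' hzA
        exact hl ⟨hw', z, hz, hzA⟩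
  · push Not at hex
    refine hno (h.exists_good_of_cycle hS c hc (fun z hz hzW => ?_) fun z hz w hw hzA => ?_)
    · exact hex z hz z hzW (fun hB => hcS z hz (h.B_sub hB)) (h.near_refl hzW)
    · exact hex z hz w (h.S_sub (h.P_sub hw)) (h.disj w hw) (h.near_petal hw hzA)

end Cert

lemma Good.exists_adj {S : Finset V} {m : ℕ} (h : Good G S m) {x : V} (hx : x ∈ S) :
    ∃ y, G.Adj x y := by
  obtain ⟨W, B, P, E, A, k, h, -⟩ := h
  exact h.supp x (h.S_sub hx)

lemma Good.exists_acyclic {S X : Finset V} (hX : ∀ x y, G.Adj x y → x ∈ X)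
    (hS : Good G S 0) : ∃ S', S ⊆ S' ∧ Good G S' 0 ∧ (del G S').IsAcyclic := by
  by_contra! hcon
  have key : ∀ m, ∃ S', S ⊆ S' ∧ Good G S' m := by
    intro m
    induction m with
    | zero => exact ⟨S, subset_rfl, hS⟩
    | succ m ih =>
      obtain ⟨S', hSS', W, B, P, E, A, k, h, hc, hm⟩ := ih
      obtain ⟨T, hT, W', B', P', E', A', k', h', hc', hm'⟩ :=
        h.exists_good hc (hcon S' hSS' ⟨W, B, P, E, A, k, h, hc, Nat.zero_le _⟩)
      exact ⟨T, hSS'.trans hT, W', B', P', E', A', k', h', hc', by omega⟩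
  obtain ⟨S', -, W, B, P, E, A, k, h, -, hm⟩ := key (X.sym2.card + X.card + 1)
  have hWX : W ⊆ X := fun x hx => by
    obtain ⟨y, hy⟩ := h.supp x hx
    exact hX x y hy
  have hE : E ⊆ X.sym2 := fun e he => Finset.mem_sym2_iff.2 fun x hx => hWX (h.ends e he x hx)
  have h1 := Finset.card_le_card hE
  have h2 := Finset.card_le_card (h.S_sub.trans hWX)
  omega

lemma Good.card_le {S F : Finset V} {m : ℕ} (h : Good G S m) (hF : (del G F).IsAcyclic) :
    S = ∅ ∨ S.card + 2 ≤ 5 * F.card := by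
  obtain ⟨W, B, P, E, A, k, h, hS, -⟩ := h
  rcases W.eq_empty_or_nonempty with rfl | hW
  · exact Or.inl (Finset.subset_empty.1 h.S_sub)
  · have := h.bound hW hF
    exact Or.inr (by omega)

/-- The subgraph of `G` formed by the edges among the vertices smaller than `i`. -/
def truncation (G : SimpleGraph ℕ) (i : ℕ) : SimpleGraph ℕ where
  Adj x y := G.Adj x y ∧ x < i ∧ y < i
  symm := ⟨fun _ _ h => ⟨h.1.symm, h.2.2, h.2.1⟩⟩
  loopless := ⟨fun _ h => h.1.ne rfl⟩

open Classical in
/-- A certified superset of `S` that is a feedback vertex set of `G`, if there is one. -/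
noncomputable def complete (G : SimpleGraph ℕ) (S : Finset ℕ) : Finset ℕ :=
  if h : ∃ S', S ⊆ S' ∧ Good G S' 0 ∧ (del G S').IsAcyclic then h.choose else S

/-- The set selected after the first `i` vertices of `G` have arrived. -/
noncomputable def selected (G : SimpleGraph ℕ) : ℕ → Finset ℕ
  | 0 => ∅
  | i + 1 => complete (truncation G (i + 1)) (selected G i)

lemma subset_complete (G : SimpleGraph ℕ) (S : Finset ℕ) : S ⊆ complete G S := by
  unfold complete
  split_ifs with h
  · exact h.choose_spec.1
  · exact subset_rfl

lemma selected_spec (G : SimpleGraph ℕ) (i : ℕ) :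
    Good (truncation G i) (selected G i) 0 ∧
      (del (truncation G i) (selected G i)).IsAcyclic := by
  induction i with
  | zero =>
    refine ⟨⟨_, _, _, _, _, _, Cert.empty _, by simp [selected], Nat.zero_le _⟩, ?_⟩
    refine IsAcyclic.anti (G' := ⊥) ?_ isAcyclic_bot
    exact fun x y hxy => absurd hxy.1.2.1 (Nat.not_lt_zero _)
  | succ i ih =>
    obtain ⟨W, B, P, E, A, k, h, hc, hm⟩ := ih.1
    have hle : truncation G i ≤ truncation G (i + 1) :=
      fun x y hxy => ⟨hxy.1, hxy.2.1.trans i.lt_succ_self, hxy.2.2.trans i.lt_succ_self⟩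
    have hex := Good.exists_acyclic (G := truncation G (i + 1)) (X := Finset.range (i + 1))
      (fun x y hxy => Finset.mem_range.2 hxy.2.1) ⟨W, B, P, E, A, k, h.mono hle, hc, hm⟩
    rw [selected, complete, dif_pos hex]
    exact hex.choose_spec.2

lemma lt_of_mem_selected {G : SimpleGraph ℕ} {i x : ℕ} (hx : x ∈ selected G i) : x < i := by
  obtain ⟨y, hy⟩ := (selected_spec G i).1.exists_adj hx
  exact hy.2.1

lemma selected_congr {G G' : SimpleGraph ℕ} {i : ℕ} (h : truncation G i = truncation G' i) :
    selected G i = selected G' i := by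
  induction i with
  | zero => rfl
  | succ i ih =>
    rw [selected, selected, h, ih]
    ext x y
    have hxy := congrArg (fun H => H.Adj x y) h
    simp only [truncation, eq_iff_iff] at hxy ⊢
    constructor <;> rintro ⟨ha, hx, hy⟩
    · exact ⟨(hxy.1 ⟨ha, by omega, by omega⟩).1, hx, hy⟩
    · exact ⟨(hxy.2 ⟨ha, by omega, by omega⟩).1, hx, hy⟩

/-- An instance on `Fin n`, viewed as a graph on `ℕ`. -/
abbrev lift {n : ℕ} (G : SimpleGraph (Fin n)) : SimpleGraph ℕ := G.map Fin.valEmbedding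

lemma lift_adj {n : ℕ} {G : SimpleGraph (Fin n)} {x y : ℕ} :
    (lift G).Adj x y ↔ ∃ (hx : x < n) (hy : y < n), G.Adj ⟨x, hx⟩ ⟨y, hy⟩ := by
  rw [SimpleGraph.map_adj]
  constructor
  · rintro ⟨u, v, huv, rfl, rfl⟩
    exact ⟨u.2, v.2, huv⟩
  · rintro ⟨hx, hy, h⟩
    exact ⟨_, _, h, rfl, rfl⟩

lemma truncation_lift {n : ℕ} (G : SimpleGraph (Fin n)) : truncation (lift G) n = lift G := by
  ext x y
  refine ⟨fun h => h.1, fun h => ⟨h, ?_⟩⟩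
  obtain ⟨hx, hy, -⟩ := lift_adj.1 h
  exact ⟨hx, hy⟩

lemma isAcyclic_del_of_isFVS {n : ℕ} {G : SimpleGraph (Fin n)} {F : Finset (Fin n)}
    (hF : IsFVS G F) : (del (lift G) (F.map Fin.valEmbedding)).IsAcyclic := by
  refine (isAcyclic_map ((Function.Embedding.subtype _).trans Fin.valEmbedding) hF).anti ?_
  rintro x y ⟨hxy, hx, hy⟩
  obtain ⟨hxn, hyn, hadj⟩ := lift_adj.1 hxy
  refine (SimpleGraph.map_adj ..).2
    ⟨⟨⟨x, hxn⟩, fun h => hx ?_⟩, ⟨⟨y, hyn⟩, fun h => hy ?_⟩, hadj, rfl, rfl⟩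
  · exact Finset.mem_map.2 ⟨_, h, rfl⟩
  · exact Finset.mem_map.2 ⟨_, h, rfl⟩

/-- The online algorithm which keeps extending a certified set just enough to make the presented
graph acyclic. -/
noncomputable def algorithm : DelayedFVSAlgorithm where
  S n G i := Finset.univ.filter fun v => (v : ℕ) ∈ selected (lift G) i
  mem_lt n G i v hv := lt_of_mem_selected (Finset.mem_filter.1 hv).2
  online n m G G' i hn hm h := by
    have himage : ∀ (l : ℕ) (H : SimpleGraph (Fin l)), i ≤ l →
        (Finset.univ.filter fun v : Fin l => (v : ℕ) ∈ selected (lift H) i).image Fin.val =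
          selected (lift H) i := by
      intro l H hl
      ext x
      simp only [Finset.mem_image, Finset.mem_filter, Finset.mem_univ, true_and]
      refine ⟨?_, fun hx => ⟨⟨x, (lt_of_mem_selected hx).trans_le hl⟩, hx, rfl⟩⟩
      rintro ⟨v, hv, rfl⟩
      exact hv
    rw [himage n G hn, himage m G' hm]
    apply selected_congr
    ext x y
    constructor <;> rintro ⟨hxy, hx, hy⟩ <;> obtain ⟨hxn, hyn, hadj⟩ := lift_adj.1 hxy <;>
      refine ⟨lift_adj.2 ⟨by omega, by omega, ?_⟩, hx, hy⟩
    · exact (h ⟨x, hx⟩ ⟨y, hy⟩).1 hadj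
    · exact (h ⟨x, hx⟩ ⟨y, hy⟩).2 hadj
  irrevocable n G i hi v hv := by
    simp only [Finset.mem_filter, Finset.mem_univ, true_and] at hv ⊢
    exact subset_complete _ _ hv
  valid n G i hi := by
    refine IsAcyclic.comap (G' := del (truncation (lift G) i) (selected (lift G) i))
      ⟨fun v => ((v : Fin n) : ℕ), ?_⟩ (Fin.val_injective.comp Subtype.val_injective)
      (selected_spec _ i).2
    rintro ⟨x, hx, hxS⟩ ⟨y, hy, hyS⟩ hxy
    simp only [Finset.mem_filter, Finset.mem_univ, true_and] at hxS hyS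
    exact ⟨⟨lift_adj.2 ⟨x.2, y.2, hxy⟩, hx, hy⟩, hxS, hyS⟩

lemma exists_isFVS_card {n : ℕ} (G : SimpleGraph (Fin n)) :
    ∃ F : Finset (Fin n), IsFVS G F ∧ F.card = fvsNum G := by
  refine Nat.sInf_mem (s := {k : ℕ | ∃ S : Finset (Fin n), IsFVS G S ∧ S.card = k})
    ⟨_, Finset.univ, ?_, rfl⟩
  rintro ⟨v, hv⟩
  exact absurd (Finset.mem_univ v) hv

lemma card_algorithm {n : ℕ} {G : SimpleGraph (Fin n)} {F : Finset (Fin n)} (hF : IsFVS G F) :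
    algorithm.S n G n = ∅ ∨ (algorithm.S n G n).card + 2 ≤ 5 * F.card := by
  have h := (selected_spec (lift G) n).1
  rw [truncation_lift] at h
  rcases h.card_le (isAcyclic_del_of_isFVS hF) with h | h
  · left
    simp [algorithm, h]
  · right
    rw [Finset.card_map] at h
    refine le_trans (Nat.add_le_add_right ?_ 2) h
    refine Finset.card_le_card_of_injOn Fin.val (fun v hv => ?_) Fin.val_injective.injOn
    simpa [algorithm] using hv

end OnlineFVS

/-- There is a deterministic delayed-decision algorithm for online Feedback Vertex Set
that selects nothing on acyclic instances, selects at most `5·μ(G) - 2` vertices on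
instances containing a cycle, and in particular achieves a strict competitive ratio of
`5 - 2/n`. -/
theorem fvs_delayed_upper_bound_five :
    ∃ A : DelayedFVSAlgorithm, ∀ (n : ℕ) (G : SimpleGraph (Fin n)),
      (G.IsAcyclic → A.S n G n = ∅) ∧
      (¬ G.IsAcyclic → ((A.S n G n).card : ℤ) ≤ 5 * (fvsNum G : ℤ) - 2) ∧
      (1 ≤ n → 1 ≤ fvsNum G →
        ((A.S n G n).card : ℝ) ≤ (5 - 2 / (n : ℝ)) * (fvsNum G : ℝ)) := by
  refine ⟨OnlineFVS.algorithm, fun n G => ?_⟩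
  obtain ⟨F, hF, hcard⟩ := OnlineFVS.exists_isFVS_card G
  have hbound := OnlineFVS.card_algorithm hF
  have hempty : G.IsAcyclic → IsFVS G ∅ := fun hG => hG.induce _
  have hzero : fvsNum G = 0 → G.IsAcyclic := by
    intro h0
    obtain rfl := Finset.card_eq_zero.1 (hcard.trans h0)
    exact IsAcyclic.comap (G' := G.induce {v : Fin n | v ∉ (∅ : Finset (Fin n))})
      ⟨fun v => ⟨v, by simp⟩, fun h => h⟩ (fun x y hxy => congrArg Subtype.val hxy) hF
  have hac : G.IsAcyclic → OnlineFVS.algorithm.S n G n = ∅ := by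
    intro hG
    rcases OnlineFVS.card_algorithm (hempty hG) with h | h
    · exact h
    · simp at h
  refine ⟨hac, fun hG => ?_, fun hn hμ => ?_⟩
  · have : fvsNum G ≠ 0 := fun h => hG (hzero h)
    rcases hbound with h | h
    · rw [h]
      simp only [Finset.card_empty]
      omega
    · omega
  · have hFn : F.card ≤ n := by simpa using F.card_le_univ
    have hn' : (0 : ℝ) < n := by exact_mod_cast hn
    have hμn : (fvsNum G : ℝ) ≤ n := by exact_mod_cast hcard ▸ hFn
    have hμ' : (1 : ℝ) ≤ fvsNum G := by exact_mod_cast hμ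
    have h1 : ((OnlineFVS.algorithm.S n G n).card : ℝ) + 2 ≤ 5 * fvsNum G := by
      rcases hbound with h | h
      · rw [h]
        simp only [Finset.card_empty, Nat.cast_zero]
        linarith
      · exact_mod_cast hcard ▸ h
    have h2 : 2 / (n : ℝ) * fvsNum G ≤ 2 := by
      rw [div_mul_eq_mul_div, div_le_iff₀ hn']
      linarith
    linarith
end

section
/- Let G be a finite simple graph with at least one vertex in which every vertex has degree at least 2, and let F be a feedback vertex set of G that contains every vertex of degree exactly 2. Then |V(G)| ≤ (Δ(G) + 1)·|F| − 2, where Δ(G) is the maximum degree of G. In particular, if every vertex of G has degree at most 3, then |V(G)| ≤ 4·|F| − 2. -/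
open SimpleGraph

/-- A forest on a nonempty finite vertex set has fewer edges than vertices. -/
theorem SimpleGraph.IsAcyclic.card_edgeFinset_add_one_le {W : Type*} [Fintype W] [Nonempty W]
    {H : SimpleGraph W} [Fintype H.edgeSet] (hH : H.IsAcyclic) :
    H.edgeFinset.card + 1 ≤ Fintype.card W := by
  classical
  obtain ⟨T, hHT, -, hT⟩ :=
    (connected_top (V := W)).exists_isTree_le_of_le_of_isAcyclic le_top hH
  rw [← hT.card_edgeFinset]
  gcongr

theorem SimpleGraph.degree_induce_setOf {V : Type*} [Fintype V]
    (G : SimpleGraph V) [DecidableRel G.Adj] (p : V → Prop) [DecidablePred p]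
    (v : {v : V | p v}) [Fintype ((G.induce {v : V | p v}).neighborSet v)] :
    (G.induce {v : V | p v}).degree v = ((G.neighborFinset v).filter p).card := by
  classical
  rw [← card_neighborFinset_eq_degree, ← Finset.card_map (Function.Embedding.subtype _)]
  congr 1
  ext w
  simp [and_comm]

/-- If the complement of `F` induces a nonempty forest whose vertices all have degree at least 3,
then many edges leave `F`. -/
theorem SimpleGraph.card_compl_add_two_le_sum_degree {V : Type*} [Fintype V] [DecidableEq V]
    (G : SimpleGraph V) [DecidableRel G.Adj] (F : Finset V)
    (hF : (G.induce {v : V | v ∉ F}).IsAcyclic) (hdeg : ∀ v ∉ F, 3 ≤ G.degree v)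
    (hne : Fᶜ.Nonempty) : Fᶜ.card + 2 ≤ ∑ v ∈ F, G.degree v := by
  obtain ⟨x, hx⟩ := hne
  have : Nonempty {v : V | v ∉ F} := ⟨⟨x, by simpa using hx⟩⟩
  have hcard : Fintype.card {v : V | v ∉ F} = Fᶜ.card :=
    Fintype.card_of_subtype _ (by simp)
  have hedges := hF.card_edgeFinset_add_one_le
  have hinner : ∑ v ∈ Fᶜ, ((G.neighborFinset v).filter (· ∉ F)).card =
      2 * (G.induce {v : V | v ∉ F}).edgeFinset.card := by
    rw [← sum_degrees_eq_twice_card_edges]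
    simp_rw [degree_induce_setOf]
    exact Finset.sum_subtype _ (by simp) _
  have hlower : 3 * Fᶜ.card ≤ ∑ v ∈ Fᶜ, G.degree v := by
    rw [mul_comm, ← smul_eq_mul]
    exact Finset.card_nsmul_le_sum _ _ _ fun v hv ↦ hdeg v (by simpa using hv)
  have hsplit : ∑ v ∈ Fᶜ, G.degree v = ∑ v ∈ Fᶜ, ((G.neighborFinset v).filter (· ∈ F)).card +
      ∑ v ∈ Fᶜ, ((G.neighborFinset v).filter (· ∉ F)).card := by
    rw [← Finset.sum_add_distrib]
    exact Finset.sum_congr rfl fun v _ ↦ (Finset.card_filter_add_card_filter_not _).symm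
  have hcross : ∑ v ∈ Fᶜ, ((G.neighborFinset v).filter (· ∈ F)).card ≤ ∑ v ∈ F, G.degree v := by
    have hswap := Finset.sum_card_bipartiteAbove_eq_sum_card_bipartiteBelow (s := Fᶜ) (t := F) G.Adj
    calc _ = ∑ v ∈ Fᶜ, (Finset.bipartiteAbove G.Adj F v).card := by
          refine Finset.sum_congr rfl fun v _ ↦ congrArg _ ?_
          ext w
          simp [and_comm]
      _ = _ := hswap
      _ ≤ _ := Finset.sum_le_sum fun v _ ↦ by
          rw [← card_neighborFinset_eq_degree]
          refine Finset.card_le_card fun w hw ↦ ?_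
          simpa [adj_comm] using (Finset.mem_bipartiteBelow _).1 hw |>.2
  omega

open SimpleGraph

/-- Let `G` be a finite nonempty simple graph with minimum degree at least 2 and let
`F` be a feedback vertex set of `G` containing all vertices of degree exactly 2. Then
`|V(G)| ≤ (Δ(G) + 1)·|F| - 2`; in particular, if every vertex has degree at most 3,
then `|V(G)| ≤ 4·|F| - 2`. -/
theorem fvs_size_bound {V : Type*} [Fintype V] [DecidableEq V] [Nonempty V]
    (G : SimpleGraph V) [DecidableRel G.Adj]
    (hdeg : ∀ v : V, 2 ≤ G.degree v)
    (F : Finset V)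
    (hF : (G.induce {v : V | v ∉ F}).IsAcyclic)
    (hF2 : ∀ v : V, G.degree v = 2 → v ∈ F) :
    (Fintype.card V : ℤ) ≤ ((G.maxDegree : ℤ) + 1) * F.card - 2 ∧
      ((∀ v : V, G.degree v ≤ 3) → (Fintype.card V : ℤ) ≤ 4 * F.card - 2) := by
  have hcard : F.card + Fᶜ.card = Fintype.card V := Finset.card_add_card_compl F
  have hbound (d : ℕ) (hd : ∀ v, G.degree v ≤ d) :
      (Fintype.card V : ℤ) ≤ ((d : ℤ) + 1) * F.card - 2 := by
    rcases Fᶜ.eq_empty_or_nonempty with hempty | hne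
    · have hd2 : 2 ≤ d := (hdeg (Classical.arbitrary V)).trans (hd _)
      have hpos : 0 < Fintype.card V := Fintype.card_pos
      rw [hempty, Finset.card_empty] at hcard
      have : 2 * F.card ≤ d * F.card := Nat.mul_le_mul_right _ hd2
      zify at *
      linarith
    · have hlow := G.card_compl_add_two_le_sum_degree F hF
        (fun v hv ↦ (hdeg v).lt_of_ne fun h ↦ hv (hF2 v h.symm)) hne
      have hup := Finset.sum_le_card_nsmul F (fun v ↦ G.degree v) d fun v _ ↦ hd v
      rw [smul_eq_mul] at hup
      zify at *
      linarith
  exact ⟨hbound _ G.degree_le_maxDegree, fun h ↦ hbound 3 h⟩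
end

section
/- For every real α ≥ 0 there exists a deterministic delayed-decision algorithm with reservations for online Feedback Vertex Set whose cost with reservation cost α is at most min{5, 1 + 5α}·μ(G) on every instance (n, G). -/
open SimpleGraph

/-- A deterministic delayed-decision algorithm with reservations for online
Feedback Vertex Set: besides the irrevocably selected set `S`, the algorithm may
reserve a set `R` of vertices. -/
structure DelayedFVSAlgorithmRes where
  /-- the set of irrevocably selected vertices after seeing the first `i` vertices -/
  S : ∀ n : ℕ, SimpleGraph (Fin n) → ℕ → Finset (Fin n)
  /-- the set of reserved vertices after seeing the first `i` vertices -/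
  R : ∀ n : ℕ, SimpleGraph (Fin n) → ℕ → Finset (Fin n)
  memS_lt : ∀ (n : ℕ) (G : SimpleGraph (Fin n)) (i : ℕ) (v : Fin n),
    v ∈ S n G i → (v : ℕ) < i
  memR_lt : ∀ (n : ℕ) (G : SimpleGraph (Fin n)) (i : ℕ) (v : Fin n),
    v ∈ R n G i → (v : ℕ) < i
  /-- determinism/online condition -/
  online : ∀ (n m : ℕ) (G : SimpleGraph (Fin n)) (G' : SimpleGraph (Fin m)) (i : ℕ)
      (hn : i ≤ n) (hm : i ≤ m),
      (∀ x y : Fin i, G.Adj (Fin.castLE hn x) (Fin.castLE hn y) ↔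
        G'.Adj (Fin.castLE hm x) (Fin.castLE hm y)) →
      (S n G i).image Fin.val = (S m G' i).image Fin.val ∧
      (R n G i).image Fin.val = (R m G' i).image Fin.val
  irrevocableS : ∀ (n : ℕ) (G : SimpleGraph (Fin n)) (i : ℕ), i < n →
    S n G i ⊆ S n G (i + 1)
  irrevocableR : ∀ (n : ℕ) (G : SimpleGraph (Fin n)) (i : ℕ), i < n →
    R n G i ⊆ R n G (i + 1)
  /-- the selected vertices together with the reserved ones form a valid partial
  solution: the subgraph induced on the remaining presented vertices is acyclic -/
  valid : ∀ (n : ℕ) (G : SimpleGraph (Fin n)) (i : ℕ), i ≤ n →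
    (G.induce {v : Fin n | (v : ℕ) < i ∧ v ∉ S n G i ∪ R n G i}).IsAcyclic

/-- The cost of an algorithm with reservations on the instance `(n, G)` with
reservation cost `α`: the irrevocably selected vertices, plus the minimum number of
further vertices needed to complete them to a feedback vertex set, plus `α` per
reserved vertex. -/
noncomputable def resCost (A : DelayedFVSAlgorithmRes) (α : ℝ) (n : ℕ)
    (G : SimpleGraph (Fin n)) : ℝ :=
  ((A.S n G n).card : ℝ) +
    ((sInf {k : ℕ | ∃ T : Finset (Fin n), IsFVS G (A.S n G n ∪ T) ∧ T.card = k} : ℕ) : ℝ) +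
    α * ((A.R n G n).card : ℝ)

/-- `G` has a cycle all of whose vertices lie in `A`. -/
def HasCycleIn {V : Type*} (G : SimpleGraph V) (A : Set V) : Prop :=
  ∃ (c : V) (w : G.Walk c c), w.IsCycle ∧ ∀ z ∈ w.support, z ∈ A

section Cycles

variable {V : Type*} {G : SimpleGraph V}

theorem HasCycleIn.mono {G' : SimpleGraph V} {A A' : Set V} (h : HasCycleIn G A) (hG : G ≤ G')
    (hA : A ⊆ A') : HasCycleIn G' A' := by
  obtain ⟨c, w, hw, hs⟩ := h
  refine ⟨c, w.mapLe hG, hw.mapLe hG, fun z hz => hA (hs z ?_)⟩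
  simpa using hz

theorem induce_isAcyclic_iff {A : Set V} : (G.induce A).IsAcyclic ↔ ¬ HasCycleIn G A := by
  constructor
  · rintro h ⟨c, w, hw, hs⟩
    refine h (w.induce A hs) ?_
    rw [← Walk.isCycle_map_iff_of_injective (f := (Embedding.induce A).toHom)
      Subtype.val_injective, Walk.map_induce]
    exact hw
  · intro h c w hw
    refine h ⟨_, w.map (Embedding.induce A).toHom, hw.map Subtype.val_injective, ?_⟩
    intro z hz
    rw [Walk.support_map, List.mem_map] at hz
    obtain ⟨y, -, rfl⟩ := hz
    exact y.2

theorem SimpleGraph.IsAcyclic.card_edgeFinset_le [Fintype V] [Fintype G.edgeSet]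
    (h : G.IsAcyclic) : G.edgeFinset.card ≤ Fintype.card V := by
  classical
  rcases isEmpty_or_nonempty V with hV | hV
  · have : G = ⊥ := Subsingleton.elim _ _
    subst this
    simp
  · obtain ⟨T, hGT, -, hT⟩ :=
      (connected_top (V := V)).exists_isTree_le_of_le_of_isAcyclic le_top h
    have h1 := hT.card_edgeFinset
    have h2 : G.edgeFinset.card ≤ T.edgeFinset.card :=
      Finset.card_le_card (edgeFinset_mono hGT)
    omega

open Classical in
theorem sum_card_adj_le_of_isAcyclic (A : Finset V) (h : ¬ HasCycleIn G (A : Set V)) :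
    ∑ v ∈ A, (A.filter (G.Adj v)).card ≤ 2 * A.card := by
  have h1 := (induce_isAcyclic_iff.2 h).card_edgeFinset_le
  have h2 := (G.induce (A : Set V)).sum_degrees_eq_twice_card_edges
  have h3 : ∑ v ∈ A, (A.filter (G.Adj v)).card =
      ∑ v : (A : Set V), (G.induce (A : Set V)).degree v := by
    rw [← Finset.sum_coe_sort]
    refine Finset.sum_congr rfl fun v _ => ?_
    rw [← card_neighborFinset_eq_degree]
    refine Finset.card_bij' (fun a ha => ⟨a, (Finset.mem_filter.1 ha).1⟩) (fun a _ => a.1)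
      ?_ ?_ ?_ ?_
    · intro a ha
      simpa using (Finset.mem_filter.1 ha).2
    · intro a ha
      simpa using ha
    · simp
    · simp
  have h4 : Fintype.card (A : Set V) = A.card := by simp
  rw [h3, h2]
  omega

/-- A walk ending in `A` can be cut at its first vertex in `A`. -/
theorem SimpleGraph.Walk.exists_first_hit {u v : V} (w : G.Walk u v) (A : Set V) (hv : v ∈ A) :
    ∃ a ∈ A, ∃ w' : G.Walk u a, (∀ z ∈ w'.support, z ∈ w.support) ∧
      ∀ z ∈ w'.support, z ∈ A → z = a := by
  induction w with
  | nil => exact ⟨_, hv, .nil, by simp, by simp⟩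
  | @cons u x v h w ih =>
    by_cases hu : u ∈ A
    · exact ⟨u, hu, .nil, by simp, by simp⟩
    · obtain ⟨a, ha, w', h1, h2⟩ := ih hv
      refine ⟨a, ha, .cons h w', ?_, ?_⟩
      · intro z hz
        rw [Walk.support_cons, List.mem_cons] at hz ⊢
        exact hz.imp id (h1 z)
      · intro z hz hzA
        rw [Walk.support_cons, List.mem_cons] at hz
        rcases hz with rfl | hz
        · exact absurd hzA hu
        · exact h2 z hz hzA

/-- Any two vertices of a closed walk are joined by a walk inside it. -/
theorem SimpleGraph.Walk.exists_walk_of_mem_support {u v : V} (w : G.Walk u v) {a b : V}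
    (ha : a ∈ w.support) (hb : b ∈ w.support) :
    ∃ w' : G.Walk a b, ∀ z ∈ w'.support, z ∈ w.support := by
  classical
  refine ⟨(w.takeUntil a ha).reverse.append (w.takeUntil b hb), fun z hz => ?_⟩
  rw [Walk.mem_support_append_iff, Walk.support_reverse, List.mem_reverse] at hz
  exact hz.elim (fun h => w.support_takeUntil_subset_support ha h)
    (fun h => w.support_takeUntil_subset_support hb h)

/-- Two vertices of a cycle are joined inside the cycle by a walk avoiding a given third one. -/
theorem SimpleGraph.Walk.IsCycle.exists_walk_avoiding {u : V} {w : G.Walk u u} (hw : w.IsCycle)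
    {a b p : V} (ha : a ∈ w.support) (hb : b ∈ w.support) (hp : p ∈ w.support) (hap : a ≠ p)
    (hbp : b ≠ p) : ∃ w' : G.Walk a b, p ∉ w'.support ∧ ∀ z ∈ w'.support, z ∈ w.support := by
  classical
  have hr := hw.rotate hp
  have hmem : ∀ z, z ∈ (w.rotate p hp).support ↔ z ∈ w.support := fun z =>
    w.mem_support_rotate_iff p hp
  generalize w.rotate p hp = r at hr hmem
  cases r with
  | nil => exact absurd hr (by simp)
  | @cons _ x _ h t =>
    have ht : t.IsPath := (Walk.cons_isCycle_iff t h).1 hr |>.1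
    have hat : a ∈ t.support := by
      have := (hmem a).2 ha
      rw [Walk.support_cons, List.mem_cons] at this
      exact this.resolve_left hap
    have hbt : b ∈ t.support := by
      have := (hmem b).2 hb
      rw [Walk.support_cons, List.mem_cons] at this
      exact this.resolve_left hbp
    refine ⟨(t.takeUntil a hat).reverse.append (t.takeUntil b hbt), ?_, fun z hz => ?_⟩
    · rw [Walk.mem_support_append_iff, Walk.support_reverse, List.mem_reverse, not_or]
      exact ⟨Walk.endpoint_notMem_support_takeUntil ht hat hap.symm,
        Walk.endpoint_notMem_support_takeUntil ht hbt hbp.symm⟩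
    · rw [Walk.mem_support_append_iff, Walk.support_reverse, List.mem_reverse] at hz
      rw [← hmem, Walk.support_cons, List.mem_cons]
      exact Or.inr (hz.elim (fun h => t.support_takeUntil_subset_support hat h)
        (fun h => t.support_takeUntil_subset_support hbt h))

theorem SimpleGraph.Walk.IsCycle.encard_neighborSet_toSubgraph {u v : V} {w : G.Walk u u}
    (hw : w.IsCycle) (hv : v ∈ w.support) : (w.toSubgraph.neighborSet v).encard = 2 := by
  rw [← (Walk.finite_neighborSet_toSubgraph w).cast_ncard_eq,
    hw.ncard_neighborSet_toSubgraph_eq_two hv]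
  rfl

theorem SimpleGraph.Walk.IsPath.encard_neighborSet_toSubgraph {u v z : V} {w : G.Walk u v}
    (hw : w.IsPath) (hz : z ∈ w.support) (hu : z ≠ u) (hv : z ≠ v) :
    (w.toSubgraph.neighborSet z).encard = 2 := by
  obtain ⟨i, rfl, hi⟩ := Walk.mem_support_iff_exists_getVert.1 hz
  have h0 : i ≠ 0 := by
    rintro rfl
    simp at hu
  have h1 : i ≠ w.length := by
    rintro rfl
    simp at hv
  rw [← (Walk.finite_neighborSet_toSubgraph w).cast_ncard_eq,
    hw.ncard_neighborSet_toSubgraph_internal_eq_two h0 (lt_of_le_of_ne hi h1)]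
  rfl

end Cycles

/-- Combinatorial data certifying a lower bound on the feedback vertex sets of `G`: a subgraph `H`
of `G` with vertex set `U` all of whose vertices have degree `2`, except those of `B`, which have
degree `3`; pairwise disjoint connected sets `P x`, for `x ∈ X`, that contain cycles and meet `U` in
the degree-two vertex `x` only; and a family `W` of pairwise disjoint subsets of `U` that contain
cycles. The set `S` contains `B`, `X` and a vertex of every connected component of `H`. -/
structure TwoThreeCertificate {V : Type*} (G : SimpleGraph V) (S : Finset V) (H : SimpleGraph V)
    (U B X : Finset V) (P : V → Set V) (W : Finset (Finset V)) : Prop where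
  le : H ≤ G
  B_subset : B ⊆ U
  X_subset : X ⊆ U
  disjoint : Disjoint X B
  mem_of_adj : ∀ a b, H.Adj a b → a ∈ U
  degree_two : ∀ v ∈ U, v ∉ B → (H.neighborSet v).encard = 2
  degree_three : ∀ v ∈ B, (H.neighborSet v).encard = 3
  reachable : ∀ u ∈ U, ∃ s ∈ S, H.Reachable u s
  B_selected : B ⊆ S
  X_selected : X ⊆ S
  P_inter : ∀ x ∈ X, ∀ z ∈ P x, z ∈ U → z = x
  P_walk : ∀ x ∈ X, ∀ z ∈ P x, ∃ w : G.Walk x z, ∀ y ∈ w.support, y ∈ P x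
  P_cycle : ∀ x ∈ X, HasCycleIn G (P x)
  P_disjoint : ∀ x ∈ X, ∀ y ∈ X, x ≠ y → Disjoint (P x) (P y)
  W_subset : ∀ Z ∈ W, Z ⊆ U
  W_cycle : ∀ Z ∈ W, HasCycleIn G (Z : Set V)
  W_disjoint : ∀ Z ∈ W, ∀ Z' ∈ W, Z ≠ Z' → Disjoint Z Z'

namespace TwoThreeCertificate

variable {V : Type*} {G H : SimpleGraph V} {S U B X : Finset V} {P : V → Set V}
  {W : Finset (Finset V)}

theorem mono {G' : SimpleGraph V} (h : TwoThreeCertificate G S H U B X P W) (hG : G ≤ G') :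
    TwoThreeCertificate G' S H U B X P W :=
  { h with
    le := h.le.trans hG
    P_walk := fun x hx z hz => by
      obtain ⟨w, hw⟩ := h.P_walk x hx z hz
      exact ⟨w.mapLe hG, fun y hy => hw y (by simpa using hy)⟩
    P_cycle := fun x hx => (h.P_cycle x hx).mono hG subset_rfl
    W_cycle := fun Z hZ => (h.W_cycle Z hZ).mono hG subset_rfl }

theorem empty (G : SimpleGraph V) (P : V → Set V) : TwoThreeCertificate G ∅ ⊥ ∅ ∅ ∅ P ∅ := by
  constructor <;> simp

theorem mem_P_self (h : TwoThreeCertificate G S H U B X P W) {x : V} (hx : x ∈ X) : x ∈ P x := by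
  obtain ⟨c, w, -, hs⟩ := h.P_cycle x hx
  obtain ⟨w', hw'⟩ := h.P_walk x hx c (hs c w.start_mem_support)
  exact hw' x w'.start_mem_support

open Classical in
theorem card_filter_adj (h : TwoThreeCertificate G S H U B X P W) {v : V} (hv : v ∈ U) :
    (U.filter (H.Adj v)).card = 2 + if v ∈ B then 1 else 0 := by
  have h1 : H.neighborSet v = ↑(U.filter (H.Adj v)) := by
    ext w
    simp only [mem_neighborSet, Finset.coe_filter, Set.mem_ofPred_eq]
    exact ⟨fun hw => ⟨h.mem_of_adj _ _ hw.symm, hw⟩, fun hw => hw.2⟩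
  split_ifs with hB
  · have h2 := h.degree_three v hB
    rw [h1, Set.encard_coe_eq_coe_finsetCard] at h2
    exact_mod_cast h2
  · have h2 := h.degree_two v hv hB
    rw [h1, Set.encard_coe_eq_coe_finsetCard] at h2
    exact_mod_cast h2

open Classical in
theorem card_B_le (h : TwoThreeCertificate G S H U B X P W) {F : Finset V}
    (hF : ¬ HasCycleIn G {v | v ∉ F}) :
    B.card ≤ 2 * (U ∩ F).card + 2 * (B ∩ F).card := by
  set A := U \ F with hA
  have h1 : ∑ v ∈ A, (A.filter (H.Adj v)).card ≤ 2 * A.card := by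
    refine sum_card_adj_le_of_isAcyclic A fun hc => hF (hc.mono h.le fun v hv => ?_)
    exact (Finset.mem_sdiff.1 hv).2
  have h2 : ∑ v ∈ A, (U.filter (H.Adj v)).card =
      ∑ v ∈ A, (A.filter (H.Adj v)).card + ∑ v ∈ A, ((U ∩ F).filter (H.Adj v)).card := by
    rw [← Finset.sum_add_distrib]
    refine Finset.sum_congr rfl fun v _ => ?_
    rw [← Finset.card_union_of_disjoint]
    · rw [← Finset.filter_union, hA, Finset.sdiff_union_inter]
    · exact Finset.disjoint_filter_filter (Finset.disjoint_sdiff_inter U F)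
  have h3 : ∑ v ∈ A, ((U ∩ F).filter (H.Adj v)).card =
      ∑ v ∈ U ∩ F, (A.filter (H.Adj v)).card := by
    have := Finset.sum_card_bipartiteAbove_eq_sum_card_bipartiteBelow (s := A) (t := U ∩ F) H.Adj
    simp only [Finset.bipartiteAbove, Finset.bipartiteBelow] at this
    rw [this]
    simp only [H.adj_comm]
  have h4 : ∑ v ∈ U ∩ F, (A.filter (H.Adj v)).card ≤
      ∑ v ∈ U ∩ F, (U.filter (H.Adj v)).card :=
    Finset.sum_le_sum fun v _ =>
      Finset.card_le_card (Finset.filter_subset_filter _ Finset.sdiff_subset)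
  have h5 : ∀ T ⊆ U, ∑ v ∈ T, (U.filter (H.Adj v)).card = 2 * T.card + (T ∩ B).card := by
    intro T hT
    rw [Finset.sum_congr rfl fun v hv => h.card_filter_adj (hT hv), Finset.sum_add_distrib,
      Finset.sum_const, ← Finset.sum_filter, Finset.sum_const, Finset.filter_mem_eq_inter]
    simp [mul_comm]
  rw [h5 A Finset.sdiff_subset] at h2
  rw [h5 (U ∩ F) Finset.inter_subset_left] at h4
  have h6 : (A ∩ B).card + (B ∩ F).card = B.card := by
    rw [← Finset.card_union_of_disjoint]
    · congr 1
      ext v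
      have := @h.B_subset v
      simp only [hA, Finset.mem_union, Finset.mem_inter, Finset.mem_sdiff]
      tauto
    · rw [Finset.disjoint_left]
      intro v
      simp only [hA, Finset.mem_inter, Finset.mem_sdiff]
      tauto
  have h7 : (U ∩ F ∩ B).card ≤ (B ∩ F).card := by
    refine Finset.card_le_card fun v => ?_
    simp only [Finset.mem_inter]
    tauto
  omega

open Classical in
theorem card_X_le (h : TwoThreeCertificate G S H U B X P W) {F : Finset V}
    (hF : ¬ HasCycleIn G {v | v ∉ F}) : X.card ≤ (F \ B).card := by
  have h1 : ∀ x ∈ X, ∃ f ∈ F, f ∈ P x := by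
    intro x hx
    by_contra! hcon
    exact hF ((h.P_cycle x hx).mono le_rfl fun z hz hzF => hcon z hzF hz)
  choose! f hfF hfP using h1
  refine Finset.card_le_card_of_injOn f (fun x hx => ?_) fun x hx y hy hxy => ?_
  · refine Finset.mem_coe.2 (Finset.mem_sdiff.2 ⟨hfF x hx, fun hB => ?_⟩)
    rw [h.P_inter x hx _ (hfP x hx) (h.B_subset hB)] at hB
    exact Finset.disjoint_left.1 h.disjoint hx hB
  · by_contra hne
    refine Set.disjoint_left.1 (h.P_disjoint x hx y hy hne) (hfP x hx) ?_
    rw [hxy]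
    exact hfP y hy

open Classical in
theorem card_W_le (h : TwoThreeCertificate G S H U B X P W) {F : Finset V}
    (hF : ¬ HasCycleIn G {v | v ∉ F}) : W.card ≤ (U ∩ F).card := by
  have h1 : ∀ Z ∈ W, ∃ f ∈ F, f ∈ Z := by
    intro Z hZ
    by_contra! hcon
    exact hF ((h.W_cycle Z hZ).mono le_rfl fun z hz hzF => hcon z hzF hz)
  by_cases hW : W = ∅
  · simp [hW]
  obtain ⟨Z₀, hZ₀⟩ := Finset.nonempty_iff_ne_empty.2 hW
  have : Nonempty V := ⟨(h1 Z₀ hZ₀).choose⟩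
  choose! f hfF hfZ using h1
  refine Finset.card_le_card_of_injOn f (fun Z hZ => ?_) fun Z hZ Z' hZ' hxy => ?_
  · exact Finset.mem_coe.2 (Finset.mem_inter.2 ⟨h.W_subset Z hZ (hfZ Z hZ), hfF Z hZ⟩)
  · by_contra hne
    refine Finset.disjoint_left.1 (h.W_disjoint Z hZ Z' hZ' hne) (hfZ Z hZ) ?_
    rw [hxy]
    exact hfZ Z' hZ'

/-- Every feedback vertex set has at least a fifth of the size certified. -/
theorem card_le (h : TwoThreeCertificate G S H U B X P W) {F : Finset V}
    (hF : ¬ HasCycleIn G {v | v ∉ F}) : B.card + X.card + W.card ≤ 5 * F.card := by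
  classical
  have h1 := h.card_B_le hF
  have h2 := h.card_X_le hF
  have h3 := h.card_W_le hF
  have h4 : (F \ B).card + (B ∩ F).card = F.card := by
    rw [Finset.inter_comm]
    exact Finset.card_sdiff_add_card_inter F B
  have h5 : (U ∩ F).card ≤ F.card := Finset.card_le_card Finset.inter_subset_right
  omega

end TwoThreeCertificate

namespace TwoThreeCertificate

variable {V : Type*} {G H : SimpleGraph V} {S U B X : Finset V} {P : V → Set V}
  {W : Finset (Finset V)}

theorem _root_.SimpleGraph.Walk.mem_edges_of_spanningCoe_adj {u v a b : V} {w : G.Walk u v} :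
    w.toSubgraph.spanningCoe.Adj a b ↔ s(a, b) ∈ w.edges := by
  rw [Subgraph.spanningCoe_adj, Walk.adj_toSubgraph_iff_mem_edges]

theorem _root_.SimpleGraph.Walk.reachable_spanningCoe {u v z : V} (w : G.Walk u v)
    (hz : z ∈ w.support) : w.toSubgraph.spanningCoe.Reachable z u := by
  classical
  refine ⟨((w.takeUntil z hz).transfer w.toSubgraph.spanningCoe fun e he => ?_).reverse⟩
  induction e with
  | _ a b =>
    rw [mem_edgeSet, Walk.mem_edges_of_spanningCoe_adj]
    exact w.edges_takeUntil_subset_edges hz he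

open Classical in
/-- Add a cycle disjoint from `U` to the subgraph of a certificate. -/
theorem addCycle (h : TwoThreeCertificate G S H U B X P W) {c : V} {w : G.Walk c c}
    (hw : w.IsCycle) (hU : ∀ z ∈ w.support, z ∉ U) {X' : Finset V} (hX : X' ⊆ X)
    (hP : ∀ x ∈ X', ∀ z ∈ w.support, z ∉ P x) :
    TwoThreeCertificate G (insert c S) (H ⊔ w.toSubgraph.spanningCoe) (U ∪ w.support.toFinset) B
      X' P (insert w.support.toFinset W) where
  le := sup_le h.le (Subgraph.spanningCoe_le _)
  B_subset := h.B_subset.trans Finset.subset_union_left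
  X_subset := (hX.trans h.X_subset).trans Finset.subset_union_left
  disjoint := h.disjoint.mono_left hX
  mem_of_adj a b hab := by
    rw [Finset.mem_union, List.mem_toFinset]
    rcases hab with hab | hab
    · exact Or.inl (h.mem_of_adj _ _ hab)
    · exact Or.inr (Walk.fst_mem_support_of_mem_edges _ (Walk.mem_edges_of_spanningCoe_adj.1 hab))
  degree_two v hv hvB := by
    rw [neighborSet_sup]
    rw [Finset.mem_union, List.mem_toFinset] at hv
    by_cases hvw : v ∈ w.support
    · have h1 : H.neighborSet v = ∅ := by
        ext b
        simpa using fun hb => hU v hvw (h.mem_of_adj _ _ hb)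
      rw [h1, Set.empty_union]
      exact hw.encard_neighborSet_toSubgraph hvw
    · have h1 : w.toSubgraph.spanningCoe.neighborSet v = ∅ := by
        ext b
        simpa using fun hb => hvw (Walk.mem_support_of_adj_toSubgraph hb)
      rw [h1, Set.union_empty]
      exact h.degree_two v (hv.resolve_right hvw) hvB
  degree_three v hv := by
    have hvw : v ∉ w.support := fun hvw => hU v hvw (h.B_subset hv)
    have h1 : w.toSubgraph.spanningCoe.neighborSet v = ∅ := by
      ext b
      simpa using fun hb => hvw (Walk.mem_support_of_adj_toSubgraph hb)
    rw [neighborSet_sup, h1, Set.union_empty]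
    exact h.degree_three v hv
  reachable u hu := by
    rw [Finset.mem_union, List.mem_toFinset] at hu
    rcases hu with hu | hu
    · obtain ⟨s, hs, hr⟩ := h.reachable u hu
      exact ⟨s, Finset.mem_insert_of_mem hs, hr.mono le_sup_left⟩
    · exact ⟨c, Finset.mem_insert_self _ _, (w.reachable_spanningCoe hu).mono le_sup_right⟩
  B_selected := h.B_selected.trans (Finset.subset_insert _ _)
  X_selected := (hX.trans h.X_selected).trans (Finset.subset_insert _ _)
  P_inter x hx z hz hzU := by
    rw [Finset.mem_union, List.mem_toFinset] at hzU
    exact h.P_inter x (hX hx) z hz (hzU.resolve_right fun hzw => hP x hx z hzw hz)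
  P_walk x hx := h.P_walk x (hX hx)
  P_cycle x hx := h.P_cycle x (hX hx)
  P_disjoint x hx y hy := h.P_disjoint x (hX hx) y (hX hy)
  W_subset Z hZ := by
    rcases Finset.mem_insert.1 hZ with rfl | hZ
    · exact Finset.subset_union_right
    · exact (h.W_subset Z hZ).trans Finset.subset_union_left
  W_cycle Z hZ := by
    rcases Finset.mem_insert.1 hZ with rfl | hZ
    · exact ⟨c, w, hw, fun z hz => by simpa using hz⟩
    · exact h.W_cycle Z hZ
  W_disjoint Z hZ Z' hZ' hne := by
    have key : ∀ Z ∈ W, Disjoint w.support.toFinset Z := fun Z hZ =>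
      Finset.disjoint_left.2 fun z hz hzZ => hU z (List.mem_toFinset.1 hz) (h.W_subset Z hZ hzZ)
    rcases Finset.mem_insert.1 hZ with rfl | hZ <;> rcases Finset.mem_insert.1 hZ' with rfl | hZ'
    · exact absurd rfl hne
    · exact key _ hZ'
    · exact (key _ hZ).symm
    · exact h.W_disjoint Z hZ Z' hZ' hne

open Classical in
/-- Add a path between two degree-two vertices to the subgraph of a certificate. -/
theorem addPath (h : TwoThreeCertificate G S H U B X P W) {p q : V} (hp : p ∈ U) (hq : q ∈ U)
    (hpB : p ∉ B) (hqB : q ∉ B) (hpq : p ≠ q) {w : G.Walk p q} (hw : w.IsPath)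
    (hU : ∀ z ∈ w.support, z ∈ U → z = p ∨ z = q) (hH : H.Adj p q → s(p, q) ∉ w.edges)
    (hP : ∀ z ∈ w.support, ∀ x ∈ X, z ∈ P x → x = p ∨ x = q) :
    TwoThreeCertificate G (insert p (insert q S)) (H ⊔ w.toSubgraph.spanningCoe)
      (U ∪ w.support.toFinset) (insert p (insert q B)) (X \ {p, q}) P W := by
  have hnil : ¬ w.Nil := Walk.not_nil_of_ne hpq
  have hdis : ∀ a b, H.Adj a b → ¬ w.toSubgraph.Adj a b := by
    intro a b hab hw
    have he := Walk.adj_toSubgraph_iff_mem_edges.1 hw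
    have ha := hU a (Walk.fst_mem_support_of_mem_edges _ he) (h.mem_of_adj _ _ hab)
    have hb := hU b (Walk.snd_mem_support_of_mem_edges _ he) (h.mem_of_adj _ _ hab.symm)
    rcases ha with rfl | rfl <;> rcases hb with rfl | rfl
    · exact hab.ne rfl
    · exact hH hab he
    · exact hH hab.symm (Sym2.eq_swap ▸ he)
    · exact hab.ne rfl
  have hend : ∀ v ∈ U, v ∉ B → (w.toSubgraph.neighborSet v).encard = 1 →
      ((H ⊔ w.toSubgraph.spanningCoe).neighborSet v).encard = 3 := by
    intro v hv hvB h1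
    rw [neighborSet_sup, Set.encard_union_eq, h.degree_two v hv hvB]
    · change 2 + (w.toSubgraph.neighborSet v).encard = 3
      rw [h1]
      rfl
    · exact Set.disjoint_left.2 fun b hb hb' => hdis v b hb hb'
  have hout : ∀ v, v ∉ w.support →
      (H ⊔ w.toSubgraph.spanningCoe).neighborSet v = H.neighborSet v := by
    intro v hv
    have h1 : w.toSubgraph.spanningCoe.neighborSet v = ∅ := by
      ext b
      simpa using fun hb => hv (Walk.mem_support_of_adj_toSubgraph hb)
    rw [neighborSet_sup, h1, Set.union_empty]
  have hXs : X \ {p, q} ⊆ X := Finset.sdiff_subset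
  have hXne : ∀ x ∈ X \ {p, q}, ¬ (x = p ∨ x = q) := by
    intro x hx
    simpa using (Finset.mem_sdiff.1 hx).2
  have hSs : S ⊆ insert p (insert q S) :=
    (Finset.subset_insert _ _).trans (Finset.subset_insert _ _)
  exact
  { le := sup_le h.le (Subgraph.spanningCoe_le _)
    B_subset := by
      refine Finset.Subset.trans ?_ Finset.subset_union_left
      exact Finset.insert_subset hp (Finset.insert_subset hq h.B_subset)
    X_subset := (hXs.trans h.X_subset).trans Finset.subset_union_left
    disjoint := by
      rw [Finset.disjoint_left]
      intro x hx hxB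
      have h1 := hXne x hx
      rw [Finset.mem_insert, Finset.mem_insert] at hxB
      rcases hxB with hx1 | hx1 | hx1
      · exact h1 (Or.inl hx1)
      · exact h1 (Or.inr hx1)
      · exact Finset.disjoint_left.1 h.disjoint (hXs hx) hx1
    mem_of_adj := by
      intro a b hab
      rw [Finset.mem_union, List.mem_toFinset]
      rcases hab with hab | hab
      · exact Or.inl (h.mem_of_adj _ _ hab)
      · exact Or.inr
          (Walk.fst_mem_support_of_mem_edges _ (Walk.mem_edges_of_spanningCoe_adj.1 hab))
    degree_two := by
      intro v hv hvB
      rw [Finset.mem_insert, Finset.mem_insert, not_or, not_or] at hvB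
      rw [Finset.mem_union, List.mem_toFinset] at hv
      by_cases hvw : v ∈ w.support
      · have hvU : v ∉ U := fun hvU => (hU v hvw hvU).elim hvB.1 hvB.2.1
        have h1 : H.neighborSet v = ∅ := by
          ext b
          simpa using fun hb => hvU (h.mem_of_adj _ _ hb)
        rw [neighborSet_sup, h1, Set.empty_union]
        exact hw.encard_neighborSet_toSubgraph hvw hvB.1 hvB.2.1
      · rw [hout v hvw]
        exact h.degree_two v (hv.resolve_right hvw) hvB.2.2
    degree_three := by
      intro v hv
      rw [Finset.mem_insert, Finset.mem_insert] at hv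
      rcases hv with rfl | rfl | hv
      · refine hend v hp hpB ?_
        rw [hw.neighborSet_toSubgraph_startpoint hnil, Set.encard_singleton]
      · refine hend v hq hqB ?_
        rw [hw.neighborSet_toSubgraph_endpoint hnil, Set.encard_singleton]
      · have hvw : v ∉ w.support := by
          intro hvw
          rcases hU v hvw (h.B_subset hv) with rfl | rfl
          · exact hpB hv
          · exact hqB hv
        rw [hout v hvw]
        exact h.degree_three v hv
    reachable := by
      intro u hu
      rw [Finset.mem_union, List.mem_toFinset] at hu
      rcases hu with hu | hu
      · obtain ⟨s, hs, hr⟩ := h.reachable u hu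
        exact ⟨s, hSs hs, hr.mono le_sup_left⟩
      · exact ⟨p, Finset.mem_insert_self _ _, (w.reachable_spanningCoe hu).mono le_sup_right⟩
    B_selected :=
      Finset.insert_subset_insert _ (Finset.insert_subset_insert _ h.B_selected)
    X_selected := (hXs.trans h.X_selected).trans hSs
    P_inter := by
      intro x hx z hz hzU
      rw [Finset.mem_union, List.mem_toFinset] at hzU
      exact h.P_inter x (hXs hx) z hz
        (hzU.resolve_right fun hzw => hXne x hx (hP z hzw x (hXs hx) hz))
    P_walk := fun x hx => h.P_walk x (hXs hx)
    P_cycle := fun x hx => h.P_cycle x (hXs hx)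
    P_disjoint := fun x hx y hy => h.P_disjoint x (hXs hx) y (hXs hy)
    W_subset := fun Z hZ => (h.W_subset Z hZ).trans Finset.subset_union_left
    W_cycle := h.W_cycle
    W_disjoint := h.W_disjoint }

open Classical in
/-- Add a cycle meeting `U` in a single degree-two vertex to the family `P` of a certificate. -/
theorem addCritical (h : TwoThreeCertificate G S H U B X P W) {p c : V} {w : G.Walk c c}
    (hw : w.IsCycle) (hpU : p ∈ U) (hpB : p ∉ B) (hp : p ∈ w.support)
    (hU : ∀ z ∈ w.support, z ∈ U → z = p) (hP : ∀ x ∈ X, ∀ z ∈ w.support, z ∉ P x) :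
    TwoThreeCertificate G (insert p S) H U B (insert p X)
      (Function.update P p {z | z ∈ w.support}) W := by
  have hpX : p ∉ X := fun hpX => hP p hpX p hp (h.mem_P_self hpX)
  have hne : ∀ x ∈ X, Function.update P p {z | z ∈ w.support} x = P x := by
    intro x hx
    exact Function.update_of_ne (ne_of_mem_of_not_mem hx hpX) _ _
  have heq : Function.update P p {z | z ∈ w.support} p = {z | z ∈ w.support} :=
    Function.update_self _ _ _
  have hdis : ∀ x ∈ X, Disjoint {z | z ∈ w.support} (P x) := fun x hx =>
    Set.disjoint_left.2 fun z hz hz' => hP x hx z hz hz'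
  exact
  { h with
    X_subset := Finset.insert_subset hpU h.X_subset
    disjoint := Finset.disjoint_insert_left.2 ⟨hpB, h.disjoint⟩
    reachable := by
      intro u hu
      obtain ⟨s, hs, hr⟩ := h.reachable u hu
      exact ⟨s, Finset.mem_insert_of_mem hs, hr⟩
    B_selected := h.B_selected.trans (Finset.subset_insert _ _)
    X_selected := Finset.insert_subset_insert _ h.X_selected
    P_inter := by
      intro x hx z hz hzU
      rcases Finset.mem_insert.1 hx with rfl | hx
      · rw [heq] at hz
        exact hU z hz hzU
      · rw [hne x hx] at hz
        exact h.P_inter x hx z hz hzU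
    P_walk := by
      intro x hx z hz
      rcases Finset.mem_insert.1 hx with rfl | hx
      · rw [heq] at hz ⊢
        exact w.exists_walk_of_mem_support hp hz
      · rw [hne x hx] at hz ⊢
        exact h.P_walk x hx z hz
    P_cycle := by
      intro x hx
      rcases Finset.mem_insert.1 hx with rfl | hx
      · rw [heq]
        exact ⟨c, w, hw, fun z hz => hz⟩
      · rw [hne x hx]
        exact h.P_cycle x hx
    P_disjoint := by
      intro x hx' y hy' hxy
      rcases Finset.mem_insert.1 hx' with rfl | hx <;> rcases Finset.mem_insert.1 hy' with rfl | hy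
      · exact absurd rfl hxy
      · rw [heq, hne y hy]
        exact hdis y hy
      · rw [heq, hne x hx]
        exact (hdis x hx).symm
      · rw [hne x hx, hne y hy]
        exact h.P_disjoint x hx y hy hxy }

end TwoThreeCertificate

namespace TwoThreeCertificate

variable {V : Type*} {G H : SimpleGraph V} {S U B X : Finset V} {P : V → Set V}
  {W : Finset (Finset V)}

open Classical in
theorem addWalk (h : TwoThreeCertificate G S H U B X P W) {p q : V} (hp : p ∈ U) (hq : q ∈ U)
    (hpB : p ∉ B) (hqB : q ∉ B) (hpq : p ≠ q) (w : G.Walk p q)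
    (hU : ∀ z ∈ w.support, z ∈ U → z = p ∨ z = q) (hH : H.Adj p q → s(p, q) ∉ w.edges)
    (hP : ∀ z ∈ w.support, ∀ x ∈ X, z ∈ P x → x = p ∨ x = q) :
    ∃ H' U', TwoThreeCertificate G (insert p (insert q S)) H' U' (insert p (insert q B))
      (X \ {p, q}) P W :=
  ⟨_, _, h.addPath hp hq hpB hqB hpq w.bypass_isPath
    (fun z hz => hU z (w.support_bypass_subset_support hz))
    (fun ha he => hH ha (w.edges_bypass_subset_edges he))
    (fun z hz => hP z (w.support_bypass_subset_support hz))⟩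

/-- `S` is at most as large as a certified lower bound, with potential at least `k`. -/
def _root_.IsCertified (G : SimpleGraph V) (S : Finset V) (k : ℕ) : Prop :=
  ∃ H U B X P W, TwoThreeCertificate G S H U B X P W ∧
    S.card ≤ B.card + X.card + W.card ∧ k ≤ 2 * B.card + X.card + W.card

open Classical in
theorem isCertified_of_walk (h : TwoThreeCertificate G S H U B X P W)
    (hS : S.card ≤ B.card + X.card + W.card) {p q : V} (hp : p ∈ U) (hq : q ∈ U)
    (hpB : p ∉ B) (hqB : q ∉ B) (hpq : p ≠ q) (w : G.Walk p q)
    (hU : ∀ z ∈ w.support, z ∈ U → z = p ∨ z = q) (hH : H.Adj p q → s(p, q) ∉ w.edges)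
    (hP : ∀ z ∈ w.support, ∀ x ∈ X, z ∈ P x → x = p ∨ x = q) :
    ∃ S', S ⊆ S' ∧ IsCertified G S' (2 * B.card + X.card + W.card + 1) := by
  obtain ⟨H', U', h'⟩ := h.addWalk hp hq hpB hqB hpq w hU hH hP
  have h1 : (insert p (insert q B)).card = B.card + 2 := by
    rw [Finset.card_insert_of_notMem, Finset.card_insert_of_notMem hqB]
    simp [hpq, hpB]
  have h2 : (insert p (insert q S)).card = S.card + ({p, q} \ S).card := by
    rw [← Finset.card_union_of_disjoint Finset.disjoint_sdiff]
    congr 1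
    ext v
    simp only [Finset.mem_insert, Finset.mem_union, Finset.mem_sdiff, Finset.mem_singleton]
    tauto
  have h3 : (X \ {p, q}).card + (X ∩ {p, q}).card = X.card :=
    Finset.card_sdiff_add_card_inter _ _
  have h4 : ({p, q} \ S).card + (X ∩ {p, q}).card ≤ 2 := by
    rw [← Finset.card_union_of_disjoint]
    · refine (Finset.card_le_card (t := {p, q}) ?_).trans Finset.card_le_two
      exact Finset.union_subset Finset.sdiff_subset Finset.inter_subset_right
    · rw [Finset.disjoint_left]
      intro v hv hv'
      exact (Finset.mem_sdiff.1 hv).2 (h.X_selected (Finset.mem_inter.1 hv').1)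
  refine ⟨_, (Finset.subset_insert _ _).trans (Finset.subset_insert _ _), _, _, _, _, _, _, h',
    ?_, ?_⟩ <;> omega

open Classical in
theorem card_insert_cycle (h : TwoThreeCertificate G S H U B X P W) {c : V} {w : G.Walk c c}
    (hU : ∀ z ∈ w.support, z ∉ U) : (insert w.support.toFinset W).card = W.card + 1 :=
  Finset.card_insert_of_notMem fun hW =>
    hU c w.start_mem_support (h.W_subset _ hW (List.mem_toFinset.2 w.start_mem_support))

theorem mem_B_of_mem (h : TwoThreeCertificate G S H U B X P W) {x : V} (hx : x ∈ X) : x ∉ B :=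
  Finset.disjoint_left.1 h.disjoint hx

theorem eq_of_mem_P (h : TwoThreeCertificate G S H U B X P W) {x y z : V} (hx : x ∈ X)
    (hy : y ∈ X) (hzx : z ∈ P x) (hzy : z ∈ P y) : x = y := by
  by_contra hne
  exact Set.disjoint_left.1 (h.P_disjoint x hx y hy hne) hzx hzy

theorem exists_walk_to_U (h : TwoThreeCertificate G S H U B X P W) {x a : V} (hx : x ∈ X)
    (haS : a ∉ S) (hax : a ∉ P x) (ha : a ∈ U ∨ ∃ y ∈ X, a ∈ P y) :
    ∃ q ∈ U, q ∉ B ∧ q ≠ x ∧ ∃ w : G.Walk a q,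
      ∀ z ∈ w.support, (z ∈ U → z = q) ∧ ∀ t ∈ X, z ∈ P t → t = q := by
  rcases ha with ha | ⟨y, hy, hay⟩
  · refine ⟨a, ha, fun haB => haS (h.B_selected haB), ?_, .nil, ?_⟩
    · rintro rfl
      exact hax (h.mem_P_self hx)
    · intro z hz
      obtain rfl : z = a := by simpa using hz
      exact ⟨fun _ => rfl, fun t ht hzt => (h.P_inter t ht z hzt ha).symm⟩
  · obtain ⟨w, hw⟩ := h.P_walk y hy a hay
    refine ⟨y, h.X_subset hy, h.mem_B_of_mem hy, ?_, w.reverse, ?_⟩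
    · rintro rfl
      exact hax hay
    · intro z hz
      have hzy : z ∈ P y := hw z (by simpa using hz)
      exact ⟨h.P_inter y hy z hzy, fun t ht hzt => h.eq_of_mem_P ht hy hzt hzy⟩

/-- A cycle meeting `P x` and also `U` or another of the sets `P y` yields a new path. -/
theorem isCertified_of_mem_P_of_hit (h : TwoThreeCertificate G S H U B X P W)
    (hS : S.card ≤ B.card + X.card + W.card) {c : V} {w : G.Walk c c}
    (hwS : ∀ z ∈ w.support, z ∉ S) {x z b : V} (hx : x ∈ X) (hz : z ∈ w.support)
    (hzx : z ∈ P x) (hb : b ∈ w.support) (hbx : b ∉ P x) (hbU : b ∈ U ∨ ∃ y ∈ X, b ∈ P y) :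
    ∃ S', S ⊆ S' ∧ IsCertified G S' (2 * B.card + X.card + W.card + 1) := by
  obtain ⟨w₁, hw₁⟩ := h.P_walk x hx z hzx
  obtain ⟨w₀, hw₀⟩ := w.exists_walk_of_mem_support hz hb
  obtain ⟨a, ⟨hax, haU⟩, w₂, hw₂, hw₂a⟩ :=
    w₀.exists_first_hit {a | a ∉ P x ∧ (a ∈ U ∨ ∃ y ∈ X, a ∈ P y)} ⟨hbx, hbU⟩
  have hw₂w : ∀ y ∈ w₂.support, y ∈ w.support := fun y hy => hw₀ y (hw₂ y hy)
  obtain ⟨q, hqU, hqB, hqx, w₃, hw₃⟩ :=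
    h.exists_walk_to_U hx (hwS a (hw₂w a w₂.end_mem_support)) hax haU
  have hxU := h.X_subset hx
  refine h.isCertified_of_walk hS hxU hqU (h.mem_B_of_mem hx) hqB hqx.symm
    (w₁.append (w₂.append w₃)) ?_ ?_ ?_
  · intro y hy hyU
    rw [Walk.mem_support_append_iff, Walk.mem_support_append_iff] at hy
    rcases hy with hy | hy | hy
    · exact Or.inl (h.P_inter x hx y (hw₁ y hy) hyU)
    · by_cases hyx : y ∈ P x
      · exact Or.inl (h.P_inter x hx y hyx hyU)
      · obtain rfl := hw₂a y hy ⟨hyx, Or.inl hyU⟩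
        exact Or.inr ((hw₃ y w₃.start_mem_support).1 hyU)
    · exact Or.inr ((hw₃ y hy).1 hyU)
  · intro _ he
    rw [Walk.edges_append, Walk.edges_append, List.mem_append, List.mem_append] at he
    rcases he with he | he | he
    · have := Walk.snd_mem_support_of_mem_edges _ he
      exact hqx (h.P_inter x hx q (hw₁ q this) hqU)
    · have := Walk.fst_mem_support_of_mem_edges _ he
      exact hwS x (hw₂w x this) (h.X_selected hx)
    · have := Walk.fst_mem_support_of_mem_edges _ he
      exact hqx ((hw₃ x this).1 hxU).symm
  · intro y hy t ht hyt
    rw [Walk.mem_support_append_iff, Walk.mem_support_append_iff] at hy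
    rcases hy with hy | hy | hy
    · exact Or.inl (h.eq_of_mem_P ht hx hyt (hw₁ y hy))
    · by_cases hyx : y ∈ P x
      · exact Or.inl (h.eq_of_mem_P ht hx hyt hyx)
      · obtain rfl := hw₂a y hy ⟨hyx, Or.inr ⟨t, ht, hyt⟩⟩
        exact Or.inr ((hw₃ y w₃.start_mem_support).2 t ht hyt)
    · exact Or.inr ((hw₃ y hy).2 t ht hyt)

open Classical in
/-- A cycle meeting `P x` but neither `U` nor any other `P y` is added to `H` together with a path
joining it to `x`. -/
theorem isCertified_of_mem_P (h : TwoThreeCertificate G S H U B X P W)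
    (hS : S.card ≤ B.card + X.card + W.card) {c : V} {w : G.Walk c c} (hw : w.IsCycle)
    (hwU : ∀ z ∈ w.support, z ∉ U) {x z : V} (hx : x ∈ X) (hz : z ∈ w.support) (hzx : z ∈ P x)
    (hwP : ∀ y ∈ X, ∀ z ∈ w.support, z ∈ P y → y = x) :
    ∃ S', S ⊆ S' ∧ IsCertified G S' (2 * B.card + X.card + W.card + 1) := by
  have h₁ := h.addCycle hw hwU (Finset.erase_subset x X) fun y hy z hz hzy =>
    Finset.ne_of_mem_erase hy (hwP y (Finset.mem_of_mem_erase hy) z hz hzy)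
  obtain ⟨w₀, hw₀⟩ := h.P_walk x hx z hzx
  obtain ⟨u, hu, w₁, hw₁, hw₁u⟩ := w₀.exists_first_hit {z | z ∈ w.support} hz
  change u ∈ w.support at hu
  have hxU := h.X_subset hx
  have hxw : x ∉ w.support := fun hxw => hwU x hxw hxU
  have hxu : x ≠ u := fun hxu => hxw (hxu ▸ hu)
  have huB : u ∉ B := fun huB => hwU u hu (h.B_subset huB)
  obtain ⟨H', U', h'⟩ := h₁.addWalk (Finset.mem_union_left _ hxU)
    (Finset.mem_union_right _ (List.mem_toFinset.2 hu)) (h.mem_B_of_mem hx) huB hxu w₁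
    (by
      intro y hy hyU
      rw [Finset.mem_union, List.mem_toFinset] at hyU
      exact hyU.imp (h.P_inter x hx y (hw₀ y (hw₁ y hy))) (hw₁u y hy))
    (by
      rintro (hadj | hadj)
      · exact absurd (h.mem_of_adj _ _ hadj.symm) (hwU u hu)
      · exact absurd (Walk.mem_support_of_adj_toSubgraph hadj) hxw)
    (by
      intro y hy t ht hyt
      exact Or.inl (h.eq_of_mem_P (Finset.mem_of_mem_erase ht) hx hyt (hw₀ y (hw₁ y hy))))
  have h1 : (insert x (insert u B)).card = B.card + 2 := by
    rw [Finset.card_insert_of_notMem, Finset.card_insert_of_notMem huB]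
    simp [hxu, h.mem_B_of_mem hx]
  have h2 : (insert x (insert u (insert c S))).card ≤ S.card + 2 := by
    rw [Finset.insert_eq_of_mem]
    · have := Finset.card_insert_le u (insert c S)
      have := Finset.card_insert_le c S
      omega
    · exact Finset.mem_insert_of_mem (Finset.mem_insert_of_mem (h.X_selected hx))
  have h3 : (X.erase x \ {x, u}).card + 1 = X.card := by
    rw [Finset.sdiff_eq_self_of_disjoint, Finset.card_erase_add_one hx]
    rw [Finset.disjoint_left]
    intro y hy hy'
    rw [Finset.mem_insert, Finset.mem_singleton] at hy'
    rcases hy' with rfl | rfl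
    · exact Finset.ne_of_mem_erase hy rfl
    · exact hwU y hu (h.X_subset (Finset.mem_of_mem_erase hy))
  have h4 := h.card_insert_cycle hwU
  refine ⟨_, ?_, _, _, _, _, _, _, h', ?_, ?_⟩
  · exact (Finset.subset_insert _ _).trans
      ((Finset.subset_insert _ _).trans (Finset.subset_insert _ _))
  · omega
  · omega

/-- A cycle of unselected vertices has an edge outside `H`. -/
theorem exists_edge_notMem (h : TwoThreeCertificate G S H U B X P W) {c : V} {w : G.Walk c c}
    (hw : w.IsCycle) (hwS : ∀ z ∈ w.support, z ∉ S) (hwU : ∀ z ∈ w.support, z ∈ U) :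
    ∃ a b, s(a, b) ∈ w.edges ∧ ¬ H.Adj a b := by
  by_contra! hcon
  have hclosed : ∀ a ∈ w.support, ∀ b, H.Adj a b → b ∈ w.support := by
    intro a ha b hab
    have hsub : w.toSubgraph.neighborSet a ⊆ H.neighborSet a := fun d hd =>
      hcon a d (Walk.adj_toSubgraph_iff_mem_edges.1 hd)
    have h2 := h.degree_two a (hwU a ha) fun haB => hwS a ha (h.B_selected haB)
    have heq : w.toSubgraph.neighborSet a = H.neighborSet a := by
      refine Set.Finite.eq_of_subset_of_encard_le' (Set.finite_of_encard_eq_coe (k := 2) ?_) hsub ?_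
      · exact h2
      · rw [h2, hw.encard_neighborSet_toSubgraph ha]
    have hb : b ∈ w.toSubgraph.neighborSet a := heq ▸ hab
    exact Walk.mem_support_of_adj_toSubgraph (Subgraph.Adj.symm hb)
  obtain ⟨s, hs, ⟨r⟩⟩ := h.reachable c (hwU c w.start_mem_support)
  have key : ∀ {a b : V} (r : H.Walk a b), a ∈ w.support → b ∈ w.support := by
    intro a b r
    induction r with
    | nil => exact id
    | cons hab _ ih => exact fun ha => ih (hclosed _ ha _ hab)
  exact hwS s (key r w.start_mem_support) hs

/-- If two vertices of a cycle of unselected vertices that misses all `P x` lie in `U`, the cycle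
contains a new path. -/
theorem isCertified_of_two_mem_U (h : TwoThreeCertificate G S H U B X P W)
    (hS : S.card ≤ B.card + X.card + W.card) {c : V} {w : G.Walk c c} (hw : w.IsCycle)
    (hwS : ∀ z ∈ w.support, z ∉ S) (hwP : ∀ x ∈ X, ∀ z ∈ w.support, z ∉ P x) {p q : V}
    (hp : p ∈ w.support) (hq : q ∈ w.support) (hpU : p ∈ U) (hqU : q ∈ U) (hpq : p ≠ q) :
    ∃ S', S ⊆ S' ∧ IsCertified G S' (2 * B.card + X.card + W.card + 1) := by
  have hwB : ∀ z ∈ w.support, z ∉ B := fun z hz hzB => hwS z hz (h.B_selected hzB)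
  by_cases hall : ∀ z ∈ w.support, z ∈ U
  · obtain ⟨a, b, hab, hH⟩ := h.exists_edge_notMem hw hwS hall
    have ha := Walk.fst_mem_support_of_mem_edges _ hab
    have hb := Walk.snd_mem_support_of_mem_edges _ hab
    have hadj : G.Adj a b := Walk.adj_of_mem_edges _ hab
    refine h.isCertified_of_walk hS (hall a ha) (hall b hb) (hwB a ha) (hwB b hb) hadj.ne
      hadj.toWalk ?_ (fun hc => absurd hc hH) ?_
    · intro z hz _
      simpa using hz
    · intro z hz x hx hzx
      have hz' : z = a ∨ z = b := by simpa using hz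
      rcases hz' with rfl | rfl
      · exact absurd hzx (hwP x hx z ha)
      · exact absurd hzx (hwP x hx z hb)
  · push Not at hall
    obtain ⟨d, hd, hdU⟩ := hall
    have hdne : ∀ u ∈ U, d ≠ u := fun u hu hdu => hdU (hdu ▸ hu)
    obtain ⟨r, hr, hrw⟩ := hw.exists_walk_avoiding hd hq hp (hdne p hpU) hpq.symm
    obtain ⟨q', hq'U, w₁, hw₁, hw₁q⟩ := r.exists_first_hit (U : Set V) hqU
    have hw₁w : ∀ z ∈ w₁.support, z ∈ w.support := fun z hz => hrw z (hw₁ z hz)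
    have hpq' : p ≠ q' := by
      rintro rfl
      exact hr (hw₁ p w₁.end_mem_support)
    have hq' : q' ∈ w.support := hw₁w q' w₁.end_mem_support
    obtain ⟨r', hr', hrw'⟩ := hw.exists_walk_avoiding hd hp hq' (hdne q' hq'U) hpq'
    obtain ⟨p', hp'U, w₂, hw₂, hw₂p⟩ := r'.exists_first_hit (U : Set V) hpU
    have hw₂w : ∀ z ∈ w₂.support, z ∈ w.support := fun z hz => hrw' z (hw₂ z hz)
    have hp'q' : p' ≠ q' := by
      rintro rfl
      exact hr' (hw₂ p' w₂.end_mem_support)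
    have hp' : p' ∈ w.support := hw₂w p' w₂.end_mem_support
    refine h.isCertified_of_walk hS hp'U hq'U (hwB p' hp') (hwB q' hq') hp'q'
      (w₂.reverse.append w₁) ?_ ?_ ?_
    · intro z hz hzU
      rw [Walk.mem_support_append_iff, Walk.support_reverse, List.mem_reverse] at hz
      exact hz.imp (fun hz => hw₂p z hz hzU) (fun hz => hw₁q z hz hzU)
    · intro _ he
      rw [Walk.edges_append, Walk.edges_reverse, List.mem_append, List.mem_reverse] at he
      rcases he with he | he
      · exact hp'q' (hw₂p q' (Walk.snd_mem_support_of_mem_edges _ he) hq'U).symm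
      · exact hp'q' (hw₁q p' (Walk.fst_mem_support_of_mem_edges _ he) hp'U)
    · intro z hz x hx hzx
      rw [Walk.mem_support_append_iff, Walk.support_reverse, List.mem_reverse] at hz
      exact absurd hzx (hwP x hx z (hz.elim (hw₂w z) (hw₁w z)))

/-- As long as the selected set is not a feedback vertex set, it can be enlarged so as to increase
the potential of its certificate. -/
theorem isCertified_of_hasCycleIn (h : TwoThreeCertificate G S H U B X P W)
    (hS : S.card ≤ B.card + X.card + W.card) (hc : HasCycleIn G {v | v ∉ S}) :
    ∃ S', S ⊆ S' ∧ IsCertified G S' (2 * B.card + X.card + W.card + 1) := by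
  classical
  obtain ⟨c, w, hw, hwS⟩ := hc
  replace hwS : ∀ z ∈ w.support, z ∉ S := hwS
  by_cases hP : ∃ x ∈ X, ∃ z ∈ w.support, z ∈ P x
  · obtain ⟨x, hx, z, hz, hzx⟩ := hP
    by_cases hb : ∃ b ∈ w.support, b ∉ P x ∧ (b ∈ U ∨ ∃ y ∈ X, b ∈ P y)
    · obtain ⟨b, hbw, hbx, hbU⟩ := hb
      exact h.isCertified_of_mem_P_of_hit hS hwS hx hz hzx hbw hbx hbU
    · push Not at hb
      refine h.isCertified_of_mem_P hS hw ?_ hx hz hzx ?_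
      · intro y hy hyU
        by_cases hyx : y ∈ P x
        · exact hwS y hy (h.P_inter x hx y hyx hyU ▸ h.X_selected hx)
        · exact (hb y hy hyx).1 hyU
      · intro y hy t ht hty
        by_cases htx : t ∈ P x
        · exact h.eq_of_mem_P hy hx hty htx
        · exact absurd hty ((hb t ht htx).2 y hy)
  · push Not at hP
    by_cases hU : ∃ p ∈ w.support, p ∈ U
    · obtain ⟨p, hp, hpU⟩ := hU
      by_cases hq : ∃ q ∈ w.support, q ∈ U ∧ p ≠ q
      · obtain ⟨q, hq, hqU, hpq⟩ := hq
        exact h.isCertified_of_two_mem_U hS hw hwS hP hp hq hpU hqU hpq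
      · push Not at hq
        have hpX : p ∉ X := fun hpX => hwS p hp (h.X_selected hpX)
        have h' := h.addCritical hw hpU (fun hpB => hwS p hp (h.B_selected hpB)) hp
          (fun z hz hzU => (hq z hz hzU).symm) hP
        have h1 := Finset.card_insert_of_notMem hpX
        have h2 := Finset.card_insert_le p S
        exact ⟨_, Finset.subset_insert _ _, _, _, _, _, _, _, h', by omega, by omega⟩
    · push Not at hU
      have h' := h.addCycle hw hU subset_rfl hP
      have h1 := h.card_insert_cycle hU
      have h2 := Finset.card_insert_le c S
      exact ⟨_, Finset.subset_insert _ _, _, _, _, _, _, _, h', by omega, by omega⟩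

end TwoThreeCertificate

section Certified

variable {V : Type*} {G : SimpleGraph V} {S : Finset V} {k : ℕ}

theorem IsCertified.mono {G' : SimpleGraph V} (h : IsCertified G S k) (hG : G ≤ G') :
    IsCertified G' S k := by
  obtain ⟨H, U, B, X, P, W, hc, h1, h2⟩ := h
  exact ⟨H, U, B, X, P, W, hc.mono hG, h1, h2⟩

theorem isCertified_empty (G : SimpleGraph V) : IsCertified G ∅ 0 :=
  ⟨_, _, _, _, fun _ => ∅, _, TwoThreeCertificate.empty G _, by simp, by simp⟩

theorem IsCertified.card_le (h : IsCertified G S k) {F : Finset V}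
    (hF : ¬ HasCycleIn G {v | v ∉ F}) : S.card ≤ 5 * F.card := by
  obtain ⟨H, U, B, X, P, W, hc, h1, -⟩ := h
  exact h1.trans (hc.card_le hF)

theorem IsCertified.le (h : IsCertified G S k) {F : Finset V}
    (hF : ¬ HasCycleIn G {v | v ∉ F}) : k ≤ 10 * F.card := by
  obtain ⟨H, U, B, X, P, W, hc, -, h2⟩ := h
  have := hc.card_le hF
  omega

/-- A certified set can be enlarged to a certified feedback vertex set. -/
theorem IsCertified.exists_superset {F : Finset V} (hF : ¬ HasCycleIn G {v | v ∉ F})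
    (h : IsCertified G S k) :
    ∃ S', S ⊆ S' ∧ IsCertified G S' 0 ∧ ¬ HasCycleIn G {v | v ∉ S'} := by
  induction hm : 10 * F.card - k using Nat.strong_induction_on generalizing S k with
  | _ m ih =>
    by_cases hc : HasCycleIn G {v | v ∉ S}
    · have hk := h.le hF
      obtain ⟨H, U, B, X, P, W, hcert, h1, h2⟩ := h
      obtain ⟨S₁, hS₁, hcert₁⟩ := hcert.isCertified_of_hasCycleIn h1 hc
      have hk₁ := hcert₁.le hF
      obtain ⟨S₂, hS₂, hcert₂⟩ := ih _ (by omega) hcert₁ rfl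
      exact ⟨S₂, hS₁.trans hS₂, hcert₂⟩
    · obtain ⟨H, U, B, X, P, W, hcert, h1, -⟩ := h
      exact ⟨S, subset_rfl, ⟨H, U, B, X, P, W, hcert, h1, Nat.zero_le _⟩, hc⟩

end Certified

section Online

/-- The `i`-th prefix of `G`, with its vertices read as natural numbers. -/
def prefixGraph {n : ℕ} (G : SimpleGraph (Fin n)) (i : ℕ) : SimpleGraph ℕ where
  Adj a b := ∃ x y : Fin n, (x : ℕ) < i ∧ (y : ℕ) < i ∧ G.Adj x y ∧ (x : ℕ) = a ∧ (y : ℕ) = b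
  symm := ⟨fun _ _ ⟨x, y, hx, hy, h, hxa, hyb⟩ => ⟨y, x, hy, hx, h.symm, hyb, hxa⟩⟩
  loopless := ⟨fun _ ⟨_, _, _, _, h, hxa, hyb⟩ => h.ne (Fin.ext (hxa.trans hyb.symm))⟩

theorem prefixGraph_mono {n : ℕ} (G : SimpleGraph (Fin n)) : Monotone (prefixGraph G) :=
  fun _ _ hij _ _ ⟨x, y, hx, hy, h⟩ => ⟨x, y, hx.trans_le hij, hy.trans_le hij, h⟩

theorem prefixGraph_congr {n m : ℕ} {G : SimpleGraph (Fin n)} {G' : SimpleGraph (Fin m)} {i : ℕ}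
    (hn : i ≤ n) (hm : i ≤ m)
    (h : ∀ x y : Fin i, G.Adj (Fin.castLE hn x) (Fin.castLE hn y) ↔
      G'.Adj (Fin.castLE hm x) (Fin.castLE hm y)) {j : ℕ} (hj : j ≤ i) :
    prefixGraph G j = prefixGraph G' j := by
  ext a b
  constructor
  · rintro ⟨x, y, hx, hy, hxy, rfl, rfl⟩
    exact ⟨⟨x, by omega⟩, ⟨y, by omega⟩, hx, hy,
      (h ⟨x, by omega⟩ ⟨y, by omega⟩).1 hxy, rfl, rfl⟩
  · rintro ⟨x, y, hx, hy, hxy, rfl, rfl⟩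
    exact ⟨⟨x, by omega⟩, ⟨y, by omega⟩, hx, hy,
      (h ⟨x, by omega⟩ ⟨y, by omega⟩).2 hxy, rfl, rfl⟩

/-- The part of a cycle-free vertex set of `G` seen so far is cycle-free in the prefix graph. -/
theorem not_hasCycleIn_prefixGraph {n : ℕ} {G : SimpleGraph (Fin n)} {F : Finset (Fin n)}
    (hF : IsFVS G F) (i : ℕ) :
    ¬ HasCycleIn (prefixGraph G i) {v | v ∉ F.map Fin.valEmbedding} := by
  rintro ⟨c, w, hw, hwF⟩
  have hlt : ∀ v ∈ w.support, v < n := by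
    intro v hv
    obtain ⟨u, hu⟩ : ∃ u, (prefixGraph G i).Adj v u := by
      have := (hw.ncard_neighborSet_toSubgraph_eq_two hv)
      obtain ⟨u, hu⟩ := Set.nonempty_of_ncard_ne_zero (this.trans_ne two_ne_zero)
      exact ⟨u, w.toSubgraph.adj_sub hu⟩
    obtain ⟨x, y, -, -, -, rfl, -⟩ := hu
    exact x.2
  refine (induce_isAcyclic_iff (G := prefixGraph G i)
    (A := {v | v < n ∧ v ∉ F.map Fin.valEmbedding})).1 ?_
    ⟨c, w, hw, fun v hv => ⟨hlt v hv, hwF v hv⟩⟩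
  refine IsAcyclic.comap (G' := G.induce {v | v ∉ F}) (f := ⟨fun v =>
    ⟨⟨v, v.2.1⟩, fun hv => v.2.2 (Finset.mem_map.2 ⟨_, hv, rfl⟩)⟩, ?_⟩) ?_ hF
  · rintro a b ⟨x, y, -, -, hxy, hxa, hyb⟩
    have hxa' : x = ⟨a, a.2.1⟩ := Fin.ext hxa
    have hyb' : y = ⟨b, b.2.1⟩ := Fin.ext hyb
    subst hxa' hyb'
    exact hxy
  · intro a b hab
    exact Subtype.ext (congrArg (fun v => (v.1 : ℕ)) hab)

open Classical in
/-- Enlarges a certified set to a certified feedback vertex set whenever that is possible. -/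
noncomputable def certifiedExtension (K : SimpleGraph ℕ) (S : Finset ℕ) : Finset ℕ :=
  if h : ∃ S', S ⊆ S' ∧ IsCertified K S' 0 ∧ ¬ HasCycleIn K {v | v ∉ S'} then h.choose else S

theorem subset_certifiedExtension (K : SimpleGraph ℕ) (S : Finset ℕ) :
    S ⊆ certifiedExtension K S := by
  unfold certifiedExtension
  split_ifs with h
  · exact h.choose_spec.1
  · rfl

theorem certifiedExtension_spec {K : SimpleGraph ℕ} {S F : Finset ℕ}
    (hF : ¬ HasCycleIn K {v | v ∉ F}) (h : IsCertified K S 0) :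
    IsCertified K (certifiedExtension K S) 0 ∧
      ¬ HasCycleIn K {v | v ∉ certifiedExtension K S} := by
  have h' := h.exists_superset hF
  rw [certifiedExtension, dif_pos h']
  exact h'.choose_spec.2

/-- The certified set maintained along a sequence of graphs. -/
noncomputable def certifiedSequence (K : ℕ → SimpleGraph ℕ) : ℕ → Finset ℕ
  | 0 => ∅
  | i + 1 => certifiedExtension (K (i + 1)) (certifiedSequence K i)

theorem certifiedSequence_congr {K K' : ℕ → SimpleGraph ℕ} {i : ℕ}
    (h : ∀ j ≤ i, K j = K' j) : certifiedSequence K i = certifiedSequence K' i := by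
  induction i with
  | zero => rfl
  | succ i ih =>
    rw [certifiedSequence, certifiedSequence, h _ le_rfl, ih fun j hj => h j (hj.trans i.le_succ)]

theorem isFVS_univ {n : ℕ} (G : SimpleGraph (Fin n)) : IsFVS G Finset.univ := by
  rw [IsFVS, induce_isAcyclic_iff]
  rintro ⟨c, w, -, hw⟩
  exact hw c w.start_mem_support (Finset.mem_univ c)

theorem certifiedSequence_spec {n : ℕ} (G : SimpleGraph (Fin n)) (i : ℕ) :
    IsCertified (prefixGraph G i) (certifiedSequence (prefixGraph G) i) 0 ∧
      ¬ HasCycleIn (prefixGraph G i) {v | v ∉ certifiedSequence (prefixGraph G) i} := by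
  induction i with
  | zero =>
    refine ⟨isCertified_empty _, ?_⟩
    rintro ⟨c, w, hw, -⟩
    cases w with
    | nil => exact hw.ne_nil rfl
    | cons h _ => exact absurd h.choose_spec.choose_spec.1 (Nat.not_lt_zero _)
  | succ i ih =>
    exact certifiedExtension_spec (not_hasCycleIn_prefixGraph (isFVS_univ G) _)
      (ih.1.mono (prefixGraph_mono G i.le_succ))

/-- The vertices among the first `i` ones that the certified online algorithm has selected. -/
noncomputable def chosenSet (n : ℕ) (G : SimpleGraph (Fin n)) (i : ℕ) : Finset (Fin n) :=
  {v : Fin n | (v : ℕ) < i ∧ (v : ℕ) ∈ certifiedSequence (prefixGraph G) i}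

theorem mem_chosenSet {n : ℕ} {G : SimpleGraph (Fin n)} {i : ℕ} {v : Fin n} :
    v ∈ chosenSet n G i ↔ (v : ℕ) < i ∧ (v : ℕ) ∈ certifiedSequence (prefixGraph G) i := by
  simp [chosenSet]

theorem image_val_chosenSet {n : ℕ} (G : SimpleGraph (Fin n)) {i : ℕ} (hi : i ≤ n) :
    (chosenSet n G i).image Fin.val =
      {a ∈ Finset.range i | a ∈ certifiedSequence (prefixGraph G) i} := by
  ext a
  simp only [Finset.mem_image, mem_chosenSet, Finset.mem_filter, Finset.mem_range]
  constructor
  · rintro ⟨v, hv, rfl⟩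
    exact hv
  · exact fun h => ⟨⟨a, h.1.trans_le hi⟩, h, rfl⟩

theorem image_val_chosenSet_congr {n m : ℕ} (G : SimpleGraph (Fin n)) (G' : SimpleGraph (Fin m))
    (i : ℕ) (hn : i ≤ n) (hm : i ≤ m)
    (h : ∀ x y : Fin i, G.Adj (Fin.castLE hn x) (Fin.castLE hn y) ↔
      G'.Adj (Fin.castLE hm x) (Fin.castLE hm y)) :
    (chosenSet n G i).image Fin.val = (chosenSet m G' i).image Fin.val := by
  rw [image_val_chosenSet G hn, image_val_chosenSet G' hm,
    certifiedSequence_congr fun j hj => prefixGraph_congr hn hm h hj]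

theorem chosenSet_subset_succ (n : ℕ) (G : SimpleGraph (Fin n)) (i : ℕ) :
    chosenSet n G i ⊆ chosenSet n G (i + 1) := fun _ hv =>
  have hv := mem_chosenSet.1 hv
  mem_chosenSet.2 ⟨hv.1.trans i.lt_succ_self, subset_certifiedExtension _ _ hv.2⟩

theorem induce_compl_chosenSet_isAcyclic (n : ℕ) (G : SimpleGraph (Fin n)) (i : ℕ) :
    (G.induce {v : Fin n | (v : ℕ) < i ∧ v ∉ chosenSet n G i}).IsAcyclic := by
  refine IsAcyclic.comap (G' := (prefixGraph G i).induce
    {v | v ∉ certifiedSequence (prefixGraph G) i}) (f := ⟨fun v =>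
      ⟨v.1, fun hv => v.2.2 (mem_chosenSet.2 ⟨v.2.1, hv⟩)⟩, ?_⟩) ?_
    (induce_isAcyclic_iff.2 (certifiedSequence_spec G i).2)
  · intro a b hab
    exact ⟨a.1, b.1, a.2.1, b.2.1, hab, rfl, rfl⟩
  · intro a b hab
    exact Subtype.ext (Fin.ext (congrArg Subtype.val hab))

theorem isFVS_chosenSet (n : ℕ) (G : SimpleGraph (Fin n)) : IsFVS G (chosenSet n G n) := by
  have h : {v : Fin n | v ∉ chosenSet n G n} =
      {v : Fin n | (v : ℕ) < n ∧ v ∉ chosenSet n G n} := by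
    simp
  rw [IsFVS, h]
  exact induce_compl_chosenSet_isAcyclic n G n

theorem card_chosenSet_le (n : ℕ) (G : SimpleGraph (Fin n)) :
    (chosenSet n G n).card ≤ 5 * fvsNum G := by
  obtain ⟨F, hF, hFc⟩ := Nat.sInf_mem (s := {k | ∃ S : Finset (Fin n), IsFVS G S ∧ S.card = k})
    ⟨_, _, isFVS_univ G, rfl⟩
  have h := (certifiedSequence_spec G n).1.card_le (not_hasCycleIn_prefixGraph hF n)
  rw [Finset.card_map, hFc] at h
  refine le_trans ?_ h
  rw [← Finset.card_image_of_injective _ Fin.val_injective]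
  exact Finset.card_le_card (Finset.image_subset_iff.2 fun v hv => (mem_chosenSet.1 hv).2)

/-- The certified online algorithm, selecting every vertex right away. -/
noncomputable def selectingAlgorithm : DelayedFVSAlgorithmRes where
  S := chosenSet
  R _ _ _ := ∅
  memS_lt _ _ _ _ hv := (mem_chosenSet.1 hv).1
  memR_lt _ _ _ _ hv := absurd hv (Finset.notMem_empty _)
  online _ _ G G' i hn hm h := ⟨image_val_chosenSet_congr G G' i hn hm h, rfl⟩
  irrevocableS n G i _ := chosenSet_subset_succ n G i
  irrevocableR _ _ _ _ := Finset.Subset.refl _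
  valid n G i _ := by
    rw [Finset.union_empty]
    exact induce_compl_chosenSet_isAcyclic n G i

/-- The certified online algorithm, reserving every vertex instead of selecting it. -/
noncomputable def reservingAlgorithm : DelayedFVSAlgorithmRes where
  S _ _ _ := ∅
  R := chosenSet
  memS_lt _ _ _ _ hv := absurd hv (Finset.notMem_empty _)
  memR_lt _ _ _ _ hv := (mem_chosenSet.1 hv).1
  online _ _ G G' i hn hm h := ⟨rfl, image_val_chosenSet_congr G G' i hn hm h⟩
  irrevocableS _ _ _ _ := Finset.Subset.refl _
  irrevocableR n G i _ := chosenSet_subset_succ n G i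
  valid n G i _ := by
    rw [Finset.empty_union]
    exact induce_compl_chosenSet_isAcyclic n G i

theorem resCost_selectingAlgorithm_le (α : ℝ) (n : ℕ) (G : SimpleGraph (Fin n)) :
    resCost selectingAlgorithm α n G ≤ 5 * fvsNum G := by
  have h0 : sInf {k : ℕ | ∃ T : Finset (Fin n), IsFVS G (chosenSet n G n ∪ T) ∧ T.card = k} = 0 :=
    Nat.sInf_eq_zero.2 (.inl ⟨∅, by simpa using isFVS_chosenSet n G, rfl⟩)
  simp only [resCost, selectingAlgorithm, h0, Finset.card_empty, Nat.cast_zero, mul_zero, add_zero]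
  exact_mod_cast card_chosenSet_le n G

theorem resCost_reservingAlgorithm_le {α : ℝ} (hα : 0 ≤ α) (n : ℕ) (G : SimpleGraph (Fin n)) :
    resCost reservingAlgorithm α n G ≤ (1 + 5 * α) * fvsNum G := by
  have h : ((chosenSet n G n).card : ℝ) ≤ 5 * fvsNum G := by exact_mod_cast card_chosenSet_le n G
  simp only [resCost, reservingAlgorithm, Finset.card_empty, Nat.cast_zero, zero_add,
    Finset.empty_union]
  change (fvsNum G : ℝ) + _ ≤ _
  linarith [mul_le_mul_of_nonneg_left h hα]

end Online

/-- There is a `min {5, 1 + 5α}`-competitive deterministic delayed-decision algorithm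
with reservations for online Feedback Vertex Set. -/
theorem fvs_reservation_upper_bound (α : ℝ) (hα : 0 ≤ α) :
    ∃ B : DelayedFVSAlgorithmRes, ∀ (n : ℕ) (G : SimpleGraph (Fin n)),
      resCost B α n G ≤ min 5 (1 + 5 * α) * (fvsNum G : ℝ) := by
  rcases le_total 5 (1 + 5 * α) with h | h
  · rw [min_eq_left h]
    exact ⟨selectingAlgorithm, resCost_selectingAlgorithm_le α⟩
  · rw [min_eq_right h]
    exact ⟨reservingAlgorithm, resCost_reservingAlgorithm_le hα⟩
end
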